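/- Let M ⊂ ℂ^N be a smooth (C^∞) real hypersurface which is holomorphically nondegenerate at p₀ ∈ M and minimal at p₀. Then dim_ℝ aut(M, p₀) ≤ (2N−1)·C(4N−3, 2N−2) (binomial coefficient); equivalently, every finite family of infinitesimal CR automorphisms of M defined near p₀ whose germs at p₀ are linearly independent over ℝ has at most (2N−1)·C(4N−3, 2N−2) members. -/

import Mathlib

open scoped Topology

noncomputable section

/-- Points of `ℂ^N`. -/
abbrev CPt (N : ℕ) := Fin N → ℂ

/-- The Wirtinger derivative `∂u/∂z_m = (1/2)(∂u/∂x_m − i ∂u/∂y_m)`. -/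
noncomputable def wz {N : ℕ} (m : Fin N) (u : CPt N → ℂ) (z : CPt N) : ℂ :=
  (1 / 2) * (fderiv ℝ u z (Pi.single m 1) - Complex.I * fderiv ℝ u z (Pi.single m Complex.I))

/-- The Wirtinger derivative `∂u/∂z̄_m = (1/2)(∂u/∂x_m + i ∂u/∂y_m)`. -/
noncomputable def wzb {N : ℕ} (m : Fin N) (u : CPt N → ℂ) (z : CPt N) : ℂ :=
  (1 / 2) * (fderiv ℝ u z (Pi.single m 1) + Complex.I * fderiv ℝ u z (Pi.single m Complex.I))

/-- `ρ` is a local defining function of `M` near `p`: smooth, real valued, with nonvanishing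
differential, and `M ∩ U = {ρ = 0} ∩ U`. -/
def DefiningFn (N : ℕ) (M : Set (CPt N)) (U : Set (CPt N)) (ρ : CPt N → ℝ) (p : CPt N) :
    Prop :=
  IsOpen U ∧ p ∈ U ∧ ContDiffOn ℝ (⊤ : ℕ∞) ρ U ∧
    (M ∩ U = {z | z ∈ U ∧ ρ z = 0}) ∧ ∀ z ∈ U, fderiv ℝ ρ z ≠ 0

/-- `M` is a smooth real hypersurface of `ℂ^N`. -/
def IsHypersurface (N : ℕ) (M : Set (CPt N)) : Prop :=
  ∀ p ∈ M, ∃ U ρ, DefiningFn N M U ρ p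

/-- `a` is (the coefficient matrix of) a basis `L_j̄ = Σ_m a_{jm} ∂/∂z̄_m` of the CR vector
fields of `M` on `U`: smooth coefficients, tangency `Σ_m a_{jm} ∂ρ/∂z̄_m = 0` on `M ∩ U`, and
pointwise linear independence. -/
def CRBasisOn (N n : ℕ) (M : Set (CPt N)) (U : Set (CPt N)) (ρ : CPt N → ℝ)
    (a : Fin n → Fin N → CPt N → ℂ) : Prop :=
  (∀ j m, ContDiffOn ℝ (⊤ : ℕ∞) (a j m) U) ∧
  (∀ j, ∀ z ∈ M ∩ U, (∑ m, a j m z * wzb m (fun w => ((ρ w : ℝ) : ℂ)) z) = 0) ∧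
  (∀ z ∈ M ∩ U, LinearIndependent ℂ fun j : Fin n => fun m => a j m z)

/-- The CR operator `L_j̄ = Σ_m a_{jm} ∂/∂z̄_m` acting on functions. -/
noncomputable def crOp {N n : ℕ} (a : Fin n → Fin N → CPt N → ℂ) (j : Fin n)
    (u : CPt N → ℂ) : CPt N → ℂ :=
  fun z => ∑ m, a j m z * wzb m u z

/-- The iterated CR operator `L^ᾱ = L_1̄^{α₁} ⋯ L_n̄^{α_n}`. -/
noncomputable def crPow {N n : ℕ} (a : Fin n → Fin N → CPt N → ℂ) (α : Fin n → ℕ)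
    (u : CPt N → ℂ) : CPt N → ℂ :=
  ((List.finRange n).foldr (fun j F => (crOp a j)^[α j] ∘ F) id) u

/-- The span condition `Span_ℂ{(L^ᾱ ρ_z)(p) : |α| ≤ k} = ℂ^N`. -/
def SpanCondAt (N n : ℕ) (ρ : CPt N → ℝ) (a : Fin n → Fin N → CPt N → ℂ) (k : ℕ)
    (p : CPt N) : Prop :=
  Submodule.span ℂ {v : CPt N | ∃ α : Fin n → ℕ, (∑ j, α j) ≤ k ∧
    v = fun l => crPow a α (wz l fun w => ((ρ w : ℝ) : ℂ)) p} = ⊤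

/-- `M` is `k₀`-nondegenerate at `p`: for some (equivalently, any) local defining function
and basis of CR vector fields near `p`, `k₀` is the smallest integer with
`Span_ℂ{(L^ᾱ ρ_z)(p) : |α| ≤ k₀} = ℂ^N`. -/
def KNondegenerateAt (N k₀ : ℕ) (M : Set (CPt N)) (p : CPt N) : Prop :=
  ∃ U ρ a, DefiningFn N M U ρ p ∧ CRBasisOn N (N - 1) M U ρ a ∧
    SpanCondAt N (N - 1) ρ a k₀ p ∧ ∀ j < k₀, ¬SpanCondAt N (N - 1) ρ a j p

attribute [local instance] Classical.propDecidable

/-- The iterated Wirtinger derivative `∂_z^α ∂_z̄^β u`. -/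
noncomputable def wpow {N : ℕ} (α β : Fin N → ℕ) (u : CPt N → ℂ) : CPt N → ℂ :=
  ((List.finRange N).foldr (fun m F => (wz m)^[α m] ∘ F) id)
    (((List.finRange N).foldr (fun m F => (wzb m)^[β m] ∘ F) id) u)

/-- The complexified formal Taylor series of `u` at `p`. -/
noncomputable def cTaylor {N : ℕ} (u : CPt N → ℂ) (p : CPt N) :
    MvPowerSeries (Fin N ⊕ Fin N) ℂ :=
  fun μ => wpow (fun m => μ (Sum.inl m)) (fun m => μ (Sum.inr m)) u p /
    (((∏ m, Nat.factorial (μ (Sum.inl m))) * ∏ m, Nat.factorial (μ (Sum.inr m)) : ℕ) : ℂ)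

/-- The embedding `ℂ[[z − p]] → ℂ[[z − p, z̄ − p̄]]`. -/
noncomputable def embZ {N : ℕ} (a : MvPowerSeries (Fin N) ℂ) :
    MvPowerSeries (Fin N ⊕ Fin N) ℂ :=
  fun μ => if _h : ∀ m, μ (Sum.inr m) = 0
    then MvPowerSeries.coeff
      (Finsupp.comapDomain Sum.inl μ Sum.inl_injective.injOn) a
    else 0

/-- `M` is (formally) holomorphically degenerate at `p`. -/
def HoloDegenerateAt (N : ℕ) (M : Set (CPt N)) (p : CPt N) : Prop :=
  ∃ U ρ, DefiningFn N M U ρ p ∧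
    ∃ a : Fin N → MvPowerSeries (Fin N) ℂ, (∃ j, a j ≠ 0) ∧
      cTaylor (fun w => ((ρ w : ℝ) : ℂ)) p ∣
        ∑ j, embZ (a j) * cTaylor (wz j fun w => ((ρ w : ℝ) : ℂ)) p

/-- `f` is a CR map along `S ⊆ M`: for every `q ∈ S`, every local defining function of `M`
at `q`, and every `(0,1)` tangent vector `c` of `M` at `q`, the `(1,0)` part of the pushed
forward vector vanishes. -/
def IsCRMapOn (N : ℕ) (M : Set (CPt N)) (f : CPt N → CPt N) (S : Set (CPt N)) : Prop :=
  ∀ q ∈ S, ∀ (U : Set (CPt N)) (ρ : CPt N → ℝ), DefiningFn N M U ρ q →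
    ∀ c : CPt N, (∑ m, c m * wzb m (fun w => ((ρ w : ℝ) : ℂ)) q) = 0 →
      ∀ j, (∑ m, c m * wzb m (fun w => f w j) q) = 0

/-- `f` is a smooth CR diffeomorphism of `M ∩ W` onto an open subset of `M'` (with smooth
CR inverse). -/
def IsCRDiffeoOn (N : ℕ) (M M' : Set (CPt N)) (f : CPt N → CPt N) (W : Set (CPt N)) :
    Prop :=
  IsOpen W ∧ ContDiffOn ℝ (⊤ : ℕ∞) f W ∧ Set.MapsTo f (M ∩ W) M' ∧
    Set.InjOn f (M ∩ W) ∧ (∃ O, IsOpen O ∧ f '' (M ∩ W) = M' ∩ O) ∧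
    IsCRMapOn N M f (M ∩ W) ∧
    ∃ g W', IsOpen W' ∧ f '' (M ∩ W) ⊆ W' ∧ ContDiffOn ℝ (⊤ : ℕ∞) g W' ∧
      (∀ z ∈ M ∩ W, g (f z) = z) ∧ IsCRMapOn N M' g (f '' (M ∩ W))

/-- `X` is an infinitesimal CR automorphism of `M` on `M ∩ V`: a smooth real vector field,
tangent to `M`, whose local flows `exp tX` are CR diffeomorphisms of pieces of `M` onto
their images in `M`. -/
def IsInfinitesimalCRAut (N : ℕ) (M : Set (CPt N)) (X : CPt N → CPt N) (V : Set (CPt N)) :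
    Prop :=
  IsOpen V ∧ ContDiffOn ℝ (⊤ : ℕ∞) X V ∧
    (∀ q ∈ M ∩ V, ∀ (U : Set (CPt N)) (ρ : CPt N → ℝ), DefiningFn N M U ρ q →
      fderiv ℝ ρ q (X q) = 0) ∧
    ∀ q ∈ M ∩ V, ∃ ε > (0 : ℝ), ∃ W' : Set (CPt N), IsOpen W' ∧ q ∈ W' ∧ W' ⊆ V ∧
      ∃ φ : ℝ → CPt N → CPt N,
        (∀ z ∈ W', φ 0 z = z) ∧
        (∀ t : ℝ, |t| < ε → ∀ z ∈ W', HasDerivAt (fun s => φ s z) (X (φ t z)) t) ∧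
        (∀ t : ℝ, |t| < ε → IsCRDiffeoOn N M M (φ t) W')

/-- `M` contains a complex manifold of complex dimension `N − 1` through `p₀` (the negation
of minimality at `p₀`). -/
def ContainsComplexHypersurfaceThrough (N : ℕ) (M : Set (CPt N)) (p₀ : CPt N) : Prop :=
  ∃ (ψ : (Fin (N - 1) → ℂ) → CPt N) (r : ℝ), 0 < r ∧
    DifferentiableOn ℂ ψ (Metric.ball 0 r) ∧ ψ 0 = p₀ ∧
    (∀ w ∈ Metric.ball (0 : Fin (N - 1) → ℂ) r, ψ w ∈ M) ∧
    Function.Injective (fderiv ℂ ψ 0)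

end

/-- A family of pairwise commuting `ℂ`-linear derivations of a commutative algebra. -/
structure CommDer (ι A : Type*) [CommRing A] [Algebra ℂ A] where
  /-- The derivations. -/
  der : ι → Derivation ℂ A A
  comm : ∀ i j a, der i (der j a) = der j (der i a)

namespace CommDer

variable {ι A : Type*} [CommRing A] [Algebra ℂ A] (D : CommDer ι A)

instance : LeftCommutative (fun (i : ι) (x : A) => D.der i x) := ⟨fun i j x => D.comm i j x⟩

/-- The iterated derivative indexed by a multi-index. -/
noncomputable def pow (μ : ι →₀ ℕ) (a : A) : A :=
  Multiset.foldr (fun i x => D.der i x) a (Finsupp.toMultiset μ)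

@[simp] lemma pow_zero (a : A) : D.pow 0 a = a := by simp [pow]

lemma pow_add_single (μ : ι →₀ ℕ) (i : ι) (a : A) :
    D.pow (μ + Finsupp.single i 1) a = D.der i (D.pow μ a) := by
  rw [pow, add_comm, map_add, Finsupp.toMultiset_single, one_smul, Multiset.singleton_add,
    Multiset.foldr_cons, pow]

lemma pow_induction {P : (ι →₀ ℕ) → Prop} (h0 : P 0)
    (h1 : ∀ μ i, P μ → P (μ + Finsupp.single i 1)) (μ : ι →₀ ℕ) : P μ := by
  classical
  induction μ using Finsupp.induction_linear with
  | zero => exact h0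
  | add f g hf hg =>
    have key : ∀ s : Multiset ι, ∀ ν, P ν → P (ν + Multiset.toFinsupp s) := by
      intro s
      induction s using Multiset.induction with
      | empty => intro ν hν; simpa using hν
      | cons a s ih =>
        intro ν hν
        have := h1 _ a (ih ν hν)
        rw [← Multiset.singleton_add, map_add, Multiset.toFinsupp_singleton]
        convert this using 1
        abel
    have := key (Finsupp.toMultiset g) f hf
    simpa using this
  | single a n =>
    induction n with
    | zero => simpa using h0
    | succ n ih => rw [Finsupp.single_add]; exact h1 _ _ ih

lemma pow_der (μ : ι →₀ ℕ) (i : ι) (a : A) : D.pow μ (D.der i a) = D.der i (D.pow μ a) := by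
  induction μ using pow_induction with
  | h0 => simp
  | h1 μ j ih => rw [pow_add_single, ih, pow_add_single, D.comm]

lemma pow_add (μ : ι →₀ ℕ) (a b : A) : D.pow μ (a + b) = D.pow μ a + D.pow μ b := by
  induction μ using pow_induction with
  | h0 => simp
  | h1 μ j ih => simp [pow_add_single, ih]

lemma pow_smul (μ : ι →₀ ℕ) (c : ℂ) (a : A) : D.pow μ (c • a) = c • D.pow μ a := by
  induction μ using pow_induction with
  | h0 => simp
  | h1 μ j ih => simp [pow_add_single, ih]

/-- The family `∂ᵢ - (g ∂ᵢρ) ∂ₘ`, tangential to `ρ`, where `g` is inverse to `∂ₘ ρ`. -/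
noncomputable def tangential (m : ι) (ρ g : A) (hg : g * D.der m ρ = 1) : CommDer ι A where
  der i := D.der i - (g * D.der i ρ) • D.der m
  comm i j a := by
    have hdg : ∀ l, D.der l g = - g ^ 2 * D.der l (D.der m ρ) := by
      intro l
      have h := congrArg (D.der l) hg
      simp only [Derivation.leibniz, smul_eq_mul, Derivation.map_one_eq_zero] at h
      linear_combination (- D.der l g) * hg + g * h
    simp only [Derivation.sub_apply, Derivation.smul_apply, smul_eq_mul, map_sub,
      Derivation.leibniz, hdg]
    rw [D.comm m i ρ, D.comm m j ρ, D.comm j i ρ, D.comm i j a, D.comm m i a, D.comm m j a]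
    ring

lemma tangential_der (m : ι) (ρ g : A) (hg : g * D.der m ρ = 1) (i : ι) (a : A) :
    (D.tangential m ρ g hg).der i a = D.der i a - g * D.der i ρ * D.der m a := by
  simp [tangential]

lemma tangential_self (m : ι) (ρ g : A) (hg : g * D.der m ρ = 1) (i : ι) :
    (D.tangential m ρ g hg).der i ρ = 0 := by
  rw [tangential_der]; linear_combination (- D.der i ρ) * hg

/-- The partial derivatives of formal power series. -/
noncomputable def formal (ι : Type*) : CommDer ι (MvPowerSeries ι ℂ) where
  der i := MvPowerSeries.pderiv ℂ i
  comm i j a := by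
    classical
    ext n
    simp only [MvPowerSeries.coeff_pderiv, Finsupp.add_apply, Finsupp.single_apply]
    rw [add_right_comm]
    by_cases h : i = j
    · subst h; rfl
    · simp [h, Ne.symm h]; ring

end CommDer

open MvPowerSeries in
/-- A family of power series stable under differentiation and without constant terms is zero. -/
lemma MvPowerSeries.eq_zero_of_stable {ι : Type*} (S : Set (MvPowerSeries ι ℂ))
    (h0 : ∀ E ∈ S, constantCoeff E = 0) (h1 : ∀ E ∈ S, ∀ i, pderiv ℂ i E ∈ S) :
    ∀ E ∈ S, E = 0 := by
  have key : ∀ n : ι →₀ ℕ, ∀ E ∈ S, coeff n E = 0 := by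
    intro n
    induction n using CommDer.pow_induction with
    | h0 => intro E hE; simpa using h0 E hE
    | h1 μ i ih =>
      intro E hE
      have := ih _ (h1 E hE i)
      rw [coeff_pderiv] at this
      exact (mul_eq_zero.mp this).resolve_right (Nat.cast_add_one_ne_zero _)
  intro E hE
  ext n
  simpa using key n E hE

namespace CommDer

variable {ι A : Type*} [CommRing A] [Algebra ℂ A] (D : CommDer ι A) [Fintype ι]

lemma prod_factorial_add_single (μ : ι →₀ ℕ) (i : ι) :
    (∏ j, ((μ + Finsupp.single i 1 : ι →₀ ℕ) j).factorial : ℕ) =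
      (∏ j, (μ j).factorial) * (μ i + 1) := by
  classical
  rw [← Finset.mul_prod_erase _ _ (Finset.mem_univ i),
    ← Finset.mul_prod_erase (a := i) _ (fun j => (μ j).factorial) (Finset.mem_univ i)]
  have : ∏ j ∈ Finset.univ.erase i, ((μ + Finsupp.single i 1 : ι →₀ ℕ) j).factorial =
      ∏ j ∈ Finset.univ.erase i, (μ j).factorial := by
    refine Finset.prod_congr rfl fun j hj => ?_
    simp [(Finset.ne_of_mem_erase hj).symm]
  rw [this]
  simp [Nat.factorial_succ]
  ring

/-- The formal Taylor series of `a` with respect to `D` at the character `ε`. -/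
noncomputable def taylorFun (ε : A →ₐ[ℂ] ℂ) (a : A) : MvPowerSeries ι ℂ :=
  fun μ => ε (D.pow μ a) / ((∏ i, (μ i).factorial : ℕ) : ℂ)

lemma coeff_taylorFun (ε : A →ₐ[ℂ] ℂ) (a : A) (μ : ι →₀ ℕ) :
    MvPowerSeries.coeff μ (D.taylorFun ε a) =
      ε (D.pow μ a) / ((∏ i, (μ i).factorial : ℕ) : ℂ) := rfl

lemma pderiv_taylorFun (ε : A →ₐ[ℂ] ℂ) (i : ι) (a : A) :
    MvPowerSeries.pderiv ℂ i (D.taylorFun ε a) = D.taylorFun ε (D.der i a) := by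
  ext μ
  rw [MvPowerSeries.coeff_pderiv, coeff_taylorFun, coeff_taylorFun, prod_factorial_add_single,
    pow_add_single, pow_der]
  have h1 : ((∏ j, (μ j).factorial : ℕ) : ℂ) ≠ 0 := by
    exact_mod_cast (Finset.prod_pos fun j _ => Nat.factorial_pos _).ne'
  have h2 : ((μ i : ℂ) + 1) ≠ 0 := Nat.cast_add_one_ne_zero _
  push_cast at h1 ⊢
  field_simp

lemma constantCoeff_taylorFun (ε : A →ₐ[ℂ] ℂ) (a : A) :
    MvPowerSeries.constantCoeff (D.taylorFun ε a) = ε a := by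
  rw [← MvPowerSeries.coeff_zero_eq_constantCoeff_apply, coeff_taylorFun]; simp

lemma taylorFun_add (ε : A →ₐ[ℂ] ℂ) (a b : A) :
    D.taylorFun ε (a + b) = D.taylorFun ε a + D.taylorFun ε b := by
  ext μ; simp [coeff_taylorFun, pow_add, add_div]

lemma taylorFun_smul (ε : A →ₐ[ℂ] ℂ) (c : ℂ) (a : A) :
    D.taylorFun ε (c • a) = c • D.taylorFun ε a := by
  ext μ; simp [coeff_taylorFun, pow_smul, mul_div_assoc]

lemma taylorFun_mul (ε : A →ₐ[ℂ] ℂ) (a b : A) :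
    D.taylorFun ε (a * b) = D.taylorFun ε a * D.taylorFun ε b := by
  let E : A × A → MvPowerSeries ι ℂ := fun p =>
    D.taylorFun ε (p.1 * p.2) - D.taylorFun ε p.1 * D.taylorFun ε p.2
  have h := MvPowerSeries.eq_zero_of_stable
    (Submodule.span ℂ (Set.range E) : Set (MvPowerSeries ι ℂ)) ?_ ?_ (E (a, b))
    (Submodule.subset_span ⟨_, rfl⟩)
  · exact sub_eq_zero.mp h
  · intro F hF
    induction hF using Submodule.span_induction with
    | mem x hx => obtain ⟨p, rfl⟩ := hx; simp [E, constantCoeff_taylorFun]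
    | zero => simp
    | add x y _ _ hx hy => simp [hx, hy]
    | smul c x _ hx => rw [← MvPowerSeries.coeff_zero_eq_constantCoeff_apply] at hx ⊢; simp [hx]
  · intro F hF i
    induction hF using Submodule.span_induction with
    | mem x hx =>
      obtain ⟨p, rfl⟩ := hx
      have : MvPowerSeries.pderiv ℂ i (E p) = E (D.der i p.1, p.2) + E (p.1, D.der i p.2) := by
        simp only [E, map_sub, Derivation.leibniz, pderiv_taylorFun, smul_eq_mul, taylorFun_add]
        rw [mul_comm p.2]
        ring
      rw [this]
      exact Submodule.add_mem _ (Submodule.subset_span ⟨_, rfl⟩) (Submodule.subset_span ⟨_, rfl⟩)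
    | zero => simp
    | add x y _ _ hx hy => rw [map_add]; exact Submodule.add_mem _ hx hy
    | smul c x _ hx => rw [Derivation.map_smul]; exact Submodule.smul_mem _ _ hx

lemma taylorFun_one (ε : A →ₐ[ℂ] ℂ) : D.taylorFun ε 1 = 1 := by
  refine sub_eq_zero.mp (MvPowerSeries.eq_zero_of_stable
    {0, D.taylorFun ε 1 - 1} ?_ ?_ _ (by simp))
  · rintro E (rfl | rfl) <;> simp [constantCoeff_taylorFun]
  · rintro E (rfl | rfl) i
    · simp
    · have : D.taylorFun ε 0 = 0 := by simpa using D.taylorFun_smul ε 0 0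
      simp [pderiv_taylorFun, this]

/-- The formal Taylor series as an algebra homomorphism. -/
noncomputable def taylor (ε : A →ₐ[ℂ] ℂ) : A →ₐ[ℂ] MvPowerSeries ι ℂ :=
  AlgHom.ofLinearMap
    { toFun := D.taylorFun ε, map_add' := D.taylorFun_add ε, map_smul' := D.taylorFun_smul ε }
    (D.taylorFun_one ε) (D.taylorFun_mul ε)

lemma coeff_taylor (ε : A →ₐ[ℂ] ℂ) (a : A) (μ : ι →₀ ℕ) :
    MvPowerSeries.coeff μ (D.taylor ε a) =
      ε (D.pow μ a) / ((∏ i, (μ i).factorial : ℕ) : ℂ) := rfl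

lemma pderiv_taylor (ε : A →ₐ[ℂ] ℂ) (i : ι) (a : A) :
    MvPowerSeries.pderiv ℂ i (D.taylor ε a) = D.taylor ε (D.der i a) := D.pderiv_taylorFun ε i a

lemma constantCoeff_taylor (ε : A →ₐ[ℂ] ℂ) (a : A) :
    MvPowerSeries.constantCoeff (D.taylor ε a) = ε a := D.constantCoeff_taylorFun ε a

end CommDer

section LinearAlgebraOverDomain

set_option linter.unusedSectionVars false

variable {S κ J : Type*} [CommRing S] [IsDomain S] [Fintype κ] [DecidableEq κ]

/-- The span over the fraction field of a family of vectors. -/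
noncomputable def fracSpan (v : J → κ → S) (s : Set J) : Submodule (FractionRing S) (κ → FractionRing S) :=
  Submodule.span _ ((fun j l => algebraMap S (FractionRing S) (v j l)) '' s)

lemma fracSpan_mono (v : J → κ → S) {s t : Set J} (h : s ⊆ t) : fracSpan v s ≤ fracSpan v t :=
  Submodule.span_mono (Set.image_mono h)

lemma sum_eq_zero_of_fracSpan_le (v : J → κ → S) {s t : Set J} (h : fracSpan v t ≤ fracSpan v s)
    (a : κ → S) (ha : ∀ j ∈ s, ∑ l, a l * v j l = 0) : ∀ j ∈ t, ∑ l, a l * v j l = 0 := by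
  let f : (κ → FractionRing S) →ₗ[FractionRing S] FractionRing S :=
    ∑ l, algebraMap S (FractionRing S) (a l) • LinearMap.proj l
  have hf : ∀ j, f (fun l => algebraMap S (FractionRing S) (v j l)) =
      algebraMap S (FractionRing S) (∑ l, a l * v j l) := by
    intro j; simp [f, Algebra.smul_def]
  have hs : fracSpan v s ≤ LinearMap.ker f := by
    refine Submodule.span_le.mpr ?_
    rintro _ ⟨j, hj, rfl⟩
    simp only [SetLike.mem_coe, LinearMap.mem_ker, hf, ha j hj, map_zero]
  intro j hj
  have : (fun l => algebraMap S (FractionRing S) (v j l)) ∈ LinearMap.ker f :=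
    hs (h (Submodule.subset_span ⟨j, hj, rfl⟩))
  rw [LinearMap.mem_ker, hf] at this
  exact (IsFractionRing.injective S (FractionRing S)) (by simpa using this)

lemma eq_zero_of_fracSpan_eq_top (v : J → κ → S) {s : Set J} (h : fracSpan v s = ⊤)
    (a : κ → S) (ha : ∀ j ∈ s, ∑ l, a l * v j l = 0) : a = 0 := by
  let w : J ⊕ κ → κ → S := Sum.elim v (fun i => Pi.single i 1)
  have hw : fracSpan w (Sum.inl '' s) = fracSpan v s := by
    simp only [fracSpan, Set.image_image]; rfl
  have := sum_eq_zero_of_fracSpan_le w (s := Sum.inl '' s) (t := Set.univ)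
    (by rw [hw, h]; exact le_top) a (by rintro _ ⟨j, hj, rfl⟩; exact ha j hj)
  ext i
  have := this (Sum.inr i) trivial
  simpa [w, Pi.single_apply] using this

lemma exists_det_ne_zero (v : J → κ → S) (s : Set J)
    (h : ∀ a : κ → S, (∀ j ∈ s, ∑ l, a l * v j l = 0) → a = 0) :
    ∃ t : κ → J, (∀ i, t i ∈ s) ∧ (Matrix.of fun i l => v (t i) l).det ≠ 0 := by
  have htop : fracSpan v s = ⊤ := by
    by_contra hne
    obtain ⟨f, hf0, hf⟩ := Submodule.exists_le_ker_of_lt_top _ (lt_top_iff_ne_top.mpr hne)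
    obtain ⟨b, hb⟩ := IsLocalization.exist_integer_multiples_of_finite (nonZeroDivisors S)
      (fun i : κ => f (Pi.single i 1))
    choose a ha using hb
    have hb0 : algebraMap S (FractionRing S) b ≠ 0 := by simp
    have hfa : ∀ x, algebraMap S (FractionRing S) b * f x =
        ∑ l, algebraMap S (FractionRing S) (a l) * x l := by
      intro x
      conv_lhs => rw [← Finset.univ_sum_single x]
      rw [map_sum, Finset.mul_sum]
      refine Finset.sum_congr rfl fun l _ => ?_
      rw [ha l]
      have : Pi.single l (x l) = x l • (Pi.single l 1 : κ → FractionRing S) := by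
        rw [← Pi.single_smul]; simp
      rw [this, map_smul, smul_eq_mul, Algebra.smul_def]
      ring
    have ha0 : a = 0 := by
      apply h
      intro j hj
      have h1 := hf (Submodule.subset_span ⟨j, hj, rfl⟩)
      rw [LinearMap.mem_ker] at h1
      have h2 := hfa (fun l => algebraMap S (FractionRing S) (v j l))
      rw [h1] at h2
      refine IsFractionRing.injective S (FractionRing S) ?_
      simpa using h2.symm
    apply hf0
    ext i
    have := hfa (Pi.single i 1)
    simp [ha0] at this
    simpa using this
  obtain ⟨κ', b, -, hspan, hli⟩ := exists_linearIndependent' (K := FractionRing S)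
    (fun j : s => fun l => algebraMap S (FractionRing S) (v j l))
  have himg : Set.range (fun j : s => fun l => algebraMap S (FractionRing S) (v j l)) =
      (fun j l => algebraMap S (FractionRing S) (v j l)) '' s := by
    ext x; simp
  rw [himg, ← fracSpan, htop] at hspan
  let B := Module.Basis.mk hli hspan.ge
  let e : κ ≃ κ' := (Pi.basisFun (FractionRing S) κ).indexEquiv B
  refine ⟨fun i => b (e i), fun i => (b (e i)).2, ?_⟩
  intro h0
  have h1 : (Matrix.of fun i l => algebraMap S (FractionRing S) (v (b (e i)) l)).det = 0 := by
    have := congrArg (algebraMap S (FractionRing S)) h0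
    rw [RingHom.map_det, map_zero] at this
    exact this
  have h2 : LinearIndependent (FractionRing S)
      (Matrix.of fun i l => algebraMap S (FractionRing S) (v (b (e i)) l)).row :=
    hli.comp e e.injective
  rw [Matrix.linearIndependent_rows_iff_isUnit, Matrix.isUnit_iff_isUnit_det] at h2
  exact h2.ne_zero h1

end LinearAlgebraOverDomain

namespace CommDer

section Basic
variable {ι κ A : Type*} [CommRing A] [Algebra ℂ A] (D : CommDer ι A)

/-- Reindexing of a family of commuting derivations. -/
def comp (f : κ → ι) : CommDer κ A where
  der i := D.der (f i)
  comm _ _ a := D.comm _ _ a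

@[simp] lemma comp_der (f : κ → ι) (i : κ) : (D.comp f).der i = D.der (f i) := rfl

lemma map_pow {B : Type*} [CommRing B] [Algebra ℂ B] (E : CommDer ι B) (F : A → B)
    (h : ∀ i a, F (D.der i a) = E.der i (F a)) (μ : ι →₀ ℕ) (a : A) :
    F (D.pow μ a) = E.pow μ (F a) := by
  induction μ using pow_induction with
  | h0 => simp
  | h1 μ j ih => rw [pow_add_single, h, ih, pow_add_single]

end Basic

/-- If the vectors of iterated derivatives of `C` span, those of small order already do. -/
lemma annihilator_eq_zero {κ R I : Type*} [CommRing R] [Algebra ℂ R] [IsDomain R] [Fintype I]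
    [DecidableEq I] (D : CommDer κ R) (C : I → R) (hC : C ≠ 0)
    (hinf : ∀ a : I → R, (∀ α, ∑ l, a l * D.pow α (C l) = 0) → a = 0) (a : I → R)
    (ha : ∀ α : κ →₀ ℕ, α.degree ≤ Fintype.card I - 1 → ∑ l, a l * D.pow α (C l) = 0) :
    a = 0 := by
  let v : (κ →₀ ℕ) → I → R := fun α l => D.pow α (C l)
  let s : ℕ → Set (κ →₀ ℕ) := fun j => {α | α.degree ≤ j}
  have hder : ∀ (b : I → R) (α : κ →₀ ℕ) (i : κ), ∑ l, b l * v α l = 0 →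
      (∑ l, D.der i (b l) * v α l) + ∑ l, b l * v (α + Finsupp.single i 1) l = 0 := by
    intro b α i hb
    have := congrArg (D.der i) hb
    rw [map_sum, map_zero] at this
    rw [← this, ← Finset.sum_add_distrib]
    refine Finset.sum_congr rfl fun l _ => ?_
    simp only [v, pow_add_single, Derivation.leibniz, smul_eq_mul]
    ring
  have stab : ∀ j, fracSpan v (s (j + 1)) ≤ fracSpan v (s j) →
      ∀ b : I → R, (∀ α ∈ s j, ∑ l, b l * v α l = 0) → b = 0 := by
    intro j hj
    have h1 : ∀ b : I → R, (∀ α ∈ s j, ∑ l, b l * v α l = 0) →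
        ∀ α ∈ s (j + 1), ∑ l, b l * v α l = 0 := fun b hb => sum_eq_zero_of_fracSpan_le v hj b hb
    have h2 : ∀ b : I → R, (∀ α ∈ s j, ∑ l, b l * v α l = 0) → ∀ i,
        ∀ α ∈ s j, ∑ l, D.der i (b l) * v α l = 0 := by
      intro b hb i α hα
      have := hder b α i (hb α hα)
      rw [h1 b hb (α + Finsupp.single i 1) (by simp only [s, Set.mem_ofPred_eq, map_add, Finsupp.degree_single] at hα ⊢; omega), add_zero] at this
      exact this
    have h3 : ∀ α, ∀ b : I → R, (∀ α ∈ s j, ∑ l, b l * v α l = 0) → ∑ l, b l * v α l = 0 := by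
      intro α
      induction α using pow_induction with
      | h0 => exact fun b hb => hb 0 (by simp [s])
      | h1 α i ih =>
        intro b hb
        have := hder b α i (ih b hb)
        rw [ih (fun l => D.der i (b l)) (h2 b hb i), zero_add] at this
        exact this
    exact fun b hb => hinf b fun α => h3 α b hb
  have hs : ∀ j, s j ⊆ s (j + 1) := fun j α hα => Nat.le_succ_of_le hα
  have dich : ∀ j, (∀ b : I → R, (∀ α ∈ s j, ∑ l, b l * v α l = 0) → b = 0) ∨
      j + 1 ≤ Module.finrank (FractionRing R) (fracSpan v (s j)) := by
    intro j
    induction j with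
    | zero =>
      right
      rw [zero_add, Nat.one_le_iff_ne_zero, Ne, Submodule.finrank_eq_zero]
      intro h0
      apply hC
      have h1 : (fun l => algebraMap R (FractionRing R) (v 0 l)) ∈ fracSpan v (s 0) :=
        Submodule.subset_span ⟨0, by simp [s], rfl⟩
      rw [h0, Submodule.mem_bot] at h1
      ext l
      have := congrFun h1 l
      exact IsFractionRing.injective R (FractionRing R) (by simpa [v] using this)
    | succ j ih =>
      rcases ih with ih | ih
      · left
        exact fun b hb => ih b fun α hα => hb α (hs j hα)
      · by_cases hle : fracSpan v (s (j + 1)) ≤ fracSpan v (s j)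
        · left
          exact fun b hb => stab j hle b fun α hα => hb α (hs j hα)
        · right
          have hlt : fracSpan v (s j) < fracSpan v (s (j + 1)) :=
            lt_of_le_not_ge (fracSpan_mono v fun α hα => hs j hα) hle
          have := Submodule.finrank_lt_finrank_of_lt hlt
          omega
  have hcard : 0 < Fintype.card I := by
    rw [Fintype.card_pos_iff]
    by_contra he
    rw [not_nonempty_iff] at he
    exact hC (Subsingleton.elim _ _)
  rcases dich (Fintype.card I - 1) with h | h
  · exact h a ha
  · refine eq_zero_of_fracSpan_eq_top v (s := s (Fintype.card I - 1)) ?_ a ha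
    apply Submodule.eq_top_of_finrank_eq
    refine le_antisymm (Submodule.finrank_le _) ?_
    rw [Module.finrank_fintype_fun_eq_card]
    omega

end CommDer

section Division

open MvPowerSeries

variable {ι : Type*}

lemma coeff_eq_zero_of_order {f : MvPowerSeries ι ℂ} {n : ℕ} (h : (n : ℕ∞) ≤ f.order)
    {d : ι →₀ ℕ} (hd : d.degree < n) : coeff d f = 0 :=
  coeff_of_lt_order (lt_of_lt_of_le (by exact_mod_cast hd) h)

/-- Formal division: modulo `ρ`, every series is equivalent to one free of the variable `m`. -/
lemma exists_division (m : ι) (ρ g F : MvPowerSeries ι ℂ) (h0 : constantCoeff ρ = 0)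
    (hg : g * pderiv ℂ m ρ = 1) :
    ∃ Q R : MvPowerSeries ι ℂ, F = ρ * Q + R ∧ pderiv ℂ m R = 0 := by
  let V : Derivation ℂ (MvPowerSeries ι ℂ) (MvPowerSeries ι ℂ) := g • pderiv ℂ m
  have hV : V ρ = 1 := by simpa [V] using hg
  have hpd : ∀ f, pderiv ℂ m f = pderiv ℂ m ρ * V f := by
    intro f
    simp only [V, Derivation.smul_apply, smul_eq_mul]
    linear_combination (-pderiv ℂ m f) * hg
  let c : ℕ → ℂ := fun k => (-1) ^ k / ((k + 1).factorial : ℂ)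
  let term : ℕ → MvPowerSeries ι ℂ := fun k => c k • (ρ ^ k * V^[k + 1] F)
  have hord1 : (1 : ℕ∞) ≤ ρ.order := by
    rw [Order.one_le_iff_pos, pos_iff_ne_zero]; exact order_ne_zero_iff_constCoeff_eq_zero.mpr h0
  have hordpow : ∀ (k : ℕ) f, (k : ℕ∞) ≤ (ρ ^ k * f).order := by
    intro k f
    refine le_trans ?_ (le_trans le_self_add le_order_mul)
    refine le_trans ?_ (le_order_pow k)
    calc (k : ℕ∞) = k • 1 := by simp
      _ ≤ k • ρ.order := nsmul_le_nsmul_right hord1 k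
  have hterm : ∀ k (d : ι →₀ ℕ), d.degree < k → coeff d (term k) = 0 := by
    intro k d hd
    simp only [term, coeff_smul]
    rw [coeff_eq_zero_of_order (hordpow k _) hd, mul_zero]
  let QK : ℕ → MvPowerSeries ι ℂ := fun K => ∑ k ∈ Finset.range K, term k
  let Q : MvPowerSeries ι ℂ := fun d => coeff d (QK (d.degree + 1))
  have hQ : ∀ K (d : ι →₀ ℕ), d.degree < K → coeff d (Q - QK K) = 0 := by
    intro K d hd
    have h1 : coeff d Q = coeff d (QK (d.degree + 1)) := rfl
    rw [map_sub, h1, sub_eq_zero]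
    simp only [QK, map_sum]
    refine Finset.sum_subset (by simpa using hd) ?_
    intro k hk hk'
    apply hterm
    simp at hk'
    omega
  have hVP : ∀ K, V (F - ρ * QK K) = ((K.factorial : ℂ)⁻¹ * (-1) ^ K) • (ρ ^ K * V^[K + 1] F) := by
    intro K
    induction K with
    | zero => simp [QK]
    | succ K ih =>
      have hs : F - ρ * QK (K + 1) = (F - ρ * QK K) - ρ * term K := by
        simp only [QK, Finset.sum_range_succ]; ring
      rw [hs, map_sub, ih]
      simp only [term, c, mul_smul_comm, Derivation.map_smul]
      rw [← mul_assoc, ← pow_succ', Derivation.leibniz, Derivation.leibniz_pow, hV,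
        ← Function.iterate_succ_apply' V]
      simp only [smul_eq_mul, mul_one, Nat.add_sub_cancel]
      have hf : ((K + 1).factorial : ℂ) = (K + 1) * K.factorial := by
        rw [Nat.factorial_succ]; push_cast; ring
      have hf0 : (K.factorial : ℂ) ≠ 0 := by exact_mod_cast Nat.factorial_ne_zero K
      have hk0 : (K : ℂ) + 1 ≠ 0 := Nat.cast_add_one_ne_zero K
      ext d
      simp only [map_sub, coeff_smul, map_add, nsmul_eq_mul, hf]
      have hnat : ∀ f : MvPowerSeries ι ℂ, coeff d (((K + 1 : ℕ) : MvPowerSeries ι ℂ) * f) =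
          ((K : ℂ) + 1) * coeff d f := by
        intro f
        rw [← nsmul_eq_mul, map_nsmul, nsmul_eq_mul]; push_cast; ring
      rw [mul_left_comm, hnat, mul_comm (V^[K+1] F), _root_.pow_succ (-1 : ℂ)]
      field_simp
      ring
  refine ⟨Q, F - ρ * Q, by ring, ?_⟩
  ext d
  have hs : F - ρ * Q = (F - ρ * QK (d.degree + 2)) - ρ * (Q - QK (d.degree + 2)) := by ring
  rw [hs, map_sub, map_sub, hpd, hVP, mul_smul_comm, coeff_smul, coeff_pderiv]
  have h1 : coeff d (pderiv ℂ m ρ * (ρ ^ (d.degree + 2) * V^[d.degree + 2 + 1] F)) = 0 := by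
    rw [mul_left_comm]
    exact coeff_eq_zero_of_order (hordpow (d.degree + 2) _) (by omega)
  have h2 : coeff (d + Finsupp.single m 1) (ρ * (Q - QK (d.degree + 2))) = 0 := by
    refine coeff_eq_zero_of_order (n := d.degree + 2) ?_ (by simp)
    refine le_trans ?_ (le_trans le_add_self le_order_mul)
    exact le_order fun e he => hQ _ e (by exact_mod_cast he)
  rw [h1, h2]; simp

end Division

namespace CommDer

open MvPowerSeries

instance (σ : Type*) : IsDomain (MvPowerSeries σ ℂ) := NoZeroDivisors.to_isDomain _

/-- The constant coefficient as a character. -/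
noncomputable def constChar (ι : Type*) : MvPowerSeries ι ℂ →ₐ[ℂ] ℂ :=
  { constantCoeff with
    commutes' := fun c => by
      simp [MvPowerSeries.algebraMap_apply] }

@[simp] lemma constChar_apply {ι : Type*} (f : MvPowerSeries ι ℂ) :
    constChar ι f = constantCoeff f := rfl

section Formal

variable {ι A : Type*} [Fintype ι] [CommRing A] [Algebra ℂ A] (D : CommDer ι A)

lemma taylor_tangential_comp (ε : A →ₐ[ℂ] ℂ) (m : ι) (ρ g : A) (hg : g * D.der m ρ = 1)
    (hg' : D.taylor ε g * (formal ι).der m (D.taylor ε ρ) = 1) (a : A) :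
    ((formal ι).tangential m (D.taylor ε ρ) (D.taylor ε g) hg').taylor (constChar ι)
      (D.taylor ε a) = (D.tangential m ρ g hg).taylor ε a := by
  have hT : ∀ i b, (formal ι).der i (D.taylor ε b) = D.taylor ε (D.der i b) :=
    fun i b => D.pderiv_taylor ε i b
  refine sub_eq_zero.mp (eq_zero_of_stable (Set.range fun a =>
    ((formal ι).tangential m (D.taylor ε ρ) (D.taylor ε g) hg').taylor (constChar ι)
      (D.taylor ε a) - (D.tangential m ρ g hg).taylor ε a) ?_ ?_ _ ⟨a, rfl⟩)
  · rintro _ ⟨a, rfl⟩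
    simp [constantCoeff_taylor]
  · rintro _ ⟨a, rfl⟩ i
    refine ⟨(D.tangential m ρ g hg).der i a, ?_⟩
    simp only [map_sub, pderiv_taylor, tangential_der, hT, map_mul]

lemma taylor_tangential_self (m : ι) (ρ g : MvPowerSeries ι ℂ)
    (hg : g * (formal ι).der m ρ = 1) (h0 : constantCoeff ρ = 0) :
    ((formal ι).tangential m ρ g hg).taylor (constChar ι) ρ = 0 := by
  refine eq_zero_of_stable {0, ((formal ι).tangential m ρ g hg).taylor (constChar ι) ρ} ?_ ?_ _
    (by simp)
  · rintro E (rfl | rfl) <;> simp [constantCoeff_taylor, h0]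
  · rintro E (rfl | rfl) i
    · simp
    · simp [pderiv_taylor, tangential_self]

lemma taylor_tangential_of_free (m : ι) (ρ g : MvPowerSeries ι ℂ)
    (hg : g * (formal ι).der m ρ = 1) (G : MvPowerSeries ι ℂ) (hG : pderiv ℂ m G = 0) :
    ((formal ι).tangential m ρ g hg).taylor (constChar ι) G = G := by
  refine sub_eq_zero.mp (eq_zero_of_stable
    {E | ∃ G, pderiv ℂ m G = 0 ∧
      E = ((formal ι).tangential m ρ g hg).taylor (constChar ι) G - G} ?_ ?_ _ ⟨G, hG, rfl⟩)
  · rintro _ ⟨G, hG, rfl⟩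
    simp [constantCoeff_taylor]
  · rintro _ ⟨G, hG, rfl⟩ i
    have hG' : (formal ι).der m G = 0 := hG
    refine ⟨pderiv ℂ i G, ?_, ?_⟩
    · have := (formal ι).comm m i G
      rw [hG', map_zero] at this
      exact this
    · rw [map_sub, pderiv_taylor, tangential_der, hG', mul_zero, sub_zero]
      rfl

lemma dvd_of_taylor_tangential_eq_zero (m : ι) (ρ g : MvPowerSeries ι ℂ)
    (hg : g * (formal ι).der m ρ = 1) (h0 : constantCoeff ρ = 0) (F : MvPowerSeries ι ℂ)
    (hF : ((formal ι).tangential m ρ g hg).taylor (constChar ι) F = 0) : ρ ∣ F := by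
  obtain ⟨Q, R, hQR, hR⟩ := exists_division m ρ g F h0 hg
  rw [hQR, map_add, map_mul, taylor_tangential_self m ρ g hg h0,
    taylor_tangential_of_free m ρ g hg R hR, zero_mul, zero_add] at hF
  exact ⟨Q, by rw [hQR, hF, add_zero]⟩

end Formal

section Restriction

variable {N : ℕ}

lemma pderiv_inr_embZ (a : MvPowerSeries (Fin N) ℂ) (i : Fin N) :
    pderiv ℂ (Sum.inr i) (embZ a) = 0 := by
  ext μ
  rw [coeff_pderiv]
  have : coeff (μ + Finsupp.single (Sum.inr i) 1) (embZ a) = 0 := by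
    change (embZ a) _ = 0
    rw [embZ, dif_neg]
    intro h
    have := h i
    simp at this
  rw [this]; simp

lemma pderiv_inl_embZ (a : MvPowerSeries (Fin N) ℂ) (i : Fin N) :
    pderiv ℂ (Sum.inl i) (embZ a) = embZ (pderiv ℂ i a) := by
  ext μ
  rw [coeff_pderiv]
  change (embZ a) _ * _ = embZ _ μ
  simp only [embZ]
  by_cases h : ∀ m, μ (Sum.inr m) = 0
  · rw [dif_pos h, dif_pos (by simpa using h), coeff_pderiv]
    have : Finsupp.comapDomain Sum.inl (μ + Finsupp.single (Sum.inl i) 1 : Fin N ⊕ Fin N →₀ ℕ)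
        Sum.inl_injective.injOn =
        Finsupp.comapDomain Sum.inl μ Sum.inl_injective.injOn + Finsupp.single i 1 := by
      ext j
      simp [Finsupp.single_apply]
    rw [this]
    simp
  · rw [dif_neg h, dif_neg (by simpa using h), zero_mul]

lemma constantCoeff_embZ (a : MvPowerSeries (Fin N) ℂ) :
    constantCoeff (embZ a) = constantCoeff a := by
  rw [← coeff_zero_eq_constantCoeff_apply, ← coeff_zero_eq_constantCoeff_apply]
  change (embZ a) 0 = _
  rw [embZ, dif_pos (by simp)]
  congr 1
  ext j
  simp

/-- Restriction of a power series in `(z, ζ)` to `ζ = 0`. -/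
noncomputable def res (N : ℕ) : MvPowerSeries (Fin N ⊕ Fin N) ℂ →ₐ[ℂ] MvPowerSeries (Fin N) ℂ :=
  ((formal (Fin N ⊕ Fin N)).comp Sum.inl).taylor (constChar _)

lemma res_embZ (a : MvPowerSeries (Fin N) ℂ) : res N (embZ a) = a := by
  refine sub_eq_zero.mp (eq_zero_of_stable (Set.range fun a => res N (embZ a) - a) ?_ ?_ _ ⟨a, rfl⟩)
  · rintro _ ⟨a, rfl⟩
    simp [res, constantCoeff_taylor, constantCoeff_embZ]
  · rintro _ ⟨a, rfl⟩ i
    refine ⟨pderiv ℂ i a, ?_⟩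
    simp only [map_sub, res, pderiv_taylor, comp_der]
    rw [← pderiv_inl_embZ]; rfl

lemma eq_zero_of_res (F : MvPowerSeries (Fin N ⊕ Fin N) ℂ)
    (h : ∀ α, res N (((formal (Fin N ⊕ Fin N)).comp Sum.inr).pow α F) = 0) : F = 0 := by
  refine eq_zero_of_stable
    {F | ∀ α, res N (((formal (Fin N ⊕ Fin N)).comp Sum.inr).pow α F) = 0} ?_ ?_ F h
  · intro F hF
    have := congrArg constantCoeff (hF 0)
    simpa [res, constantCoeff_taylor] using this
  · intro F hF i α
    rcases i with i | i
    · have h1 : ((formal (Fin N ⊕ Fin N)).comp Sum.inr).pow α (pderiv ℂ (Sum.inl i) F) =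
          (formal _).der (Sum.inl i) (((formal (Fin N ⊕ Fin N)).comp Sum.inr).pow α F) :=
        (map_pow ((formal (Fin N ⊕ Fin N)).comp Sum.inr) ((formal _).comp Sum.inr)
          ((formal _).der (Sum.inl i)) (fun j a => (formal _).comm _ _ a) α F).symm
      have h2 : res N ((formal _).der (Sum.inl i)
          (((formal (Fin N ⊕ Fin N)).comp Sum.inr).pow α F)) = pderiv ℂ i (res N
          (((formal (Fin N ⊕ Fin N)).comp Sum.inr).pow α F)) := by
        simp only [res, pderiv_taylor, comp_der]
      rw [h1, h2, hF α, map_zero]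
    · have h1 : ((formal (Fin N ⊕ Fin N)).comp Sum.inr).pow α (pderiv ℂ (Sum.inr i) F) =
          ((formal (Fin N ⊕ Fin N)).comp Sum.inr).pow (α + Finsupp.single i 1) F := by
        rw [pow_add_single, ← pow_der]; rfl
      rw [h1]; exact hF _

end Restriction

/-- Generic finite nondegeneracy: if the formal hypersurface `ρ = 0` carries no formal
holomorphic tangent field, then the derivatives of order `< N` of the normalized complex
gradient along the CR directions are generically independent. -/
theorem exists_generic_nondegenerate {N : ℕ} (hN : 2 ≤ N) {A : Type*} [CommRing A] [Algebra ℂ A]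
    (D : CommDer (Fin N ⊕ Fin N) A) (ε : A →ₐ[ℂ] ℂ) (ρ g gb : A) (m : Fin N)
    (hg : g * D.der (Sum.inr m) ρ = 1) (hgb : gb * D.der (Sum.inl m) ρ = 1) (h0 : ε ρ = 0)
    (hnd : ¬ ∃ a : Fin N → MvPowerSeries (Fin N) ℂ, (∃ j, a j ≠ 0) ∧
      D.taylor ε ρ ∣ ∑ j, embZ (a j) * D.taylor ε (D.der (Sum.inl j) ρ)) :
    ∃ (t : Fin N → Fin N →₀ ℕ) (i₀ j₀ : Fin N), (∀ i, (t i).degree ≤ N - 1) ∧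
      (D.tangential (Sum.inr m) ρ g hg).taylor ε
        ((Matrix.of fun i l => ((D.tangential (Sum.inr m) ρ g hg).comp Sum.inr).pow (t i)
            (gb * D.der (Sum.inl l) ρ)).det *
          (D.tangential (Sum.inr m) ρ g hg).der (Sum.inr i₀)
            (gb * D.der (Sum.inl j₀) ρ)) ≠ 0 := by
  set 𝒯 := (D.tangential (Sum.inr m) ρ g hg).taylor ε
  set Dζ := (formal (Fin N ⊕ Fin N)).comp (Sum.inr : Fin N → _)
  let C : Fin N → MvPowerSeries (Fin N ⊕ Fin N) ℂ := fun l => 𝒯 (gb * D.der (Sum.inl l) ρ)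
  have hCm : C m = 1 := by simp only [C, hgb, map_one]
  have hg' : D.taylor ε g * (formal _).der (Sum.inr m) (D.taylor ε ρ) = 1 := by
    have : (formal _).der (Sum.inr m) (D.taylor ε ρ) = D.taylor ε (D.der (Sum.inr m) ρ) :=
      D.pderiv_taylor ε _ _
    rw [this, ← map_mul, hg, map_one]
  have hpow : ∀ (a : MvPowerSeries (Fin N) ℂ) α F,
      Dζ.pow α (embZ a * F) = embZ a * Dζ.pow α F := by
    intro a α F
    refine (map_pow _ _ (fun F => embZ a * F) (fun i F => ?_) α F).symm
    have : (Dζ.der i) (embZ a) = 0 := pderiv_inr_embZ a i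
    rw [Derivation.leibniz, this]; simp
  have hpow_sum : ∀ α (f : Fin N → MvPowerSeries (Fin N ⊕ Fin N) ℂ),
      Dζ.pow α (∑ l, f l) = ∑ l, Dζ.pow α (f l) := by
    intro α f
    let φ : MvPowerSeries (Fin N ⊕ Fin N) ℂ →+ MvPowerSeries (Fin N ⊕ Fin N) ℂ :=
      AddMonoidHom.mk' (Dζ.pow α) (Dζ.pow_add α)
    exact map_sum φ f Finset.univ
  -- relations over the power series in `z` contradict nondegeneracy
  have hrel : ∀ a : Fin N → MvPowerSeries (Fin N) ℂ,
      (∀ α ∈ (Set.univ : Set (Fin N →₀ ℕ)), ∑ l, a l * res N (Dζ.pow α (C l)) = 0) → a = 0 := by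
    intro a ha
    by_contra hane
    apply hnd
    refine ⟨a, Function.ne_iff.mp hane, ?_⟩
    have hsum : ∑ l, embZ (a l) * C l = 0 := by
      apply eq_zero_of_res
      intro α
      rw [hpow_sum, map_sum, ← ha α trivial]
      refine Finset.sum_congr rfl fun l _ => ?_
      rw [hpow, map_mul, res_embZ]
    have hdvd : D.taylor ε ρ ∣ ∑ l, embZ (a l) * D.taylor ε (gb * D.der (Sum.inl l) ρ) := by
      refine dvd_of_taylor_tangential_eq_zero (Sum.inr m) _ _ hg'
        (by rw [constantCoeff_taylor, h0]) _ ?_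
      rw [map_sum, ← hsum]
      refine Finset.sum_congr rfl fun l _ => ?_
      rw [map_mul, taylor_tangential_of_free _ _ _ _ _ (pderiv_inr_embZ _ _),
        taylor_tangential_comp D ε (Sum.inr m) ρ g hg hg']
    have := hdvd.mul_left (D.taylor ε (D.der (Sum.inl m) ρ))
    rw [Finset.mul_sum] at this
    convert this using 2 with l
    rw [mul_left_comm, ← map_mul]
    congr 2
    linear_combination (-D.der (Sum.inl l) ρ) * hgb
  obtain ⟨t₀, -, ht₀⟩ := exists_det_ne_zero (fun α l => res N (Dζ.pow α (C l))) Set.univ hrel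
  have hdet₀ : (Matrix.of fun i l => Dζ.pow (t₀ i) (C l)).det ≠ 0 := by
    intro h
    apply ht₀
    have := congrArg (res N) h
    rw [AlgHom.map_det, map_zero] at this
    exact this
  have hinf : ∀ a : Fin N → MvPowerSeries (Fin N ⊕ Fin N) ℂ,
      (∀ α, ∑ l, a l * Dζ.pow α (C l) = 0) → a = 0 := by
    intro a ha
    by_contra hane
    apply hdet₀
    rw [← Matrix.exists_mulVec_eq_zero_iff]
    refine ⟨a, hane, ?_⟩
    ext1 i
    simp only [Matrix.mulVec, dotProduct, Matrix.of_apply, Pi.zero_apply]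
    rw [← ha (t₀ i)]
    exact Finset.sum_congr rfl fun l _ => mul_comm _ _
  have hfin := annihilator_eq_zero Dζ C (fun h => one_ne_zero (hCm.symm.trans (congrFun h m))) hinf
  rw [Fintype.card_fin] at hfin
  obtain ⟨t, ht, htdet⟩ := exists_det_ne_zero (fun α l => Dζ.pow α (C l))
    {α | α.degree ≤ N - 1} fun a ha => hfin a ha
  have hnc : ∃ i j, Dζ.der i (C j) ≠ 0 := by
    by_contra! hc
    obtain ⟨l, hl⟩ : ∃ l : Fin N, l ≠ m := by
      have : Nontrivial (Fin N) := Fin.nontrivial_iff_two_le.mpr hN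
      exact exists_ne m
    have hpc : ∀ α j, α ≠ 0 → Dζ.pow α (C j) = 0 := by
      intro α j
      induction α using pow_induction with
      | h0 => simp
      | h1 α i ih =>
        intro _
        rw [pow_add_single, ← pow_der, hc i j]
        simpa using Dζ.pow_smul α 0 0
    have := hinf (Pi.single l 1 - C l • Pi.single m 1) fun α => by
      simp only [Pi.sub_apply, Pi.smul_apply, smul_eq_mul, sub_mul, Finset.sum_sub_distrib]
      by_cases hα : α = 0
      · subst hα
        simp [Pi.single_apply, hCm]
      · simp [hpc α _ hα]
    have := congrFun this l
    simp [hl] at this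
  obtain ⟨i₀, j₀, hij⟩ := hnc
  have hder : ∀ i a, 𝒯 (((D.tangential (Sum.inr m) ρ g hg).comp Sum.inr).der i a) =
      Dζ.der i (𝒯 a) := fun i a => (pderiv_taylor _ _ _ _).symm
  refine ⟨t, i₀, j₀, ht, ?_⟩
  rw [map_mul]
  refine mul_ne_zero ?_ ?_
  · rw [AlgHom.map_det]
    convert htdet using 2
    ext1 i l
    simp only [AlgHom.mapMatrix_apply, Matrix.map_apply, Matrix.of_apply]
    exact map_pow _ _ 𝒯 hder (t i) _
  · exact fun h => hij ((hder i₀ _).symm.trans h)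

end CommDer

set_option linter.unusedSectionVars false

namespace MvPolynomial

variable {σ B : Type*} [CommRing B] [Algebra ℂ B]

/-- Coefficientwise application of a derivation. -/
noncomputable def coeffDer (δ : Derivation ℂ B B) (p : MvPolynomial σ B) : MvPolynomial σ B :=
  ∑ μ ∈ p.support, monomial μ (δ (coeff μ p))

lemma coeff_coeffDer (δ : Derivation ℂ B B) (p : MvPolynomial σ B) (μ : σ →₀ ℕ) :
    coeff μ (coeffDer δ p) = δ (coeff μ p) := by
  classical
  rw [coeffDer, coeff_sum]
  simp only [coeff_monomial]
  rw [Finset.sum_ite_eq']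
  split_ifs with h
  · rfl
  · rw [notMem_support_iff.mp h, map_zero]

lemma coeffDer_add (δ : Derivation ℂ B B) (p q : MvPolynomial σ B) :
    coeffDer δ (p + q) = coeffDer δ p + coeffDer δ q := by
  ext μ; simp [coeff_coeffDer]

lemma coeffDer_mul (δ : Derivation ℂ B B) (p q : MvPolynomial σ B) :
    coeffDer δ (p * q) = p * coeffDer δ q + coeffDer δ p * q := by
  classical
  ext μ
  simp only [coeff_coeffDer, coeff_mul, coeff_add, map_sum, ← Finset.sum_add_distrib]
  refine Finset.sum_congr rfl fun x _ => ?_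
  simp [Derivation.leibniz]; ring

lemma coeffDer_monomial (δ : Derivation ℂ B B) (μ : σ →₀ ℕ) (b : B) :
    coeffDer δ (monomial μ b) = monomial μ (δ b) := by
  classical
  ext ν
  simp only [coeff_coeffDer, coeff_monomial]
  split_ifs <;> simp

lemma coeffDer_zero (δ : Derivation ℂ B B) : coeffDer δ (0 : MvPolynomial σ B) = 0 := by
  simpa using coeffDer_add δ (0 : MvPolynomial σ B) 0

lemma coeffDer_smul (δ : Derivation ℂ B B) (b : B) (p : MvPolynomial σ B) :
    coeffDer δ (b • p) = b • coeffDer δ p + δ b • p := by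
  ext μ
  simp [coeff_coeffDer, Derivation.leibniz, mul_comm]

/-- Polynomials all of whose monomials have degree less than `n`. -/
noncomputable def degLT (σ B : Type*) [CommRing B] (n : ℕ) : Submodule B (MvPolynomial σ B) :=
  Submodule.span B {p | ∃ μ : σ →₀ ℕ, μ.degree < n ∧ p = monomial μ 1}

lemma coeffDer_mem_degLT (δ : Derivation ℂ B B) {n : ℕ} {p : MvPolynomial σ B}
    (hp : p ∈ degLT σ B n) : coeffDer δ p ∈ degLT σ B n := by
  induction hp using Submodule.span_induction with
  | mem p hp => obtain ⟨μ, -, rfl⟩ := hp; simp [coeffDer_monomial]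
  | zero => rw [coeffDer_zero]; exact zero_mem _
  | add p q _ _ hp hq => rw [coeffDer_add]; exact add_mem hp hq
  | smul b p h hp =>
    rw [coeffDer_smul]
    exact add_mem (Submodule.smul_mem _ _ hp) (Submodule.smul_mem _ _ h)

lemma X_mul_mem_degLT (j : σ) {n : ℕ} {p : MvPolynomial σ B}
    (hp : p ∈ degLT σ B n) : X j * p ∈ degLT σ B (n + 1) := by
  induction hp using Submodule.span_induction with
  | mem p hp =>
    obtain ⟨μ, hμ, rfl⟩ := hp
    refine Submodule.subset_span ⟨μ + Finsupp.single j 1, by simpa using hμ, ?_⟩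
    rw [X, monomial_mul, one_mul, add_comm]
  | zero => simp
  | add p q _ _ hp hq => rw [mul_add]; exact add_mem hp hq
  | smul b p h hp => rw [mul_smul_comm]; exact Submodule.smul_mem _ _ hp

end MvPolynomial

/-- The pair of adapted commuting families on (functions on) a hypersurface: `S` consists of
`Z` and `L̄`, while `S'` consists of `Z̄` and `L`. -/
structure CRFrame (N : ℕ) (B : Type*) [CommRing B] [Algebra ℂ B] (m : Fin N) where
  /-- The fields `Z` and `L̄`. -/
  S : CommDer (Fin N ⊕ Fin N) B
  /-- The fields `Z̄` and `L`. -/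
  S' : CommDer (Fin N ⊕ Fin N) B
  /-- The normalized complex gradient. -/
  c : Fin N → B
  /-- The conjugate normalized complex gradient. -/
  c' : Fin N → B
  /-- The transition factor. -/
  κ : B
  /-- The inverse transition factor. -/
  κ' : B
  hκ : κ * κ' = 1
  hL : ∀ j b, S'.der (Sum.inr j) b = S.der (Sum.inl j) b - c j * S.der (Sum.inl m) b
  hL' : ∀ j b, S.der (Sum.inr j) b = S'.der (Sum.inl j) b - c' j * S'.der (Sum.inl m) b
  hZ : ∀ b, S'.der (Sum.inl m) b = κ * S.der (Sum.inl m) b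
  hc : c m = 1
  hc' : c' m = 1

namespace CRFrame

variable {N : ℕ} {B : Type*} [CommRing B] [Algebra ℂ B] {m : Fin N}

/-- The conjugate frame. -/
def conj (F : CRFrame N B m) : CRFrame N B m where
  S := F.S'
  S' := F.S
  c := F.c'
  c' := F.c
  κ := F.κ'
  κ' := F.κ
  hκ := by rw [mul_comm, F.hκ]
  hL := F.hL'
  hL' := F.hL
  hZ b := by rw [F.hZ, ← mul_assoc, mul_comm F.κ', F.hκ, one_mul]
  hc := F.hc'
  hc' := F.hc

variable (F : CRFrame N B m)

/-- The module generated by the `Z`-derivatives of order `< n` of the components of `X`. -/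
noncomputable def jet (X : Fin N → B) (n : ℕ) : Submodule B B :=
  Submodule.span B {b | ∃ (μ : Fin N →₀ ℕ) (i : Fin N), μ.degree < n ∧
    b = (F.S.comp Sum.inl).pow μ (X i)}

variable {F} {X Y : Fin N → B}

lemma pow_mem_jet {n : ℕ} {μ : Fin N →₀ ℕ} (hμ : μ.degree < n) (i : Fin N) :
    (F.S.comp Sum.inl).pow μ (X i) ∈ F.jet X n := Submodule.subset_span ⟨μ, i, hμ, rfl⟩

lemma X_mem_jet (i : Fin N) : X i ∈ F.jet X 1 := by
  simpa using pow_mem_jet (F := F) (X := X) (n := 1) (μ := 0) (by simp) i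

lemma jet_mono {n n' : ℕ} (h : n ≤ n') : F.jet X n ≤ F.jet X n' :=
  Submodule.span_mono fun _ ⟨μ, i, hμ, hb⟩ => ⟨μ, i, hμ.trans_le h, hb⟩

lemma der_span_mem (δ : Derivation ℂ B B) {s : Set B} {P : Submodule B B}
    (hs : Submodule.span B s ≤ P) (h : ∀ b ∈ s, δ b ∈ P) {b : B} (hb : b ∈ Submodule.span B s) :
    δ b ∈ P := by
  induction hb using Submodule.span_induction with
  | mem b hb => exact h b hb
  | zero => simp
  | add a b _ _ ha hb => rw [map_add]; exact add_mem ha hb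
  | smul a b hb ih =>
    rw [smul_eq_mul, Derivation.leibniz]
    refine add_mem (Submodule.smul_mem _ _ ih) ?_
    rw [smul_eq_mul, mul_comm]
    exact Submodule.smul_mem _ (δ a) (hs hb)

lemma inr_pow_eq_zero (hX : ∀ i j, F.S.der (Sum.inr j) (X i) = 0) (j i : Fin N) (μ : Fin N →₀ ℕ) :
    F.S.der (Sum.inr j) ((F.S.comp Sum.inl).pow μ (X i)) = 0 := by
  rw [CommDer.map_pow (F.S.comp Sum.inl) (F.S.comp Sum.inl) (F.S.der (Sum.inr j))
    (fun l a => F.S.comm _ _ a), hX]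
  simpa using (F.S.comp Sum.inl).pow_smul μ 0 (0 : B)

lemma inr_mem_jet (hX : ∀ i j, F.S.der (Sum.inr j) (X i) = 0) (j : Fin N) {n : ℕ} {b : B}
    (hb : b ∈ F.jet X n) : F.S.der (Sum.inr j) b ∈ F.jet X n := by
  refine der_span_mem _ le_rfl ?_ hb
  rintro _ ⟨μ, i, -, rfl⟩
  rw [inr_pow_eq_zero hX]
  exact zero_mem _

lemma inl_mem_jet (j : Fin N) {n : ℕ} {b : B} (hb : b ∈ F.jet X n) :
    F.S.der (Sum.inl j) b ∈ F.jet X (n + 1) := by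
  refine der_span_mem _ (jet_mono (Nat.le_succ n)) ?_ hb
  rintro _ ⟨μ, i, hμ, rfl⟩
  have : F.S.der (Sum.inl j) ((F.S.comp Sum.inl).pow μ (X i)) =
      (F.S.comp Sum.inl).pow (μ + Finsupp.single j 1) (X i) := by
    rw [CommDer.pow_add_single]; rfl
  rw [this]
  exact pow_mem_jet (by simpa using hμ) i

lemma inr'_mem_jet (j : Fin N) {n : ℕ} {b : B} (hb : b ∈ F.jet X n) :
    F.S'.der (Sum.inr j) b ∈ F.jet X (n + 1) := by
  rw [F.hL]
  exact sub_mem (inl_mem_jet j hb) (Submodule.smul_mem _ _ (inl_mem_jet m hb))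

lemma inl'_mem_jet (hX : ∀ i j, F.S.der (Sum.inr j) (X i) = 0) (j : Fin N) {n : ℕ} {b : B}
    (hb : b ∈ F.jet X n) : F.S'.der (Sum.inl j) b ∈ F.jet X (n + 1) := by
  have : F.S'.der (Sum.inl j) b =
      F.S.der (Sum.inr j) b + (F.c' j * F.κ) * F.S.der (Sum.inl m) b := by
    rw [F.hL', F.hZ]; ring
  rw [this]
  exact add_mem (jet_mono (Nat.le_succ n) (inr_mem_jet hX j hb))
    (Submodule.smul_mem _ _ (inl_mem_jet m hb))

lemma pow_inr'_mem_jet (α : Fin N →₀ ℕ) {n : ℕ} {b : B} (hb : b ∈ F.jet X n) :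
    (F.S'.comp Sum.inr).pow α b ∈ F.jet X (n + α.degree) := by
  induction α using CommDer.pow_induction with
  | h0 => simpa using hb
  | h1 α j ih =>
    rw [CommDer.pow_add_single, map_add, Finsupp.degree_single, ← add_assoc]
    exact inr'_mem_jet j ih

/-- The reflection step: the conjugate components are controlled by the `k`-jet. -/
lemma conj_mem_jet {k : ℕ} (hY : ∀ i j, F.S'.der (Sum.inr j) (Y i) = 0)
    (hXY : ∑ i, F.c i * X i = F.κ * ∑ i, F.c' i * Y i)
    (t : Fin N → Fin N →₀ ℕ) (ht : ∀ a, (t a).degree ≤ k)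
    (hdet : IsUnit (Matrix.of fun a i => (F.S'.comp Sum.inr).pow (t a) (F.c' i)).det) (i : Fin N) :
    Y i ∈ F.jet X (k + 1) := by
  have hW : ∑ i, F.c' i * Y i ∈ F.jet X 1 := by
    have : ∑ i, F.c' i * Y i = F.κ' * ∑ i, F.c i * X i := by
      rw [hXY, ← mul_assoc, mul_comm F.κ', F.hκ, one_mul]
    rw [this]
    exact Submodule.smul_mem _ _ (sum_mem fun i _ => Submodule.smul_mem _ _ (X_mem_jet i))
  have hpow : ∀ α, (F.S'.comp Sum.inr).pow α (∑ i, F.c' i * Y i) =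
      ∑ i, (F.S'.comp Sum.inr).pow α (F.c' i) * Y i := by
    intro α
    induction α using CommDer.pow_induction with
    | h0 => simp
    | h1 α j ih =>
      simp only [CommDer.pow_add_single, ih, map_sum, Derivation.leibniz, CommDer.comp_der, hY,
        smul_eq_mul]
      exact Finset.sum_congr rfl fun l _ => by ring
  set Mx := Matrix.of fun a i => (F.S'.comp Sum.inr).pow (t a) (F.c' i)
  have hinv : Mx⁻¹.mulVec (Mx.mulVec Y) = Y := by
    rw [Matrix.mulVec_mulVec, Matrix.nonsing_inv_mul _ hdet, Matrix.one_mulVec]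
  rw [← congrFun hinv i]
  change ∑ a, Mx⁻¹ i a * Mx.mulVec Y a ∈ _
  refine sum_mem fun a _ => Submodule.smul_mem _ _ ?_
  have : Mx.mulVec Y a = (F.S'.comp Sum.inr).pow (t a) (∑ i, F.c' i * Y i) := by
    rw [hpow]; rfl
  rw [this]
  exact jet_mono (by have := ht a; omega) (pow_inr'_mem_jet (t a) hW)

section Symbol

open MvPolynomial hiding X

variable (F) in
/-- Evaluation of a symbol on a function. -/
noncomputable def symEval (x : B) : MvPolynomial (Fin N) B →ₗ[B] B :=
  (basisMonomials (Fin N) B).constr B fun μ => (F.S.comp Sum.inl).pow μ x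

lemma symEval_monomial (x : B) (μ : Fin N →₀ ℕ) (b : B) :
    F.symEval x (monomial μ b) = b * (F.S.comp Sum.inl).pow μ x := by
  have h1 : (monomial μ b : MvPolynomial (Fin N) B) = b • basisMonomials (Fin N) B μ := by
    simp [smul_monomial]
  rw [h1, map_smul, symEval, Module.Basis.constr_basis, smul_eq_mul]

lemma symEval_mem_jet {n : ℕ} (i : Fin N) {p : MvPolynomial (Fin N) B}
    (hp : p ∈ degLT (Fin N) B n) : F.symEval (X i) p ∈ F.jet X n := by
  have : degLT (Fin N) B n ≤ (F.jet X n).comap (F.symEval (X i)) := by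
    refine Submodule.span_le.mpr ?_
    rintro _ ⟨μ, hμ, rfl⟩
    change F.symEval (X i) _ ∈ F.jet X n
    rw [symEval_monomial, one_mul]
    exact pow_mem_jet hμ i
  exact this hp

lemma der_symEval_inr (hX : ∀ i j, F.S.der (Sum.inr j) (X i) = 0) (i j : Fin N)
    (p : MvPolynomial (Fin N) B) : F.S.der (Sum.inr j) (F.symEval (X i) p) =
      F.symEval (X i) (coeffDer (F.S.der (Sum.inr j)) p) := by
  induction p using MvPolynomial.induction_on' with
  | monomial μ b =>
    rw [coeffDer_monomial, symEval_monomial, symEval_monomial, Derivation.leibniz,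
      inr_pow_eq_zero hX]
    simp [mul_comm]
  | add p q hp hq => rw [coeffDer_add, map_add, map_add, map_add, hp, hq]

variable (F) in
/-- The symbol of `L_j`. -/
noncomputable def symL (j : Fin N) : MvPolynomial (Fin N) B :=
  MvPolynomial.X j - F.c j • MvPolynomial.X m

lemma der_symEval_inr' (x : B) (j : Fin N) (p : MvPolynomial (Fin N) B) :
    F.S'.der (Sum.inr j) (F.symEval x p) =
      F.symEval x (F.symL j * p + coeffDer (F.S'.der (Sum.inr j)) p) := by
  induction p using MvPolynomial.induction_on' with
  | monomial μ b =>
    have h : ∀ l : Fin N, F.symEval x (MvPolynomial.X l * monomial μ b) =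
        b * F.S.der (Sum.inl l) ((F.S.comp Sum.inl).pow μ x) := by
      intro l
      rw [MvPolynomial.X, monomial_mul, one_mul, symEval_monomial, add_comm,
        CommDer.pow_add_single]
      rfl
    rw [coeffDer_monomial, map_add, symEval_monomial, symEval_monomial, Derivation.leibniz,
      symL, sub_mul, map_sub, smul_mul_assoc, map_smul, h, h, F.hL _ (CommDer.pow _ _ _)]
    simp only [smul_eq_mul]
    ring
  | add p q hp hq => rw [coeffDer_add, map_add, map_add, hp, hq, ← map_add]; congr 1; ring

lemma symL_mul_mem_degLT (j : Fin N) {n : ℕ} {p : MvPolynomial (Fin N) B}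
    (hp : p ∈ degLT (Fin N) B n) : F.symL j * p ∈ degLT (Fin N) B (n + 1) := by
  rw [symL, sub_mul, smul_mul_assoc]
  exact sub_mem (X_mul_mem_degLT j hp) (Submodule.smul_mem _ _ (X_mul_mem_degLT m hp))

/-- Products of the symbols of the `L`'s, when all iterated `L`-derivatives of `X` lie in the
jet module, are evaluated into the jet module. -/
lemma symEval_prod_symL_mem {n : ℕ} (hLX : ∀ (i : Fin N) (l : List (Fin N)),
      l.foldr (fun j x => F.S'.der (Sum.inr j) x) (X i) ∈ F.jet X n) (i : Fin N)
    (l : List (Fin N)) (hl : l.length ≤ n) :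
    F.symEval (X i) (l.map F.symL).prod ∈ F.jet X n := by
  have hdeg : ∀ l : List (Fin N), (l.map F.symL).prod ∈ degLT (Fin N) B (l.length + 1) := by
    intro l
    induction l with
    | nil => exact Submodule.subset_span ⟨0, by simp, by simp⟩
    | cons j l ih => simpa using symL_mul_mem_degLT j ih
  have key : ∀ l : List (Fin N), F.symEval (X i) (l.map F.symL).prod -
      l.foldr (fun j x => F.S'.der (Sum.inr j) x) (X i) ∈ F.jet X l.length := by
    intro l
    induction l with
    | nil =>
      have : (1 : MvPolynomial (Fin N) B) = monomial 0 1 := rfl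
      simp only [List.map_nil, List.prod_nil, List.foldr_nil]
      rw [this, symEval_monomial]
      simp
    | cons j l ih =>
      have h1 := inr'_mem_jet j ih
      have h2 := symEval_mem_jet (F := F) (X := X) i (coeffDer_mem_degLT (F.S'.der (Sum.inr j)) (hdeg l))
      have h3 := sub_mem h1 h2
      rw [map_sub, der_symEval_inr', map_add] at h3
      simp only [List.map_cons, List.prod_cons, List.foldr_cons, List.length_cons]
      convert h3 using 1
      ring
  have := add_mem (jet_mono hl (key l)) (hLX i l)
  simpa using this

variable (F) in
/-- The span of the products of `c` symbols of `L`'s. -/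
noncomputable def symPow (c : ℕ) : Submodule B (MvPolynomial (Fin N) B) :=
  Submodule.span B {p | ∃ l : List (Fin N), l.length = c ∧ p = (l.map F.symL).prod}

lemma symL_mul_mem_symPow (j : Fin N) {c : ℕ} {p : MvPolynomial (Fin N) B}
    (hp : p ∈ F.symPow c) : F.symL j * p ∈ F.symPow (c + 1) := by
  induction hp using Submodule.span_induction with
  | mem p hp =>
    obtain ⟨l, hl, rfl⟩ := hp
    exact Submodule.subset_span ⟨j :: l, by simp [hl], by simp⟩
  | zero => simp
  | add p q _ _ hp hq => rw [mul_add]; exact add_mem hp hq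
  | smul b p h hp => rw [mul_smul_comm]; exact Submodule.smul_mem _ _ hp

lemma coeffDer_X (δ : Derivation ℂ B B) (j : Fin N) :
    coeffDer δ (MvPolynomial.X j : MvPolynomial (Fin N) B) = 0 := by
  rw [MvPolynomial.X, coeffDer_monomial]; simp

lemma coeffDer_symL (δ : Derivation ℂ B B) (j : Fin N) :
    coeffDer δ (F.symL j) = -δ (F.c j) • MvPolynomial.X m := by
  have h := coeffDer_add δ (F.symL j) (F.c j • MvPolynomial.X m)
  rw [symL, sub_add_cancel, coeffDer_X, coeffDer_smul, coeffDer_X, smul_zero, zero_add] at h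
  rw [symL, neg_smul]
  exact eq_neg_of_add_eq_zero_left h.symm

lemma coeffDer_one (δ : Derivation ℂ B B) : coeffDer δ (1 : MvPolynomial (Fin N) B) = 0 := by
  have : (1 : MvPolynomial (Fin N) B) = monomial 0 1 := rfl
  rw [this, coeffDer_monomial]; simp

lemma coeffDer_prod_symL (δ : Derivation ℂ B B) (l : List (Fin N)) :
    l = [] ∨ ∃ w ∈ F.symPow (l.length - 1),
      coeffDer δ (l.map F.symL).prod = MvPolynomial.X m * w := by
  induction l with
  | nil => left; rfl
  | cons j l ih =>
    right
    have h0 : (l.map F.symL).prod ∈ F.symPow l.length := Submodule.subset_span ⟨l, rfl, rfl⟩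
    simp only [List.map_cons, List.prod_cons, List.length_cons, Nat.add_sub_cancel]
    rw [coeffDer_mul, coeffDer_symL]
    rcases ih with rfl | ⟨w, hw, hlw⟩
    · refine ⟨-δ (F.c j) • 1, Submodule.smul_mem _ _ (by simpa using h0), ?_⟩
      simp [coeffDer_one]
    · rcases l with _ | ⟨a, l⟩
      · refine ⟨-δ (F.c j) • 1, Submodule.smul_mem _ _ (by simpa using h0), ?_⟩
        simp [coeffDer_one]
      · refine ⟨F.symL j * w - δ (F.c j) • ((a :: l).map F.symL).prod,
          sub_mem (symL_mul_mem_symPow j (by simpa using hw)) (Submodule.smul_mem _ _ h0), ?_⟩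
        rw [hlw]
        simp only [MvPolynomial.smul_eq_C_mul, map_neg]
        ring

/-- Elimination of the transversal symbol: a `B`-module of symbols which is stable under a
derivation `δ` with `δ c_j` invertible, and which contains all products of `r` symbols of `L`'s,
contains every monomial of degree `r`. -/
lemma monomial_mem_of_stable (𝒮 : Submodule B (MvPolynomial (Fin N) B)) (δ : Derivation ℂ B B)
    (hδ : ∀ p ∈ 𝒮, coeffDer δ p ∈ 𝒮) (j₀ : Fin N) (hj₀ : IsUnit (δ (F.c j₀))) (r : ℕ)
    (hr : F.symPow r ≤ 𝒮) (μ : Fin N →₀ ℕ) (hμ : μ.degree = r) : monomial μ 1 ∈ 𝒮 := by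
  set T : MvPolynomial (Fin N) B := MvPolynomial.X m with hT
  set y := F.symL j₀ with hy
  have hyT : ∀ b : ℕ, coeffDer δ (y ^ (b + 1)) = -((b + 1 : B) * δ (F.c j₀)) • (T * y ^ b) := by
    intro b
    induction b with
    | zero => simp [hy, coeffDer_symL, hT]
    | succ b ih =>
      rw [pow_succ y (b + 1), coeffDer_mul, ih, coeffDer_symL]
      push_cast
      simp only [MvPolynomial.smul_eq_C_mul, map_neg, map_mul, map_add, map_natCast, map_one]
      ring
  have hTδ : ∀ i p, coeffDer δ (T ^ i * p) = T ^ i * coeffDer δ p := by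
    intro i p
    have : ∀ i, coeffDer δ (T ^ i) = 0 := by
      intro i
      induction i with
      | zero => simp [coeffDer_one]
      | succ i ih => rw [pow_succ, coeffDer_mul, ih, coeffDer_X]; simp
    rw [coeffDer_mul, this, zero_mul, add_zero]
  have hunit : ∀ (b : ℕ) (p : MvPolynomial (Fin N) B),
      -((b + 1 : B) * δ (F.c j₀)) • p ∈ 𝒮 → p ∈ 𝒮 := by
    intro b p hp
    have hb : IsUnit ((b : B) + 1) := by
      have : ((b : B) + 1) = algebraMap ℂ B ((b : ℂ) + 1) := by simp
      rw [this]
      exact (IsUnit.mk0 _ (Nat.cast_add_one_ne_zero b)).map _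
    obtain ⟨u, hu⟩ := (hb.mul hj₀).neg
    rw [← hu] at hp
    have := Submodule.smul_mem 𝒮 (↑u⁻¹ : B) hp
    rwa [smul_smul, Units.inv_mul, one_smul] at this
  have main : ∀ i c b : ℕ, i + b + c = r → ∀ w ∈ F.symPow c, T ^ i * (y ^ b * w) ∈ 𝒮 := by
    intro i
    induction i with
    | zero =>
      intro c b hbc w hw
      have : ∀ b, y ^ b * w ∈ F.symPow (c + b) := by
        intro b
        induction b with
        | zero => simpa using hw
        | succ b ih =>
          rw [pow_succ', mul_assoc]
          exact symL_mul_mem_symPow j₀ ih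
      rw [pow_zero, one_mul]
      apply hr
      have h := this b
      rwa [show c + b = r by omega] at h
    | succ i ihi =>
      intro c
      induction c with
      | zero =>
        intro b hbc w hw
        have hw' : ∀ w ∈ F.symPow 0, ∃ a : B, w = a • 1 := by
          intro w hw
          induction hw using Submodule.span_induction with
          | mem p hp =>
            obtain ⟨l, hl, rfl⟩ := hp
            rw [List.length_eq_zero_iff] at hl
            subst hl
            exact ⟨1, by simp⟩
          | zero => exact ⟨0, by simp⟩
          | add p q _ _ hp hq =>
            obtain ⟨a, rfl⟩ := hp
            obtain ⟨a', rfl⟩ := hq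
            exact ⟨a + a', by rw [add_smul]⟩
          | smul a p _ hp =>
            obtain ⟨a', rfl⟩ := hp
            exact ⟨a * a', by rw [mul_smul]⟩
        obtain ⟨a, rfl⟩ := hw' w hw
        rw [mul_smul_comm, mul_smul_comm, mul_one]
        apply Submodule.smul_mem
        apply hunit b
        have h1 := ihi 0 (b + 1) (by omega) 1 (Submodule.subset_span ⟨[], rfl, by simp⟩)
        rw [mul_one] at h1
        have h2 := hδ _ h1
        rw [hTδ, hyT] at h2
        convert h2 using 1
        rw [mul_smul_comm, pow_succ, mul_assoc]
      | succ c ihc =>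
        intro b hbc w hw
        have hsub : F.symPow (c + 1) ≤ Submodule.comap
            (LinearMap.mulLeft B (T ^ (i + 1) * y ^ b)) 𝒮 := by
          refine Submodule.span_le.mpr ?_
          rintro _ ⟨l, hl, rfl⟩
          change T ^ (i + 1) * y ^ b * (l.map F.symL).prod ∈ 𝒮
          apply hunit b
          have h1 := ihi (c + 1) (b + 1) (by omega) (l.map F.symL).prod
            (Submodule.subset_span ⟨l, hl, rfl⟩)
          have h2 := hδ _ h1
          rw [hTδ, coeffDer_mul, hyT] at h2
          rcases coeffDer_prod_symL (F := F) δ l with rfl | ⟨w', hw', hlw⟩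
          · simp at hl
          · rw [hlw] at h2
            have h3 := ihc (b + 1) (by omega) w' (by simpa [hl] using hw')
            have h4 := sub_mem h2 h3
            convert h4 using 1
            simp only [MvPolynomial.smul_eq_C_mul]
            ring
        have := hsub hw
        simpa [mul_assoc] using this
  have hX : ∀ j, (MvPolynomial.X j : MvPolynomial (Fin N) B) = F.symL j + F.c j • T := by
    intro j; simp [symL, hT]
  let H : ℕ → Submodule B (MvPolynomial (Fin N) B) := fun n =>
    Submodule.span B {p | ∃ i c w, i + c = n ∧ w ∈ F.symPow c ∧ p = T ^ i * w}
  have hXH : ∀ j n, ∀ p ∈ H n, MvPolynomial.X j * p ∈ H (n + 1) := by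
    intro j n p hp
    induction hp using Submodule.span_induction with
    | mem p hp =>
      obtain ⟨i, c, w, hic, hw, rfl⟩ := hp
      rw [hX, add_mul]
      refine add_mem (Submodule.subset_span ⟨i, c + 1, F.symL j * w, by omega,
        symL_mul_mem_symPow j hw, by ring⟩) ?_
      rw [smul_mul_assoc]
      exact Submodule.smul_mem _ _ (Submodule.subset_span ⟨i + 1, c, w, by omega, hw, by ring⟩)
    | zero => simp
    | add p q _ _ hp hq => rw [mul_add]; exact add_mem hp hq
    | smul b p h hp => rw [mul_smul_comm]; exact Submodule.smul_mem _ _ hp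
  have hmon : ∀ μ : Fin N →₀ ℕ, monomial μ (1 : B) ∈ H μ.degree := by
    intro μ
    induction μ using CommDer.pow_induction with
    | h0 =>
      exact Submodule.subset_span ⟨0, 0, 1, by simp,
        Submodule.subset_span ⟨[], rfl, by simp⟩, by simp⟩
    | h1 μ j ih =>
      have := hXH j _ _ ih
      rw [MvPolynomial.X, monomial_mul, one_mul, add_comm (Finsupp.single j 1)] at this
      simpa using this
  have hH : H r ≤ 𝒮 := by
    refine Submodule.span_le.mpr ?_
    rintro _ ⟨i, c, w, hic, hw, rfl⟩
    simpa using main i c 0 (by omega) w hw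
  exact hH (hμ ▸ hmon μ)

end Symbol

/-- Closure of the jet module of order `2k`: the derivatives of order `2k+1` of the components
of an infinitesimal automorphism are combinations of the derivatives of order `≤ 2k`. -/
theorem inl_mem_jet_of_nondegenerate {k : ℕ} (hX : ∀ i j, F.S.der (Sum.inr j) (X i) = 0)
    (hY : ∀ i j, F.S'.der (Sum.inr j) (Y i) = 0)
    (hXY : ∑ i, F.c i * X i = F.κ * ∑ i, F.c' i * Y i)
    (t : Fin N → Fin N →₀ ℕ) (ht : ∀ a, (t a).degree ≤ k)
    (hdet : IsUnit (Matrix.of fun a i => (F.S.comp Sum.inr).pow (t a) (F.c i)).det)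
    (hdet' : IsUnit (Matrix.of fun a i => (F.S'.comp Sum.inr).pow (t a) (F.c' i)).det)
    (i₀ j₀ : Fin N) (hc : IsUnit (F.S.der (Sum.inr i₀) (F.c j₀)))
    (j : Fin N) {b : B} (hb : b ∈ F.jet X (2 * k + 1)) :
    F.S.der (Sum.inl j) b ∈ F.jet X (2 * k + 1) := by
  have hYX : ∀ i, Y i ∈ F.jet X (k + 1) := conj_mem_jet hY hXY t ht hdet'
  have hXY' : ∑ i, F.c' i * Y i = F.κ' * ∑ i, F.c i * X i := by
    rw [hXY, ← mul_assoc, mul_comm F.κ', F.hκ, one_mul]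
  have hXY'' : ∀ i, X i ∈ F.conj.jet Y (k + 1) :=
    conj_mem_jet (F := F.conj) (X := Y) (Y := X) hX hXY' t ht hdet
  have hincl : F.conj.jet Y (k + 1) ≤ F.jet X (2 * k + 1) := by
    refine Submodule.span_le.mpr ?_
    rintro _ ⟨μ, i, hμ, rfl⟩
    have : ∀ μ : Fin N →₀ ℕ, (F.S'.comp Sum.inl).pow μ (Y i) ∈ F.jet X (k + 1 + μ.degree) := by
      intro μ
      induction μ using CommDer.pow_induction with
      | h0 => simpa using hYX i
      | h1 μ j ih =>
        rw [CommDer.pow_add_single, map_add, Finsupp.degree_single, ← add_assoc]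
        exact inl'_mem_jet hX j ih
    exact jet_mono (by omega) (this μ)
  have hLX : ∀ (i : Fin N) (l : List (Fin N)),
      l.foldr (fun j x => F.S'.der (Sum.inr j) x) (X i) ∈ F.jet X (2 * k + 1) := by
    intro i l
    apply hincl
    induction l with
    | nil => exact hXY'' i
    | cons a l ih => exact inr_mem_jet (F := F.conj) hY a ih
  have hmem : ∀ (i : Fin N) (μ : Fin N →₀ ℕ), μ.degree = 2 * k + 1 →
      (F.S.comp Sum.inl).pow μ (X i) ∈ F.jet X (2 * k + 1) := by
    intro i μ hμ
    have := monomial_mem_of_stable (F := F) ((F.jet X (2 * k + 1)).comap (F.symEval (X i)))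
      (F.S.der (Sum.inr i₀)) ?_ j₀ hc (2 * k + 1) ?_ μ hμ
    · rw [Submodule.mem_comap, symEval_monomial, one_mul] at this
      exact this
    · intro p hp
      rw [Submodule.mem_comap] at hp ⊢
      rw [← der_symEval_inr hX]
      exact inr_mem_jet hX _ hp
    · refine Submodule.span_le.mpr ?_
      rintro _ ⟨l, hl, rfl⟩
      exact symEval_prod_symL_mem hLX i l hl.le
  have hsucc : F.jet X (2 * k + 1 + 1) ≤ F.jet X (2 * k + 1) := by
    refine Submodule.span_le.mpr ?_
    rintro _ ⟨μ, i, hμ, rfl⟩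
    rcases Nat.lt_succ_iff_lt_or_eq.mp hμ with h | h
    · exact pow_mem_jet h i
    · exact hmem i μ h
  exact hsucc (inl_mem_jet j hb)

end CRFrame

/-- Invariance of a closed set under the flow of a Lipschitz vector field which is tangent to it
in the sense of exterior normals. -/
theorem IsClosed.mem_of_trajectory {F : Type*} [NormedAddCommGroup F] [InnerProductSpace ℝ F]
    [ProperSpace F] {S : Set F} (hS : IsClosed S) {V : F → F} {K : NNReal} (hV : LipschitzWith K V)
    (hn : ∀ p ∈ S, ∀ c, Disjoint (Metric.ball c (dist p c)) S → inner ℝ (V p) (p - c) = 0)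
    {γ : ℝ → F} {a b : ℝ} (hc : ContinuousOn γ (Set.Icc a b))
    (hγ : ∀ t ∈ Set.Ico a b, HasDerivWithinAt γ (V (γ t)) (Set.Ici t) t) (ha : γ a ∈ S)
    {t : ℝ} (ht : t ∈ Set.Icc a b) : γ t ∈ S := by
  have hne : S.Nonempty := ⟨_, ha⟩
  have hcont : ContinuousOn (fun t => Metric.infDist (γ t) S ^ 2) (Set.Icc a b) :=
    ((Metric.continuous_infDist_pt S).comp_continuousOn hc).pow 2
  have key := le_gronwallBound_of_liminf_deriv_right_le (δ := 0) (K := 2 * K) (ε := 0)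
    (f' := fun t => 2 * K * Metric.infDist (γ t) S ^ 2) hcont ?_ ?_ (fun x _ => by simp) t ht
  · rw [gronwallBound_ε0_δ0] at key
    have h0 : Metric.infDist (γ t) S = 0 := by
      have : Metric.infDist (γ t) S ^ 2 = 0 := le_antisymm key (sq_nonneg _)
      exact pow_eq_zero_iff two_ne_zero |>.mp this
    exact (hS.mem_iff_infDist_zero hne).mpr h0
  · intro t ht r hr
    obtain ⟨p, hp, hpd⟩ := hS.exists_infDist_eq_dist hne (γ t)
    have hdisj : Disjoint (Metric.ball (γ t) (dist p (γ t))) S := by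
      rw [dist_comm, ← hpd]
      exact Metric.disjoint_ball_infDist
    have hzero := hn p hp _ hdisj
    have hder : HasDerivWithinAt (fun s => ‖γ s - p‖ ^ 2) (2 * inner ℝ (γ t - p) (V (γ t)))
        (Set.Ici t) t := ((hγ t ht).sub_const p).norm_sq
    have hle : 2 * inner ℝ (γ t - p) (V (γ t)) ≤ 2 * K * Metric.infDist (γ t) S ^ 2 := by
      have h1 : inner ℝ (γ t - p) (V (γ t)) = inner ℝ (γ t - p) (V (γ t) - V p) := by
        rw [inner_sub_right, real_inner_comm (V p), ← neg_sub p, inner_neg_right, hzero]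
        simp
      have h2 := real_inner_le_norm (γ t - p) (V (γ t) - V p)
      have h3 : ‖V (γ t) - V p‖ ≤ K * ‖γ t - p‖ := by
        simpa [dist_eq_norm] using hV.dist_le_mul (γ t) p
      rw [h1, hpd, dist_eq_norm]
      nlinarith [norm_nonneg (γ t - p)]
    have hev := ((hasDerivWithinAt_iff_tendsto_slope' (by simp)).mp
      (hder.mono Set.Ioi_subset_Ici_self)).eventually (Iio_mem_nhds (hle.trans_lt hr))
    refine Filter.Eventually.frequently ?_
    filter_upwards [hev, self_mem_nhdsWithin] with z hz hzt
    refine lt_of_le_of_lt ?_ hz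
    rw [slope_def_field, div_eq_inv_mul]
    have h4 : Metric.infDist (γ z) S ≤ ‖γ z - p‖ := by
      rw [← dist_eq_norm]; exact Metric.infDist_le_dist_of_mem hp
    have h5 : Metric.infDist (γ t) S = ‖γ t - p‖ := by rw [hpd, dist_eq_norm]
    have h6 : (0 : ℝ) ≤ (z - t)⁻¹ := inv_nonneg.mpr (sub_nonneg.mpr (le_of_lt hzt))
    rw [h5]
    have := pow_le_pow_left₀ Metric.infDist_nonneg h4 2
    gcongr
  · simp [Metric.infDist_zero_of_mem ha]

open scoped Topology ContDiff

section DirectionalDerivative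

variable {E F : Type*} [NormedAddCommGroup E] [NormedSpace ℝ E] [NormedAddCommGroup F]
  [NormedSpace ℝ F]

lemma ContDiff.fderiv_apply_const {u : E → F} (hu : ContDiff ℝ ∞ u) (v : E) :
    ContDiff ℝ ∞ fun x => fderiv ℝ u x v :=
  (hu.fderiv_right (m := ∞) (by simp)).clm_apply contDiff_const

lemma ContDiff.fderiv_apply_comm {u : E → F} (hu : ContDiff ℝ ∞ u) (v w x : E) :
    fderiv ℝ (fun y => fderiv ℝ u y v) x w = fderiv ℝ (fun y => fderiv ℝ u y w) x v := by
  have hd : DifferentiableAt ℝ (fderiv ℝ u) x :=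
    (hu.fderiv_right (m := ∞) (by simp)).differentiable (by simp) x
  have key : ∀ v w : E, fderiv ℝ (fun y => fderiv ℝ u y v) x w = fderiv ℝ (fderiv ℝ u) x w v := by
    intro v w
    rw [fderiv_clm_apply hd (differentiableAt_const v)]
    simp
  rw [key, key]
  exact (hu.contDiffAt.isSymmSndFDerivAt
    (by simpa using (WithTop.coe_le_coe.2 (le_top : (2 : ℕ∞) ≤ ⊤)))).eq w v

end DirectionalDerivative

open MeasureTheory in
/-- Stokes' theorem for the closed form `H dζ₁ ∧ dζ₂` on a three-dimensional box. -/
lemma integral_face_eq_zero {a b : Fin 3 → ℝ} (hab : a ≤ b) {H ζ₁ ζ₂ : (Fin 3 → ℝ) → ℂ}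
    (hH : ContDiff ℝ ∞ H) (h₁ : ContDiff ℝ ∞ ζ₁) (h₂ : ContDiff ℝ ∞ ζ₂)
    (hdet : ∀ x ∈ Set.Icc a b, (Matrix.of fun i j =>
      fderiv ℝ (![H, ζ₁, ζ₂] i) x (Pi.single j 1)).det = 0)
    (hzero : ∀ x ∈ Set.Icc a b, x 0 = b 0 ∨ x 1 = a 1 ∨ x 1 = b 1 ∨ x 2 = a 2 ∨ x 2 = b 2 →
      H x = 0) :
    ∫ y in Set.Icc (a ∘ Fin.succ) (b ∘ Fin.succ), H (Fin.cons (a 0) y) *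
      (fderiv ℝ ζ₁ (Fin.cons (a 0) y) (Pi.single 1 1) *
          fderiv ℝ ζ₂ (Fin.cons (a 0) y) (Pi.single 2 1) -
        fderiv ℝ ζ₁ (Fin.cons (a 0) y) (Pi.single 2 1) *
          fderiv ℝ ζ₂ (Fin.cons (a 0) y) (Pi.single 1 1)) = 0 := by
  let d : Fin 3 → ((Fin 3 → ℝ) → ℂ) → (Fin 3 → ℝ) → ℂ := fun i u x => fderiv ℝ u x (Pi.single i 1)
  have hd : ∀ i u, ContDiff ℝ ∞ u → ContDiff ℝ ∞ (d i u) := fun i u hu => hu.fderiv_apply_const _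
  let J : Fin 3 → Fin 3 → (Fin 3 → ℝ) → ℂ := fun i j x =>
    d i ζ₁ x * d j ζ₂ x - d j ζ₁ x * d i ζ₂ x
  have hJ : ∀ i j, ContDiff ℝ ∞ (J i j) := fun i j =>
    ((hd i _ h₁).mul (hd j _ h₂)).sub ((hd j _ h₁).mul (hd i _ h₂))
  let f : Fin 3 → (Fin 3 → ℝ) → ℂ := fun i x => H x * J (i + 1) (i + 2) x
  have hf : ∀ i, ContDiff ℝ ∞ (f i) := fun i => hH.mul (hJ _ _)
  have hmul : ∀ {u v : (Fin 3 → ℝ) → ℂ}, ContDiff ℝ ∞ u → ContDiff ℝ ∞ v → ∀ i x,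
      d i (fun x => u x * v x) x = u x * d i v x + d i u x * v x := by
    intro u v hu hv i x
    simp only [d]
    rw [fderiv_fun_mul (hu.differentiable (by simp) x) (hv.differentiable (by simp) x)]
    simp [mul_comm]
  have hsub : ∀ {u v : (Fin 3 → ℝ) → ℂ}, ContDiff ℝ ∞ u → ContDiff ℝ ∞ v → ∀ i x,
      d i (fun x => u x - v x) x = d i u x - d i v x := by
    intro u v hu hv i x
    simp only [d]
    rw [fderiv_fun_sub (hu.differentiable (by simp) x) (hv.differentiable (by simp) x)]
    simp
  have hcomm : ∀ {u : (Fin 3 → ℝ) → ℂ}, ContDiff ℝ ∞ u → ∀ i j x,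
      d i (d j u) x = d j (d i u) x := fun hu i j x => hu.fderiv_apply_comm _ _ x
  have hdiv : ∀ x ∈ Set.Icc a b, ∑ i, fderiv ℝ (f i) x (Pi.single i 1) = 0 := by
    intro x hx
    have hD := hdet x hx
    rw [Matrix.det_fin_three] at hD
    simp only [Matrix.of_apply, Matrix.cons_val_zero, Matrix.cons_val_one, Matrix.cons_val] at hD
    have hfi : ∀ i j, d i (fun x => H x * J (j + 1) (j + 2) x) x =
        H x * (d (j+1) ζ₁ x * d i (d (j+2) ζ₂) x + d i (d (j+1) ζ₁) x * d (j+2) ζ₂ x -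
          (d (j+2) ζ₁ x * d i (d (j+1) ζ₂) x + d i (d (j+2) ζ₁) x * d (j+1) ζ₂ x)) +
        d i H x * J (j+1) (j+2) x := by
      intro i j
      rw [hmul hH (hJ _ _), hsub ((hd _ _ h₁).mul (hd _ _ h₂)) ((hd _ _ h₁).mul (hd _ _ h₂)),
        hmul (hd _ _ h₁) (hd _ _ h₂), hmul (hd _ _ h₁) (hd _ _ h₂)]
    change ∑ i, d i (fun x => H x * J (i + 1) (i + 2) x) x = 0
    simp only [Fin.sum_univ_three, hfi]
    have e1 : (0 : Fin 3) + 1 = 1 := rfl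
    have e2 : (0 : Fin 3) + 2 = 2 := rfl
    have e3 : (1 : Fin 3) + 1 = 2 := rfl
    have e4 : (1 : Fin 3) + 2 = 0 := rfl
    have e5 : (2 : Fin 3) + 1 = 0 := rfl
    have e6 : (2 : Fin 3) + 2 = 1 := rfl
    simp only [e1, e2, e3, e4, e5, e6, J]
    rw [hcomm h₁ 1 0, hcomm h₁ 2 0, hcomm h₁ 2 1, hcomm h₂ 1 0, hcomm h₂ 2 0, hcomm h₂ 2 1]
    simp only [d] at hD ⊢
    linear_combination hD
  have key := integral_divergence_of_hasFDerivAt_off_countable' a b hab f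
    (fun i => fderiv ℝ (f i)) ∅ Set.countable_empty (fun i => (hf i).continuous.continuousOn)
    (fun x _ i => ((hf i).differentiable (by simp) x).hasFDerivAt)
    (integrableOn_zero.congr_fun (fun x hx => (hdiv x hx).symm) measurableSet_Icc)
  rw [setIntegral_congr_fun measurableSet_Icc hdiv] at key
  have hmem : ∀ (i : Fin 3) (c : ℝ), c ∈ Set.Icc (a i) (b i) →
      ∀ y ∈ Set.Icc (a ∘ i.succAbove) (b ∘ i.succAbove), i.insertNth c y ∈ Set.Icc a b := by
    intro i c hc y hy
    exact Fin.insertNth_mem_Icc.mpr ⟨hc, hy⟩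
  have hface : ∀ (i : Fin 3) (c : ℝ), c ∈ Set.Icc (a i) (b i) →
      (∀ x : Fin 3 → ℝ, x i = c → x 0 = b 0 ∨ x 1 = a 1 ∨ x 1 = b 1 ∨ x 2 = a 2 ∨ x 2 = b 2) →
      ∫ y in Set.Icc (a ∘ i.succAbove) (b ∘ i.succAbove), f i (i.insertNth c y) = 0 := by
    intro i c hc hi
    rw [setIntegral_congr_fun (g := fun _ => (0 : ℂ)) measurableSet_Icc]
    · simp
    · intro y hy
      simp only [f]
      rw [hzero _ (hmem i c hc y hy) (hi _ (Fin.insertNth_apply_same _ _ _)), zero_mul]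
  replace key := key.trans (Fin.sum_univ_three _)
  rw [integral_zero] at key
  rw [hface 0 (b 0) ⟨hab 0, le_rfl⟩ (fun x h => Or.inl h),
    hface 1 (b 1) ⟨hab 1, le_rfl⟩ (fun x h => by tauto),
    hface 1 (a 1) ⟨le_rfl, hab 1⟩ (fun x h => by tauto),
    hface 2 (b 2) ⟨hab 2, le_rfl⟩ (fun x h => by tauto),
    hface 2 (a 2) ⟨le_rfl, hab 2⟩ (fun x h => by tauto)] at key
  have : ∫ y in Set.Icc (a ∘ Fin.succ) (b ∘ Fin.succ), f 0 (Fin.cons (a 0) y) = 0 := by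
    simpa [Fin.insertNth_zero] using key
  simpa [f, J, d] using this

open MeasureTheory in
/-- Concentration of complex Gaussians at a nondegenerate phase. -/
lemma eq_zero_of_integral_gaussian_eq_zero {g ζ₁ ζ₂ : (Fin 2 → ℝ) → ℂ} (hg : Continuous g)
    (c₁ : Continuous ζ₁) (c₂ : Continuous ζ₂) (z₁ : ζ₁ 0 = 0) (z₂ : ζ₂ 0 = 0)
    {ℓ₁ ℓ₂ : (Fin 2 → ℝ) →L[ℝ] ℂ} (d₁ : HasFDerivAt ζ₁ ℓ₁ 0) (d₂ : HasFDerivAt ζ₂ ℓ₂ 0)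
    (hℓ₁ : ∀ u, ℓ₁ u = u 0) (hℓ₂ : ∀ u, ℓ₂ u = u 1) {r : ℝ} (hr : 0 < r)
    (hre : ∀ u ∈ Set.Icc (fun _ => -r) (fun _ => r : Fin 2 → ℝ),
      (1 / 2) * (u 0 ^ 2 + u 1 ^ 2) ≤ (ζ₁ u ^ 2 + ζ₂ u ^ 2).re)
    (hzero_int : ∀ n : ℕ, ∫ u in Set.Icc (fun _ => -r) (fun _ => r : Fin 2 → ℝ),
      g u * Complex.exp (-(n + 1) ^ 2 * (ζ₁ u ^ 2 + ζ₂ u ^ 2)) = 0) : g 0 = 0 := by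
  set K : Set (Fin 2 → ℝ) := Set.Icc (fun _ => -r) (fun _ => r) with hK
  have hKm : MeasurableSet K := measurableSet_Icc
  let Φ : ℕ → (Fin 2 → ℝ) → ℂ := fun n =>
    K.indicator fun u => g u * Complex.exp (-(n + 1) ^ 2 * (ζ₁ u ^ 2 + ζ₂ u ^ 2))
  let Ψ : ℕ → (Fin 2 → ℝ) → ℂ := fun n u => Φ n (((n : ℝ) + 1)⁻¹ • u)
  have hΨ : ∀ n, ∫ u, Ψ n u = 0 := by
    intro n
    rw [Measure.integral_comp_inv_smul, integral_indicator hKm, hzero_int, smul_zero]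
  obtain ⟨C, hC⟩ := (isCompact_Icc (a := (fun _ => -r : Fin 2 → ℝ)) (b := fun _ => r)).bddAbove_image
    (f := fun u => ‖g u‖) hg.norm.continuousOn
  have hC' : ∀ u ∈ K, ‖g u‖ ≤ C := fun u hu => hC ⟨u, hu, rfl⟩
  have h0K : (0 : Fin 2 → ℝ) ∈ K := ⟨fun _ => by simp [hr.le], fun _ => by simp [hr.le]⟩
  have hC0 : 0 ≤ C := (norm_nonneg _).trans (hC' 0 h0K)
  let bound : (Fin 2 → ℝ) → ℝ := fun u => C * ∏ i, Real.exp (-(1 / 2) * u i ^ 2)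
  have hbi : Integrable bound :=
    (Integrable.fintype_prod (μ := fun _ => volume) fun _ : Fin 2 =>
      integrable_exp_neg_mul_sq (b := 1 / 2) (by norm_num)).const_mul C
  have hmeas : ∀ n, AEStronglyMeasurable (Ψ n) volume := by
    intro n
    have h1 : Measurable (Φ n) := by
      refine Measurable.indicator (Continuous.measurable ?_) hKm
      fun_prop
    exact (h1.comp (by fun_prop)).aestronglyMeasurable
  have hbd : ∀ n, ∀ᵐ u, ‖Ψ n u‖ ≤ bound u := by
    intro n
    refine Filter.Eventually.of_forall fun u => ?_
    simp only [Ψ, Φ, bound]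
    by_cases hu : ((n : ℝ) + 1)⁻¹ • u ∈ K
    · rw [Set.indicator_of_mem hu, norm_mul, Complex.norm_exp]
      refine mul_le_mul (hC' _ hu) ?_ (Real.exp_pos _).le hC0
      rw [← Real.exp_sum]
      apply Real.exp_le_exp.mpr
      have h1 := hre _ hu
      have h2 : (-((n : ℂ) + 1) ^ 2 * (ζ₁ (((n : ℝ) + 1)⁻¹ • u) ^ 2 +
          ζ₂ (((n : ℝ) + 1)⁻¹ • u) ^ 2)).re = -((n : ℝ) + 1) ^ 2 *
          (ζ₁ (((n : ℝ) + 1)⁻¹ • u) ^ 2 + ζ₂ (((n : ℝ) + 1)⁻¹ • u) ^ 2).re := by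
        rw [← Complex.re_ofReal_mul]
        push_cast
        rfl
      rw [h2]
      simp only [Pi.smul_apply, smul_eq_mul, Fin.sum_univ_two] at h1 ⊢
      have hn : (0 : ℝ) < (n : ℝ) + 1 := by positivity
      have h3 : ((n : ℝ) + 1) ^ 2 * (1 / 2 * ((((n : ℝ) + 1)⁻¹ * u 0) ^ 2 +
          (((n : ℝ) + 1)⁻¹ * u 1) ^ 2)) = 1 / 2 * (u 0 ^ 2 + u 1 ^ 2) := by
        field_simp
      have h4 := mul_le_mul_of_nonneg_left h1 (sq_nonneg ((n : ℝ) + 1))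
      linarith
    · rw [Set.indicator_of_notMem hu, norm_zero]
      positivity
  have hsc : Filter.Tendsto (fun n : ℕ => ((n : ℝ) + 1)⁻¹) Filter.atTop (𝓝 0) := by
    simpa [one_div] using tendsto_one_div_add_atTop_nhds_zero_nat (𝕜 := ℝ)
  have hlim : ∀ᵐ u : Fin 2 → ℝ, Filter.Tendsto (fun n => Ψ n u) Filter.atTop
      (𝓝 (g 0 * ((∏ i, Real.exp (-1 * u i ^ 2) : ℝ) : ℂ))) := by
    refine Filter.Eventually.of_forall fun u => ?_
    have hsu : Filter.Tendsto (fun n : ℕ => ((n : ℝ) + 1)⁻¹ • u) Filter.atTop (𝓝 0) := by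
      simpa using hsc.smul_const u
    have hnear : ∀ᶠ n : ℕ in Filter.atTop, ((n : ℝ) + 1)⁻¹ • u ∈ K := by
      refine hsu.eventually ?_
      have hball : Metric.ball (0 : Fin 2 → ℝ) r ⊆ K := by
        intro x hx
        rw [mem_ball_zero_iff, pi_norm_lt_iff hr] at hx
        exact ⟨fun i => (abs_lt.mp (hx i)).1.le, fun i => (abs_lt.mp (hx i)).2.le⟩
      exact Filter.mem_of_superset (Metric.ball_mem_nhds 0 hr) hball
    have hscale : ∀ {ζ : (Fin 2 → ℝ) → ℂ} {ℓ : (Fin 2 → ℝ) →L[ℝ] ℂ}, ζ 0 = 0 →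
        HasFDerivAt ζ ℓ 0 → Filter.Tendsto
          (fun n : ℕ => ((n : ℂ) + 1) * ζ (((n : ℝ) + 1)⁻¹ • u)) Filter.atTop (𝓝 (ℓ u)) := by
      intro ζ ℓ hζ hd
      have := hd.lim_real (v := u)
      have h1 := (this.comp (tendsto_natCast_atTop_atTop (R := ℝ))).comp
        (Filter.tendsto_add_atTop_nat 1)
      refine h1.congr fun n => ?_
      simp [hζ]
    have e1 := hscale z₁ d₁
    have e2 := hscale z₂ d₂
    have hexp : Filter.Tendsto (fun n : ℕ => g (((n : ℝ) + 1)⁻¹ • u) *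
        Complex.exp (-((((n : ℂ) + 1) * ζ₁ (((n : ℝ) + 1)⁻¹ • u)) ^ 2 +
          (((n : ℂ) + 1) * ζ₂ (((n : ℝ) + 1)⁻¹ • u)) ^ 2))) Filter.atTop
        (𝓝 (g 0 * Complex.exp (-(ℓ₁ u ^ 2 + ℓ₂ u ^ 2)))) :=
      ((hg.tendsto 0).comp hsu).mul
        ((Complex.continuous_exp.tendsto _).comp ((e1.pow 2).add (e2.pow 2)).neg)
    have htarget : g 0 * ((∏ i, Real.exp (-1 * u i ^ 2) : ℝ) : ℂ) =
        g 0 * Complex.exp (-(ℓ₁ u ^ 2 + ℓ₂ u ^ 2)) := by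
      rw [hℓ₁, hℓ₂, Fin.prod_univ_two, ← Real.exp_add]
      push_cast
      congr 2
      ring
    rw [htarget]
    refine hexp.congr' ?_
    filter_upwards [hnear] with n hn
    simp only [Ψ, Φ]
    rw [Set.indicator_of_mem hn]
    congr 2
    ring
  have hfin := tendsto_integral_of_dominated_convergence bound hmeas hbi hbd hlim
  simp only [hΨ] at hfin
  have h0 := tendsto_nhds_unique hfin tendsto_const_nhds
  rw [integral_const_mul, integral_complex_ofReal] at h0
  have hpos : (∫ u : Fin 2 → ℝ, ∏ i, Real.exp (-1 * u i ^ 2)) ≠ 0 := by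
    rw [integral_fintype_prod_volume_eq_prod (fun (_ : Fin 2) x => Real.exp (-1 * x ^ 2))]
    simp only [integral_gaussian, Finset.prod_const]
    positivity
  rcases mul_eq_zero.mp h0 with h | h
  · exact h
  · exact absurd (Complex.ofReal_eq_zero.mp h) hpos

/-- A function on a three-dimensional box which is annihilated by a complex vector field with two
independent first integrals, and which vanishes on all faces but one, vanishes at the centre of
the remaining face. -/
lemma eq_zero_of_vanish_on_faces {η r : ℝ} (hη : 0 ≤ η) (hr : 0 < r)
    {h ζ₁ ζ₂ : (Fin 3 → ℝ) → ℂ}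
    (hh : ContDiff ℝ ∞ h) (h₁ : ContDiff ℝ ∞ ζ₁) (h₂ : ContDiff ℝ ∞ ζ₂)
    (hker : ∀ x ∈ Set.Icc ![0, -r, -r] ![η, r, r], ∃ ξ : Fin 3 → ℂ, ξ ≠ 0 ∧
      (∑ j, fderiv ℝ h x (Pi.single j 1) * ξ j = 0) ∧
      (∑ j, fderiv ℝ ζ₁ x (Pi.single j 1) * ξ j = 0) ∧
      (∑ j, fderiv ℝ ζ₂ x (Pi.single j 1) * ξ j = 0))
    (hzero : ∀ x ∈ Set.Icc ![0, -r, -r] ![η, r, r],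
      x 0 = η ∨ x 1 = -r ∨ x 1 = r ∨ x 2 = -r ∨ x 2 = r → h x = 0)
    (z₁ : ζ₁ 0 = 0) (z₂ : ζ₂ 0 = 0)
    (d₁₁ : fderiv ℝ ζ₁ 0 (Pi.single 1 1) = 1) (d₁₂ : fderiv ℝ ζ₁ 0 (Pi.single 2 1) = 0)
    (d₂₁ : fderiv ℝ ζ₂ 0 (Pi.single 1 1) = 0) (d₂₂ : fderiv ℝ ζ₂ 0 (Pi.single 2 1) = 1)
    (hre : ∀ x ∈ Set.Icc ![0, -r, -r] ![η, r, r], x 0 = 0 →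
      (1 / 2) * (x 1 ^ 2 + x 2 ^ 2) ≤ (ζ₁ x ^ 2 + ζ₂ x ^ 2).re) : h 0 = 0 := by
  have hab : (![0, -r, -r] : Fin 3 → ℝ) ≤ ![η, r, r] := by
    intro i; fin_cases i <;> simp <;> linarith
  let ι : (Fin 2 → ℝ) →L[ℝ] (Fin 3 → ℝ) :=
    ContinuousLinearMap.pi (Fin.cons 0 fun i => ContinuousLinearMap.proj i)
  have hι : ∀ y : Fin 2 → ℝ, ι y = Fin.cons 0 y := by
    intro y; ext i
    refine Fin.cases ?_ (fun j => ?_) i <;> simp [ι]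
  have hcons : ∀ y : Fin 2 → ℝ, (Fin.cons 0 y : Fin 3 → ℝ) 2 = y 1 := fun y => rfl
  have hmem : ∀ y ∈ Set.Icc (fun _ => -r) (fun _ => r : Fin 2 → ℝ),
      ι y ∈ Set.Icc (![0, -r, -r] : Fin 3 → ℝ) ![η, r, r] := by
    intro y hy
    have h0 := hy.1 0; have h1 := hy.1 1; have h2 := hy.2 0; have h3 := hy.2 1
    rw [hι]
    constructor <;> intro i <;> fin_cases i
    · simp
    · simpa using h0
    · simpa [hcons] using h1
    · simpa using hη
    · simpa using h2
    · simpa [hcons] using h3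
  have hsingle : ∀ u : Fin 2 → ℝ, ι u = u 0 • (Pi.single 1 1 : Fin 3 → ℝ) + u 1 • Pi.single 2 1 := by
    intro u; rw [hι]; ext i; fin_cases i <;> simp [hcons]
  let J : (Fin 3 → ℝ) → ℂ := fun x =>
    fderiv ℝ ζ₁ x (Pi.single 1 1) * fderiv ℝ ζ₂ x (Pi.single 2 1) -
      fderiv ℝ ζ₁ x (Pi.single 2 1) * fderiv ℝ ζ₂ x (Pi.single 1 1)
  have hJ : ContDiff ℝ ∞ J :=
    ((h₁.fderiv_apply_const _).mul (h₂.fderiv_apply_const _)).sub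
      ((h₁.fderiv_apply_const _).mul (h₂.fderiv_apply_const _))
  have hι0 : ι 0 = 0 := map_zero _
  have key := eq_zero_of_integral_gaussian_eq_zero (g := fun y => h (ι y) * J (ι y))
    (ζ₁ := fun y => ζ₁ (ι y)) (ζ₂ := fun y => ζ₂ (ι y)) (ℓ₁ := (fderiv ℝ ζ₁ 0).comp ι)
    (ℓ₂ := (fderiv ℝ ζ₂ 0).comp ι)
    ((hh.continuous.comp ι.continuous).mul (hJ.continuous.comp ι.continuous))
    (h₁.continuous.comp ι.continuous) (h₂.continuous.comp ι.continuous)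
    (by simp [z₁]) (by simp [z₂]) ?_ ?_ ?_ ?_ hr ?_ ?_
  · simpa [J, d₁₁, d₁₂, d₂₁, d₂₂] using key
  · have := (h₁.differentiable (by simp) (ι 0)).hasFDerivAt.comp (0 : Fin 2 → ℝ) ι.hasFDerivAt
    rwa [hι0] at this
  · have := (h₂.differentiable (by simp) (ι 0)).hasFDerivAt.comp (0 : Fin 2 → ℝ) ι.hasFDerivAt
    rwa [hι0] at this
  · intro u; simp [hsingle, d₁₁, d₁₂]
  · intro u; simp [hsingle, d₂₁, d₂₂]
  · intro u hu
    have := hre _ (hmem u hu) (by simp [hι])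
    simpa [hι, hcons] using this
  · intro n
    let e : (Fin 3 → ℝ) → ℂ := fun x => Complex.exp (-(n + 1) ^ 2 * (ζ₁ x ^ 2 + ζ₂ x ^ 2))
    have he : ContDiff ℝ ∞ e := (contDiff_const.mul ((h₁.pow 2).add (h₂.pow 2))).cexp
    have hS := integral_face_eq_zero hab (H := fun x => h x * e x) (hh.mul he) h₁ h₂ ?_ ?_
    · have hi : ∀ c d e : ℝ, (![c, d, e] ∘ Fin.succ : Fin 2 → ℝ) = ![d, e] := by
        intro c d e; ext i; fin_cases i <;> rfl
      have hc : ∀ c : ℝ, (![c, c] : Fin 2 → ℝ) = fun _ => c := by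
        intro c; ext i; fin_cases i <;> rfl
      rw [hi, hi, hc, hc] at hS
      refine Eq.trans ?_ hS
      refine MeasureTheory.integral_congr_ae (Filter.Eventually.of_forall fun y => ?_)
      simp only [e, J, hι, Matrix.cons_val_zero]
      ring
    · intro x hx
      obtain ⟨ξ, hξ, k0, k1, k2⟩ := hker x hx
      refine Matrix.exists_mulVec_eq_zero_iff.mp ⟨ξ, hξ, ?_⟩
      have hed : ∀ v, fderiv ℝ (fun x => h x * e x) x v = e x * fderiv ℝ h x v +
          h x * (e x * (-(n + 1) ^ 2 * (2 * ζ₁ x * fderiv ℝ ζ₁ x v + 2 * ζ₂ x * fderiv ℝ ζ₂ x v))) := by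
        intro v
        have D1 := (h₁.differentiable (by simp) x).hasFDerivAt
        have D2 := (h₂.differentiable (by simp) x).hasFDerivAt
        have De : HasFDerivAt e _ x := (((D1.pow 2).add (D2.pow 2)).const_mul (-((n : ℂ) + 1) ^ 2)).cexp
        have := ((hh.differentiable (by simp) x).hasFDerivAt.fun_mul De).fderiv
        rw [this]
        simp only [e, Pi.add_apply, add_apply, smul_apply,
          smul_eq_mul, nsmul_eq_mul]
        push_cast
        ring
      ext i
      fin_cases i
      · change ∑ j, fderiv ℝ (fun x => h x * e x) x (Pi.single j 1) * ξ j = 0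
        simp only [hed]
        have : ∀ j : Fin 3, (e x * fderiv ℝ h x (Pi.single j 1) +
          h x * (e x * (-(n + 1) ^ 2 * (2 * ζ₁ x * fderiv ℝ ζ₁ x (Pi.single j 1) +
            2 * ζ₂ x * fderiv ℝ ζ₂ x (Pi.single j 1))))) * ξ j =
            e x * (fderiv ℝ h x (Pi.single j 1) * ξ j) +
            h x * e x * (-(n + 1) ^ 2) * (2 * ζ₁ x) * (fderiv ℝ ζ₁ x (Pi.single j 1) * ξ j) +
            h x * e x * (-(n + 1) ^ 2) * (2 * ζ₂ x) * (fderiv ℝ ζ₂ x (Pi.single j 1) * ξ j) := by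
          intro j; ring
        simp only [this, Finset.sum_add_distrib, ← Finset.mul_sum, k0, k1, k2]
        ring
      · exact k1
      · exact k2
    · intro x hx hxf
      simp only [Matrix.cons_val_zero, Matrix.cons_val_one, Matrix.cons_val] at hxf
      rw [hzero x hx hxf, zero_mul]

/-- A real hypersurface in graph form `Im w = φ(z, Re w)`, in the coordinates `(z, Re w)`: the
horizontal lift of `v` at `x` is `(v, A x v)`. -/
structure CRGraph (Z : Type*) [NormedAddCommGroup Z] [InnerProductSpace ℝ Z] where
  /-- The complex structure on the base. -/
  J : Z →L[ℝ] Z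
  /-- The graphing function. -/
  φ : Z × ℝ → ℝ
  /-- The horizontal connection. -/
  A : Z × ℝ → Z →L[ℝ] ℝ
  J_sq : ∀ v, J (J v) = -v
  contDiff_φ : ContDiff ℝ ∞ φ
  contDiff_A : ContDiff ℝ ∞ A
  hasCompactSupport_A : HasCompactSupport A
  compat : ∀ x v, (A x (J v) : ℂ) + Complex.I * (fderiv ℝ φ x (J v, A x (J v)) : ℝ) =
    Complex.I * (A x v + Complex.I * (fderiv ℝ φ x (v, A x v) : ℝ))

namespace CRGraph

variable {Z : Type*} [NormedAddCommGroup Z] [InnerProductSpace ℝ Z] (G : CRGraph Z)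

/-- The tangential Cauchy–Riemann equations on `Ω`. -/
def IsCR (h : Z × ℝ → ℂ) (Ω : Set (Z × ℝ)) : Prop :=
  ∀ x ∈ Ω, ∀ v, fderiv ℝ h x (G.J v, G.A x (G.J v)) = Complex.I * fderiv ℝ h x (v, G.A x v)

variable (v : Z) (κ g : ℝ)

/-- The coordinate along `v` in a slice. -/
def sliceCoord (x : Fin 3 → ℝ) : ℝ := x 0 + 2 * κ * (x 1 ^ 2 + x 2 ^ 2) - g * x 2

/-- A three-dimensional slice through `b` in the direction of `v`. -/
def slice (b : Z × ℝ) (x : Fin 3 → ℝ) : Z × ℝ :=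
  b + (sliceCoord κ g x • (v, G.A b v) + x 1 • (G.J v, G.A b (G.J v)) + x 2 • (0, 1))

/-- The first complex coordinate of a slice. -/
noncomputable def holo₁ (x : Fin 3 → ℝ) : ℂ := sliceCoord κ g x + Complex.I * x 1

/-- The second complex coordinate of a slice. -/
noncomputable def holo₂ (b : Z × ℝ) (x : Fin 3 → ℝ) : ℂ :=
  ((G.slice v κ g b x).2 - b.2 : ℝ) + Complex.I * (G.φ (G.slice v κ g b x) - G.φ b : ℝ)

/-- The second first integral, normalized at the origin. -/
noncomputable def normal₂ (b : Z × ℝ) (x : Fin 3 → ℝ) : ℂ :=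
  (G.holo₂ v κ g b x - (G.A b v + Complex.I * (fderiv ℝ G.φ b (v, G.A b v) : ℝ)) *
    holo₁ κ g x) / (1 + Complex.I * (fderiv ℝ G.φ b (0, 1) : ℝ))

/-- The first first integral, normalized at the origin. -/
noncomputable def normal₁ (b : Z × ℝ) (x : Fin 3 → ℝ) : ℂ :=
  -Complex.I * (holo₁ κ g x + g * G.normal₂ v κ g b x)

lemma one_add_I_mul_ne_zero (t : ℝ) : (1 : ℂ) + Complex.I * t ≠ 0 := by
  intro h
  simpa using congrArg Complex.re h

lemma contDiff_sliceCoord : ContDiff ℝ ∞ (sliceCoord κ g) := by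
  unfold sliceCoord; fun_prop

lemma contDiff_holo₁ : ContDiff ℝ ∞ (holo₁ κ g) := by
  have := contDiff_sliceCoord κ g
  have h2 := Complex.ofRealCLM.contDiff (n := ∞)
  unfold holo₁
  exact (h2.comp this).add (contDiff_const.mul (h2.comp (contDiff_apply ℝ ℝ 1)))

lemma contDiff_slice : ContDiff ℝ ∞ fun y : (Z × ℝ) × (Fin 3 → ℝ) => G.slice v κ g y.1 y.2 := by
  have h1 := contDiff_sliceCoord κ g
  have h2 := G.contDiff_A
  unfold slice
  fun_prop

lemma contDiff_fderiv_φ (c : ℝ) : ContDiff ℝ ∞ fun b : Z × ℝ => fderiv ℝ G.φ b (0, c) := by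
  exact G.contDiff_φ.fderiv_apply_const _

lemma contDiff_fderiv_φ' : ContDiff ℝ ∞ fun b : Z × ℝ => fderiv ℝ G.φ b (v, G.A b v) := by
  have h1 := G.contDiff_φ.fderiv_right (m := ∞) (by simp)
  have h2 := G.contDiff_A
  exact h1.clm_apply (by fun_prop)

lemma contDiff_holo₂ : ContDiff ℝ ∞ fun y : (Z × ℝ) × (Fin 3 → ℝ) => G.holo₂ v κ g y.1 y.2 := by
  have h1 := G.contDiff_slice v κ g
  have h2 := Complex.ofRealCLM.contDiff (n := ∞)
  have h3 := G.contDiff_φ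
  unfold holo₂
  exact (h2.comp (h1.snd.sub contDiff_fst.snd)).add
    (contDiff_const.mul (h2.comp ((h3.comp h1).sub (h3.comp contDiff_fst))))

lemma contDiff_normal₂ :
    ContDiff ℝ ∞ fun y : (Z × ℝ) × (Fin 3 → ℝ) => G.normal₂ v κ g y.1 y.2 := by
  have h1 := G.contDiff_holo₂ v κ g
  have h2 := Complex.ofRealCLM.contDiff (n := ∞)
  have h3 : ContDiff ℝ ∞ fun b : Z × ℝ => G.A b v := G.contDiff_A.clm_apply contDiff_const
  unfold normal₂
  simp only [div_eq_mul_inv]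
  refine ContDiff.mul (h1.sub (ContDiff.mul ?_ ((contDiff_holo₁ κ g).comp contDiff_snd)))
    (ContDiff.inv ?_ ?_)
  · exact (h2.comp (h3.comp contDiff_fst)).add
      (contDiff_const.mul (h2.comp ((G.contDiff_fderiv_φ' v).comp contDiff_fst)))
  · exact contDiff_const.add
      (contDiff_const.mul (h2.comp ((G.contDiff_fderiv_φ 1).comp contDiff_fst)))
  · exact fun y => one_add_I_mul_ne_zero _

lemma contDiff_normal₁ :
    ContDiff ℝ ∞ fun y : (Z × ℝ) × (Fin 3 → ℝ) => G.normal₁ v κ g y.1 y.2 := by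
  have := G.contDiff_normal₂ v κ g
  unfold normal₁
  exact contDiff_const.mul (((contDiff_holo₁ κ g).comp contDiff_snd).add (contDiff_const.mul this))

/-- The derivative of a slice. -/
lemma fderiv_slice (b : Z × ℝ) (x u : Fin 3 → ℝ) :
    fderiv ℝ (G.slice v κ g b) x u =
      (u 0 + 4 * κ * (x 1 * u 1 + x 2 * u 2) - g * u 2) • (v, G.A b v) +
        u 1 • (G.J v, G.A b (G.J v)) + u 2 • (0, 1) := by
  have hp : ∀ i : Fin 3, HasFDerivAt (fun x : Fin 3 → ℝ => x i)
      (ContinuousLinearMap.proj (R := ℝ) (φ := fun _ : Fin 3 => ℝ) i) x :=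
    fun i => (ContinuousLinearMap.proj (R := ℝ) (φ := fun _ : Fin 3 => ℝ) i).hasFDerivAt
  have hk : HasFDerivAt (sliceCoord κ g) _ x :=
    ((hp 0).add ((((hp 1).pow 2).add ((hp 2).pow 2)).const_mul (2 * κ))).sub ((hp 2).const_mul g)
  have := (((hk.smul_const (v, G.A b v)).add ((hp 1).smul_const (G.J v, G.A b (G.J v)))).add
    ((hp 2).smul_const ((0 : Z), (1 : ℝ)))).const_add b
  have h2 : HasFDerivAt (G.slice v κ g b) _ x := this
  rw [h2.fderiv]
  simp only [add_apply, ContinuousLinearMap.smulRight_apply, sub_apply, smul_apply,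
    ContinuousLinearMap.proj_apply, smul_eq_mul, nsmul_eq_mul]
  congr 3
  push_cast
  ring

lemma fderiv_holo₁ (x u : Fin 3 → ℝ) : fderiv ℝ (holo₁ κ g) x u =
    (u 0 + 4 * κ * (x 1 * u 1 + x 2 * u 2) - g * u 2 : ℝ) + Complex.I * u 1 := by
  have hp : ∀ i : Fin 3, HasFDerivAt (fun x : Fin 3 → ℝ => x i)
      (ContinuousLinearMap.proj (R := ℝ) (φ := fun _ : Fin 3 => ℝ) i) x :=
    fun i => (ContinuousLinearMap.proj (R := ℝ) (φ := fun _ : Fin 3 => ℝ) i).hasFDerivAt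
  have hk : HasFDerivAt (sliceCoord κ g) _ x :=
    ((hp 0).add ((((hp 1).pow 2).add ((hp 2).pow 2)).const_mul (2 * κ))).sub ((hp 2).const_mul g)
  have h2 : HasFDerivAt (holo₁ κ g) _ x :=
    (Complex.ofRealCLM.hasFDerivAt.comp x hk).add
      ((Complex.ofRealCLM.hasFDerivAt.comp x (hp 1)).const_mul Complex.I)
  rw [h2.fderiv]
  simp only [add_apply, ContinuousLinearMap.comp_apply, sub_apply, smul_apply,
    ContinuousLinearMap.proj_apply, smul_eq_mul, nsmul_eq_mul, Complex.ofRealCLM_apply]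
  congr 2
  push_cast
  ring

lemma contDiff_slice_right (b : Z × ℝ) : ContDiff ℝ ∞ (G.slice v κ g b) :=
  (G.contDiff_slice v κ g).comp (contDiff_const.prodMk contDiff_id)

lemma fderiv_holo₂ (b : Z × ℝ) (x u : Fin 3 → ℝ) : fderiv ℝ (G.holo₂ v κ g b) x u =
    ((fderiv ℝ (G.slice v κ g b) x u).2 : ℝ) +
      Complex.I * (fderiv ℝ G.φ (G.slice v κ g b x) (fderiv ℝ (G.slice v κ g b) x u) : ℝ) := by
  have hX := ((G.contDiff_slice_right v κ g b).differentiable (by simp) x).hasFDerivAt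
  have hφ := (G.contDiff_φ.differentiable (by simp) (G.slice v κ g b x)).hasFDerivAt
  have h2 : HasFDerivAt (G.holo₂ v κ g b) _ x :=
    (Complex.ofRealCLM.hasFDerivAt.comp x (hX.snd.sub_const b.2)).add
      ((Complex.ofRealCLM.hasFDerivAt.comp x ((hφ.comp x hX).sub_const (G.φ b))).const_mul
        Complex.I)
  rw [h2.fderiv]
  simp

lemma fderiv_normal₂ (b : Z × ℝ) (x u : Fin 3 → ℝ) : fderiv ℝ (G.normal₂ v κ g b) x u =
    (fderiv ℝ (G.holo₂ v κ g b) x u -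
      (G.A b v + Complex.I * (fderiv ℝ G.φ b (v, G.A b v) : ℝ)) *
        fderiv ℝ (holo₁ κ g) x u) / (1 + Complex.I * (fderiv ℝ G.φ b (0, 1) : ℝ)) := by
  have h2 : ContDiff ℝ ∞ (G.holo₂ v κ g b) :=
    (G.contDiff_holo₂ v κ g).comp (contDiff_const.prodMk contDiff_id)
  have d2 := (h2.differentiable (by simp) x).hasFDerivAt
  have d1 := ((contDiff_holo₁ κ g).differentiable (by simp) x).hasFDerivAt
  have := (d2.fun_sub (d1.const_mul
    (G.A b v + Complex.I * (fderiv ℝ G.φ b (v, G.A b v) : ℝ)))).mul_const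
      (1 + Complex.I * (fderiv ℝ G.φ b (0, 1) : ℝ))⁻¹
  have e : G.normal₂ v κ g b = fun x => (G.holo₂ v κ g b x -
      (G.A b v + Complex.I * (fderiv ℝ G.φ b (v, G.A b v) : ℝ)) * holo₁ κ g x) *
      (1 + Complex.I * (fderiv ℝ G.φ b (0, 1) : ℝ))⁻¹ := by
    funext x
    simp only [normal₂, div_eq_mul_inv]
  rw [e, this.fderiv]
  simp only [sub_apply, smul_apply, smul_eq_mul]
  rw [div_eq_mul_inv, mul_comm]

lemma contDiff_normal₂_right (b : Z × ℝ) : ContDiff ℝ ∞ (G.normal₂ v κ g b) :=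
  ContDiff.comp (g := fun y : (Z × ℝ) × (Fin 3 → ℝ) => G.normal₂ v κ g y.1 y.2)
    (f := fun x => (b, x)) (G.contDiff_normal₂ v κ g) (contDiff_const.prodMk contDiff_id)

lemma contDiff_normal₁_right (b : Z × ℝ) : ContDiff ℝ ∞ (G.normal₁ v κ g b) :=
  ContDiff.comp (g := fun y : (Z × ℝ) × (Fin 3 → ℝ) => G.normal₁ v κ g y.1 y.2)
    (f := fun x => (b, x)) (G.contDiff_normal₁ v κ g) (contDiff_const.prodMk contDiff_id)

lemma fderiv_normal₁ (b : Z × ℝ) (x u : Fin 3 → ℝ) : fderiv ℝ (G.normal₁ v κ g b) x u =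
    -Complex.I * (fderiv ℝ (holo₁ κ g) x u + g * fderiv ℝ (G.normal₂ v κ g b) x u) := by
  have d2 := ((G.contDiff_normal₂_right v κ g b).differentiable (by simp) x).hasFDerivAt
  have d1 := ((contDiff_holo₁ κ g).differentiable (by simp) x).hasFDerivAt
  have := (d1.fun_add (d2.const_mul (g : ℂ))).const_mul (-Complex.I)
  have e : G.normal₁ v κ g b =
      fun x => -Complex.I * (holo₁ κ g x + g * G.normal₂ v κ g b x) := rfl
  rw [e, this.fderiv]
  simp only [add_apply, smul_apply, smul_eq_mul]

lemma slice_zero (b : Z × ℝ) : G.slice v κ g b 0 = b := by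
  simp [slice, sliceCoord]

/-- Normalization of the first integrals at the centre of a slice. -/
lemma fderiv_normal_zero (b : Z × ℝ) :
    fderiv ℝ (G.normal₁ v κ g b) 0 (Pi.single 1 1) = 1 ∧
    fderiv ℝ (G.normal₁ v κ g b) 0 (Pi.single 2 1) = 0 ∧
    fderiv ℝ (G.normal₂ v κ g b) 0 (Pi.single 1 1) = 0 ∧
    fderiv ℝ (G.normal₂ v κ g b) 0 (Pi.single 2 1) = 1 := by
  have hs := one_add_I_mul_ne_zero (fderiv ℝ G.φ b (0, 1))
  have e1 : fderiv ℝ (G.normal₂ v κ g b) 0 (Pi.single 1 1) = 0 := by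
    rw [fderiv_normal₂, fderiv_holo₂, fderiv_holo₁, fderiv_slice, slice_zero]
    have := G.compat b v
    simp only [Pi.zero_apply, Pi.single_eq_same]
    rw [Pi.single_eq_of_ne (by decide), Pi.single_eq_of_ne (by decide)]
    simp [this]
    left; ring
  have e2 : fderiv ℝ (G.normal₂ v κ g b) 0 (Pi.single 2 1) = 1 := by
    rw [fderiv_normal₂, fderiv_holo₂, fderiv_holo₁, fderiv_slice, slice_zero, div_eq_one_iff_eq hs]
    simp only [Pi.zero_apply, Pi.single_eq_same]
    rw [Pi.single_eq_of_ne (by decide), Pi.single_eq_of_ne (by decide)]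
    simp only [mul_zero, add_zero, mul_one, zero_sub, zero_smul, one_smul,
      map_add, map_smul, neg_smul, map_neg, Prod.snd_add, Prod.snd_neg, Prod.smul_snd, smul_eq_mul]
    push_cast
    ring
  refine ⟨?_, ?_, e1, e2⟩
  · rw [fderiv_normal₁, e1, fderiv_holo₁]
    simp only [Pi.zero_apply, Pi.single_eq_same]
    rw [Pi.single_eq_of_ne (by decide), Pi.single_eq_of_ne (by decide)]
    simp
  · rw [fderiv_normal₁, e2, fderiv_holo₁]
    simp only [Pi.zero_apply, Pi.single_eq_same]
    rw [Pi.single_eq_of_ne (by decide), Pi.single_eq_of_ne (by decide)]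
    simp

/-- A common annihilator of the tangential Cauchy–Riemann functions in a slice. -/
lemma exists_annihilator {h : Z × ℝ → ℂ} (hh : ContDiff ℝ ∞ h) {Ω : Set (Z × ℝ)}
    (hCR : G.IsCR h Ω) (b : Z × ℝ) (x : Fin 3 → ℝ) (hx : G.slice v κ g b x ∈ Ω) :
    ∃ ξ : Fin 3 → ℂ, ξ ≠ 0 ∧
      (∑ j, fderiv ℝ (fun x => h (G.slice v κ g b x)) x (Pi.single j 1) * ξ j = 0) ∧
      (∑ j, fderiv ℝ (G.normal₁ v κ g b) x (Pi.single j 1) * ξ j = 0) ∧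
      (∑ j, fderiv ℝ (G.normal₂ v κ g b) x (Pi.single j 1) * ξ j = 0) := by
  set X := G.slice v κ g b x with hX
  set a : ℝ := G.A X v - G.A b v with ha
  set a' : ℝ := G.A X (G.J v) - G.A b (G.J v) with ha'
  set q : ℝ := g - 4 * κ * x 2 with hq
  let ξ : Fin 3 → ℂ := ![-4 * κ * x 1 + a' * q - Complex.I * (1 + a * q), 1, a' - Complex.I * a]
  have hU : (v, G.A X v) = (v, G.A b v) + a • ((0 : Z), (1 : ℝ)) := by
    ext <;> simp [ha]
  have hU' : (G.J v, G.A X (G.J v)) = (G.J v, G.A b (G.J v)) + a' • ((0 : Z), (1 : ℝ)) := by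
    ext <;> simp [ha']
  have key : ∀ (D : (Fin 3 → ℝ) → ℂ) (d1 d2 d3 : ℂ),
      (∀ u, D u = (u 0 + 4 * κ * (x 1 * u 1 + x 2 * u 2) - g * u 2 : ℝ) * d1 + u 1 * d2 +
        u 2 * d3) → d2 + a' * d3 = Complex.I * (d1 + a * d3) →
      ∑ j, D (Pi.single j 1) * ξ j = 0 := by
    intro D d1 d2 d3 hD hd
    rw [Fin.sum_univ_three, hD, hD, hD]
    simp only [Pi.single_eq_same, ξ, Matrix.cons_val_zero, Matrix.cons_val_one, Matrix.cons_val]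
    rw [Pi.single_eq_of_ne (by decide), Pi.single_eq_of_ne (by decide),
      Pi.single_eq_of_ne (by decide), Pi.single_eq_of_ne (by decide),
      Pi.single_eq_of_ne (by decide), Pi.single_eq_of_ne (by decide)]
    push_cast [hq]
    linear_combination hd
  have k1 : ∑ j, fderiv ℝ (holo₁ κ g) x (Pi.single j 1) * ξ j = 0 := by
    refine key _ 1 Complex.I 0 (fun u => ?_) (by simp)
    rw [fderiv_holo₁]; ring
  have k2 : ∑ j, fderiv ℝ (G.holo₂ v κ g b) x (Pi.single j 1) * ξ j = 0 := by
    refine key _ (G.A b v + Complex.I * (fderiv ℝ G.φ X (v, G.A b v) : ℝ))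
      (G.A b (G.J v) + Complex.I * (fderiv ℝ G.φ X (G.J v, G.A b (G.J v)) : ℝ))
      (1 + Complex.I * (fderiv ℝ G.φ X (0, 1) : ℝ)) (fun u => ?_) ?_
    · rw [fderiv_holo₂, fderiv_slice, ← hX]
      simp only [map_add, map_smul, Prod.snd_add, Prod.smul_snd, smul_eq_mul]
      push_cast
      ring
    · have := G.compat X v
      rw [hU, hU', map_add, map_add, map_smul, map_smul] at this
      have e1 : G.A X v = G.A b v + a := by rw [ha]; ring
      have e2 : G.A X (G.J v) = G.A b (G.J v) + a' := by rw [ha']; ring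
      rw [e1, e2] at this
      simp only [smul_eq_mul] at this
      push_cast at this
      linear_combination this
  have k3 : ∑ j, fderiv ℝ (G.normal₂ v κ g b) x (Pi.single j 1) * ξ j = 0 := by
    simp only [fderiv_normal₂]
    have : ∀ (A B C D E : ℂ), (A - B * C) / D * E = D⁻¹ * (A * E) - D⁻¹ * B * (C * E) := by
      intros; ring
    simp only [this, Finset.sum_sub_distrib, ← Finset.mul_sum, k1, k2]
    ring
  refine ⟨ξ, fun h0 => by simpa [ξ] using congrFun h0 1, ?_, ?_, k3⟩
  · have hd := (hh.differentiable (by simp) X).hasFDerivAt.comp x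
      ((G.contDiff_slice_right v κ g b).differentiable (by simp) x).hasFDerivAt
    have hd' : fderiv ℝ (fun x => h (G.slice v κ g b x)) x = _ := hd.fderiv
    refine key _ (fderiv ℝ h X (v, G.A b v)) (fderiv ℝ h X (G.J v, G.A b (G.J v)))
      (fderiv ℝ h X (0, 1)) (fun u => ?_) ?_
    · rw [hd', ContinuousLinearMap.comp_apply, fderiv_slice]
      simp only [map_add, map_smul, Complex.real_smul]
    · have := hCR X hx v
      rw [hU, hU', map_add, map_add, map_smul, map_smul] at this
      simpa only [Complex.real_smul] using this
  · simp only [fderiv_normal₁]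
    have : ∀ (A B C D : ℂ), -Complex.I * (A + B * C) * D =
        -Complex.I * (A * D) + -Complex.I * B * (C * D) := by
      intros; ring
    simp only [this, Finset.sum_add_distrib, ← Finset.mul_sum, k1, k3]
    ring

end CRGraph

/-- A smooth family vanishing at the origin is uniformly close to its linearization on the plane
`x 0 = 0`. -/
lemma exists_norm_sub_linear_le {B : Type*} [NormedAddCommGroup B] [NormedSpace ℝ B]
    {F : B × (Fin 3 → ℝ) → ℂ} (hF : ContDiff ℝ ∞ F) (h0 : ∀ b, F (b, 0) = 0) (p : B) {ε : ℝ}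
    (hε : 0 < ε) : ∀ᶠ y in 𝓝 (p, (0 : ℝ)), ∀ x : Fin 3 → ℝ, ‖x‖ ≤ y.2 → x 0 = 0 →
      ‖F (y.1, x) - (x 1 * fderiv ℝ F (p, 0) (0, Pi.single 1 1) +
        x 2 * fderiv ℝ F (p, 0) (0, Pi.single 2 1))‖ ≤ ε * (|x 1| + |x 2|) := by
  have hev : ∀ i : Fin 3, ∀ᶠ y in 𝓝 (p, (0 : Fin 3 → ℝ)),
      ‖fderiv ℝ F y (0, Pi.single i 1) - fderiv ℝ F (p, 0) (0, Pi.single i 1)‖ < ε := by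
    intro i
    have hc := (hF.fderiv_apply_const ((0 : B), (Pi.single i 1 : Fin 3 → ℝ))).continuous
    have := (hc.tendsto (p, 0)).eventually (Metric.ball_mem_nhds _ hε)
    filter_upwards [this] with y hy
    rwa [← dist_eq_norm]
  obtain ⟨δ, hδ, hball⟩ := Metric.eventually_nhds_iff_ball.mp ((hev 1).and (hev 2))
  filter_upwards [Metric.ball_mem_nhds (p, (0 : ℝ)) hδ] with y hy x hx hx0
  rw [Metric.mem_ball, Prod.dist_eq, max_lt_iff] at hy
  set a₁ := fderiv ℝ F (p, 0) (0, Pi.single 1 1)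
  set a₂ := fderiv ℝ F (p, 0) (0, Pi.single 2 1)
  have hxy : ‖x‖ < δ := by
    have h2 := hy.2
    rw [Real.dist_0_eq_abs] at h2
    exact lt_of_le_of_lt (hx.trans (le_abs_self _)) h2
  have hdec : ((0 : B), x) = x 1 • ((0 : B), (Pi.single 1 1 : Fin 3 → ℝ)) +
      x 2 • ((0 : B), (Pi.single 2 1 : Fin 3 → ℝ)) := by
    ext i
    · simp
    · fin_cases i <;> simp [hx0]
  have hd : ∀ t : ℝ, HasDerivAt (fun t : ℝ => F (y.1, t • x) - t • (x 1 * a₁ + x 2 * a₂))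
      (fderiv ℝ F (y.1, t • x) (0, x) - (x 1 * a₁ + x 2 * a₂)) t := by
    intro t
    have h1 : HasDerivAt (fun t : ℝ => (y.1, t • x)) ((0 : B), x) t := by
      have := (hasDerivAt_const t y.1).prodMk ((hasDerivAt_id t).smul_const x)
      simpa using this
    have h2 := (hF.differentiable (by simp) (y.1, t • x)).hasFDerivAt.comp_hasDerivAt t h1
    have h3 := (hasDerivAt_id t).smul_const ((x 1 : ℂ) * a₁ + x 2 * a₂)
    rw [one_smul] at h3
    exact h2.sub h3
  have := norm_image_sub_le_of_norm_deriv_le_segment_01'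
    (fun t _ => (hd t).hasDerivWithinAt) (C := ε * (|x 1| + |x 2|)) (fun t ht => ?_)
  · simpa [h0] using this
  · have hmem : (y.1, t • x) ∈ Metric.ball (p, (0 : Fin 3 → ℝ)) δ := by
      rw [Metric.mem_ball, Prod.dist_eq, max_lt_iff]
      refine ⟨hy.1, ?_⟩
      rw [dist_zero_right, norm_smul, Real.norm_of_nonneg ht.1]
      exact lt_of_le_of_lt (mul_le_of_le_one_left (norm_nonneg _) ht.2.le) hxy
    obtain ⟨e1, e2⟩ := hball _ hmem
    rw [hdec, map_add, map_smul, map_smul]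
    have : x 1 • fderiv ℝ F (y.1, t • x) (0, Pi.single 1 1) +
        x 2 • fderiv ℝ F (y.1, t • x) (0, Pi.single 2 1) - (x 1 * a₁ + x 2 * a₂) =
        x 1 • (fderiv ℝ F (y.1, t • x) (0, Pi.single 1 1) - a₁) +
        x 2 • (fderiv ℝ F (y.1, t • x) (0, Pi.single 2 1) - a₂) := by
      simp only [Complex.real_smul]; ring
    rw [this]
    refine (norm_add_le _ _).trans ?_
    rw [norm_smul, norm_smul, Real.norm_eq_abs, Real.norm_eq_abs]
    nlinarith [abs_nonneg (x 1), abs_nonneg (x 2)]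

lemma half_sq_le_re_sq {s t : ℝ} {a b : ℂ} (ha : ‖a - s‖ ≤ 1 / 20 * (|s| + |t|))
    (hb : ‖b - t‖ ≤ 1 / 20 * (|s| + |t|)) :
    1 / 2 * (s ^ 2 + t ^ 2) ≤ (a ^ 2 + b ^ 2).re := by
  have key : ∀ (c : ℂ) (r : ℝ), r ^ 2 - 2 * |r| * ‖c - r‖ - ‖c - r‖ ^ 2 ≤ (c ^ 2).re := by
    intro c r
    set e := c - r
    have hc : c = r + e := by simp [e]
    have h1 : (c ^ 2).re = r ^ 2 + 2 * (r * e.re) + (e.re ^ 2 - e.im ^ 2) := by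
      rw [hc]; simp [pow_two]; ring
    have h2 : ‖e‖ ^ 2 = e.re ^ 2 + e.im ^ 2 := by
      rw [← Complex.normSq_eq_norm_sq, Complex.normSq_apply]; ring
    have h3 : |r * e.re| ≤ |r| * ‖e‖ := by
      rw [abs_mul]
      exact mul_le_mul_of_nonneg_left (Complex.abs_re_le_norm e) (abs_nonneg _)
    have h4 := neg_abs_le (r * e.re)
    rw [h1]
    nlinarith [sq_nonneg e.re]
  have k1 := key a s
  have k2 := key b t
  rw [Complex.add_re]
  have hs := sq_abs s
  have ht := sq_abs t
  set S := |s|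
  set T := |t|
  set x := ‖a - s‖
  set y := ‖b - t‖
  have hS : 0 ≤ S := abs_nonneg _
  have hT : 0 ≤ T := abs_nonneg _
  have hx : 0 ≤ x := norm_nonneg _
  have hy : 0 ≤ y := norm_nonneg _
  have i1 : S * x ≤ S * (1 / 20 * (S + T)) := mul_le_mul_of_nonneg_left ha hS
  have i2 : T * y ≤ T * (1 / 20 * (S + T)) := mul_le_mul_of_nonneg_left hb hT
  have i3 : x ^ 2 ≤ (1 / 20 * (S + T)) ^ 2 := pow_le_pow_left₀ hx ha 2
  have i4 : y ^ 2 ≤ (1 / 20 * (S + T)) ^ 2 := pow_le_pow_left₀ hy hb 2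
  nlinarith [sq_nonneg (S - T)]

namespace CRGraph

variable {Z : Type*} [NormedAddCommGroup Z] [InnerProductSpace ℝ Z] (G : CRGraph Z)
  (v : Z) (κ g : ℝ)

lemma normal_apply_zero (b : Z × ℝ) : G.normal₁ v κ g b 0 = 0 ∧ G.normal₂ v κ g b 0 = 0 := by
  have h1 : holo₁ κ g 0 = 0 := by simp [holo₁, sliceCoord]
  have h2 : G.holo₂ v κ g b 0 = 0 := by simp [holo₂, slice_zero]
  have h3 : G.normal₂ v κ g b 0 = 0 := by rw [normal₂, h1, h2]; simp
  exact ⟨by rw [normal₁, h1, h3]; simp, h3⟩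

lemma fderiv_partial {B : Type*} [NormedAddCommGroup B] [NormedSpace ℝ B]
    {F : B → (Fin 3 → ℝ) → ℂ} (hF : ContDiff ℝ ∞ fun y : B × (Fin 3 → ℝ) => F y.1 y.2) (b : B)
    (x u : Fin 3 → ℝ) :
    fderiv ℝ (fun y : B × (Fin 3 → ℝ) => F y.1 y.2) (b, x) (0, u) = fderiv ℝ (F b) x u := by
  have h1 : HasFDerivAt (fun x : Fin 3 → ℝ => (b, x)) (ContinuousLinearMap.inr ℝ B _) x :=
    hasFDerivAt_prodMk_right b x
  have h2 := ((hF.differentiable (by simp) (b, x)).hasFDerivAt.comp x h1).fderiv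
  have h3 : fderiv ℝ (F b) x = _ := h2
  rw [h3]; simp

/-- On small boxes the squares of the normalized first integrals have positive real part. -/
lemma eventually_re_sq (p : Z × ℝ) : ∀ᶠ y in 𝓝 (p, (0 : ℝ)), ∀ x : Fin 3 → ℝ, ‖x‖ ≤ y.2 →
    x 0 = 0 → 1 / 2 * (x 1 ^ 2 + x 2 ^ 2) ≤
      (G.normal₁ v κ g y.1 x ^ 2 + G.normal₂ v κ g y.1 x ^ 2).re := by
  obtain ⟨d1, d2, d3, d4⟩ := G.fderiv_normal_zero v κ g p
  have e1 := exists_norm_sub_linear_le (G.contDiff_normal₁ v κ g)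
    (fun b => (G.normal_apply_zero v κ g b).1) p (ε := 1 / 20) (by norm_num)
  have e2 := exists_norm_sub_linear_le (G.contDiff_normal₂ v κ g)
    (fun b => (G.normal_apply_zero v κ g b).2) p (ε := 1 / 20) (by norm_num)
  rw [fderiv_partial (G.contDiff_normal₁ v κ g), fderiv_partial (G.contDiff_normal₁ v κ g),
    d1, d2] at e1
  rw [fderiv_partial (G.contDiff_normal₂ v κ g), fderiv_partial (G.contDiff_normal₂ v κ g),
    d3, d4] at e2
  filter_upwards [e1, e2] with y h1 h2 x hx hx0
  have i1 := h1 x hx hx0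
  have i2 := h2 x hx hx0
  rw [mul_one, mul_zero, add_zero] at i1
  rw [mul_one, mul_zero, zero_add] at i2
  exact half_sq_le_re_sq i1 i2

end CRGraph

namespace CRGraph

variable {Z : Type*} [NormedAddCommGroup Z] [InnerProductSpace ℝ Z] (G : CRGraph Z)

/-- The squared Euclidean norm on `Z × ℝ`. -/
def sqNorm (x : Z × ℝ) : ℝ := ‖x.1‖ ^ 2 + x.2 ^ 2

lemma sqNorm_nonneg (x : Z × ℝ) : 0 ≤ sqNorm x := by unfold sqNorm; positivity

lemma sqNorm_smul (c : ℝ) (x : Z × ℝ) : sqNorm (c • x) = c ^ 2 * sqNorm x := by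
  simp only [sqNorm, Prod.smul_fst, Prod.smul_snd, norm_smul, Real.norm_eq_abs, smul_eq_mul,
    mul_pow, sq_abs]
  ring

lemma sqNorm_add (x y : Z × ℝ) :
    sqNorm (x + y) = sqNorm x + 2 * (inner ℝ y.1 x.1 + y.2 * x.2) + sqNorm y := by
  simp only [sqNorm, Prod.fst_add, Prod.snd_add, norm_add_sq_real, real_inner_comm y.1]
  ring

lemma sqNorm_add_three_le (x y z : Z × ℝ) :
    sqNorm (x + y + z) ≤ 3 * (sqNorm x + sqNorm y + sqNorm z) := by
  have h1 : ‖(x + y + z).1‖ ≤ ‖x.1‖ + ‖y.1‖ + ‖z.1‖ := norm_add₃_le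
  have h2 : ‖(x + y + z).1‖ ^ 2 ≤ (‖x.1‖ + ‖y.1‖ + ‖z.1‖) ^ 2 :=
    pow_le_pow_left₀ (norm_nonneg _) h1 2
  simp only [sqNorm, Prod.snd_add]
  nlinarith [sq_nonneg (‖x.1‖ - ‖y.1‖), sq_nonneg (‖y.1‖ - ‖z.1‖), sq_nonneg (‖x.1‖ - ‖z.1‖),
    sq_nonneg (x.2 - y.2), sq_nonneg (y.2 - z.2), sq_nonneg (x.2 - z.2)]

/-- A direction whose horizontal lift points into the ball, with `J`-image tangent to it. -/
lemma exists_direction {ℓ : Z →ₗ[ℝ] ℝ} (hℓ : ℓ ≠ 0) : ∃ v, 0 < ℓ v ∧ ℓ (G.J v) = 0 := by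
  obtain ⟨v₀, hv₀⟩ : ∃ v₀, ℓ v₀ ≠ 0 := by
    by_contra! h; exact hℓ (LinearMap.ext h)
  refine ⟨ℓ v₀ • v₀ + ℓ (G.J v₀) • G.J v₀, ?_, ?_⟩
  · simp only [map_add, map_smul, smul_eq_mul]
    have := mul_self_pos.mpr hv₀
    nlinarith [mul_self_nonneg (ℓ (G.J v₀))]
  · simp only [map_add, map_smul, smul_eq_mul, G.J_sq, map_neg]
    ring

lemma bent_estimate {α C g κ t a x₁ x₂ k n Q : ℝ} (hα : 0 < α) (hC : 0 < C)
    (hκα : α * κ = C * (3 * g ^ 2 + 1)) (ha : 0 ≤ a) (hat : a ≤ t) (hx₁ : |x₁| ≤ t)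
    (hx₂ : |x₂| ≤ t) (ht₁ : 3 * C * t ≤ α) (ht₂ : 24 * κ ^ 2 * t ^ 2 ≤ 1)
    (hn : n = x₁ ^ 2 + x₂ ^ 2) (hpos : 0 < a ∨ 0 < n) (hk : k = a + 2 * κ * n - g * x₂)
    (hQ : Q ≤ C * (k ^ 2 + n)) : Q < 2 * (α * (a + 2 * κ * n)) := by
  have hk2 : k ^ 2 ≤ 3 * (a ^ 2 + 4 * κ ^ 2 * n ^ 2 + g ^ 2 * x₂ ^ 2) := by
    have : ∀ x y z : ℝ, (x + y - z) ^ 2 ≤ 3 * (x ^ 2 + y ^ 2 + z ^ 2) := by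
      intro x y z
      linarith [sq_nonneg (x - y), sq_nonneg (x + z), sq_nonneg (y + z)]
    rw [hk]
    refine (this _ _ _).trans (le_of_eq ?_)
    ring
  have hn0 : 0 ≤ n := by rw [hn]; positivity
  have hnt : n ≤ 2 * t ^ 2 := by
    have a1 := pow_le_pow_left₀ (abs_nonneg _) hx₁ 2
    have a2 := pow_le_pow_left₀ (abs_nonneg _) hx₂ 2
    rw [sq_abs] at a1 a2
    linarith
  have b1 : 3 * C * a ^ 2 ≤ α * a := by
    have : 3 * C * a ≤ α := (mul_le_mul_of_nonneg_left hat (by positivity)).trans ht₁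
    calc 3 * C * a ^ 2 = 3 * C * a * a := by ring
      _ ≤ α * a := mul_le_mul_of_nonneg_right this ha
  have b2 : 12 * κ ^ 2 * n ^ 2 ≤ n := by
    have h8 : 12 * κ ^ 2 * n ≤ 1 := by
      have := mul_le_mul_of_nonneg_left hnt (by positivity : 0 ≤ 12 * κ ^ 2)
      linarith
    calc 12 * κ ^ 2 * n ^ 2 = 12 * κ ^ 2 * n * n := by ring
      _ ≤ 1 * n := mul_le_mul_of_nonneg_right h8 hn0
      _ = n := one_mul n
  have b3 : g ^ 2 * x₂ ^ 2 ≤ g ^ 2 * n := by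
    apply mul_le_mul_of_nonneg_left _ (sq_nonneg g)
    rw [hn]; linarith [sq_nonneg x₁]
  have b4 : Q ≤ α * a + 2 * (C * (3 * g ^ 2 + 1)) * n := by
    refine hQ.trans ?_
    have : k ^ 2 + n ≤ 3 * a ^ 2 + n + 3 * (g ^ 2 * n) + n := by linarith
    have h9 := mul_le_mul_of_nonneg_left this hC.le
    have h10 : 0 ≤ C * (g ^ 2 * n) := by positivity
    linarith
  have hCg : 0 < C * (3 * g ^ 2 + 1) := by positivity
  have b5 : α * (a + 2 * κ * n) = α * a + 2 * (C * (3 * g ^ 2 + 1)) * n := by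
    rw [← hκα]; ring
  have b6 : 0 < α * a + 2 * (C * (3 * g ^ 2 + 1)) * n := by
    rcases hpos with h | h
    · have := mul_pos hα h
      have := mul_nonneg hCg.le hn0
      linarith
    · have := mul_pos hCg h
      have := mul_nonneg hα.le ha
      linarith
  linarith

set_option maxHeartbeats 1000000 in
/-- The bent slices stay strictly inside the ball away from their centre. -/
lemma exists_slice_inside (p c : Z × ℝ) {v : Z}
    (hα : 0 < inner ℝ v (c.1 - p.1) + G.A p v * (c.2 - p.2))
    (hJ : inner ℝ (G.J v) (c.1 - p.1) + G.A p (G.J v) * (c.2 - p.2) = 0) :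
    ∃ κ g, ∃ t₀ > (0 : ℝ), ∀ x : Fin 3 → ℝ, x ≠ 0 → 0 ≤ x 0 → x 0 ≤ t₀ → |x 1| ≤ t₀ → |x 2| ≤ t₀ →
      sqNorm (G.slice v κ g p x - c) < sqNorm (p - c) := by
  set α := inner ℝ v (c.1 - p.1) + G.A p v * (c.2 - p.2) with hαdef
  set e₁ : Z × ℝ := (v, G.A p v)
  set e₂ : Z × ℝ := (G.J v, G.A p (G.J v))
  set e₃ : Z × ℝ := (0, 1)
  set C : ℝ := 3 * (sqNorm e₁ + sqNorm e₂ + sqNorm e₃) + 1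
  have q1 := sqNorm_nonneg e₁
  have q2 := sqNorm_nonneg e₂
  have q3 := sqNorm_nonneg e₃
  have hC : 0 < C := by positivity
  set g := (c.2 - p.2) / α with hg
  set κ := C * (3 * g ^ 2 + 1) / α with hκ
  have hgα : α * g = c.2 - p.2 := by rw [hg]; field_simp
  have hκα : α * κ = C * (3 * g ^ 2 + 1) := by rw [hκ]; field_simp
  refine ⟨κ, g, min (α / (3 * C)) (1 / (5 * (|κ| + 1))), by positivity, ?_⟩
  intro x hx hx0 hxt hx1 hx2
  set t := min (α / (3 * C)) (1 / (5 * (|κ| + 1)))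
  have ht0 : 0 ≤ t := hx0.trans hxt
  have ht1 : 3 * C * t ≤ α := by
    have : t ≤ α / (3 * C) := min_le_left _ _
    rw [le_div_iff₀ (by positivity)] at this
    linarith
  have ht2 : 24 * κ ^ 2 * t ^ 2 ≤ 1 := by
    have : t ≤ 1 / (5 * (|κ| + 1)) := min_le_right _ _
    rw [le_div_iff₀ (by positivity)] at this
    have h5 : t * (5 * |κ|) ≤ 1 := by nlinarith
    have h6 : (t * (5 * |κ|)) ^ 2 ≤ 1 := pow_le_one₀ (by positivity) h5
    have h7 := sq_abs κ
    nlinarith [sq_nonneg (κ * t)]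
  set k := sliceCoord κ g x with hk
  set n := x 1 ^ 2 + x 2 ^ 2 with hn
  have hw : G.slice v κ g p x - c = (p - c) + (k • e₁ + x 1 • e₂ + x 2 • e₃) := by
    simp only [slice, ← hk]; abel
  rw [hw, sqNorm_add]
  set w := k • e₁ + x 1 • e₂ + x 2 • e₃ with hwdef
  have hin : inner ℝ w.1 (p - c).1 + w.2 * (p - c).2 = -α * (x 0 + 2 * κ * n) := by
    have h1 : inner ℝ w.1 (p - c).1 = -(k * inner ℝ v (c.1 - p.1) +
        x 1 * inner ℝ (G.J v) (c.1 - p.1)) := by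
      have : (p - c).1 = -(c.1 - p.1) := by simp
      rw [this, inner_neg_right]
      simp [w, e₁, e₂, e₃, inner_add_left, real_inner_smul_left]
    have h2 : w.2 * (p - c).2 = -((k * G.A p v + x 1 * G.A p (G.J v) + x 2) * (c.2 - p.2)) := by
      simp [w, e₁, e₂, e₃]; ring
    have h3 : k = x 0 + 2 * κ * n - g * x 2 := rfl
    rw [h1, h2]
    linear_combination (-x 1) * hJ + (-α) * h3 + x 2 * hgα + (-k) * hαdef.symm
  have hQ : sqNorm w ≤ C * (k ^ 2 + n) := by
    refine (sqNorm_add_three_le _ _ _).trans ?_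
    simp only [sqNorm_smul]
    rw [hn]
    linarith [sq_nonneg k, sq_nonneg (x 1), sq_nonneg (x 2), mul_nonneg (sq_nonneg k) q2,
      mul_nonneg (sq_nonneg k) q3, mul_nonneg (sq_nonneg (x 1)) q1,
      mul_nonneg (sq_nonneg (x 1)) q3, mul_nonneg (sq_nonneg (x 2)) q1,
      mul_nonneg (sq_nonneg (x 2)) q2]
  have hpos : 0 < x 0 ∨ 0 < n := by
    by_contra! h
    apply hx
    have a0 : x 0 = 0 := le_antisymm h.1 hx0
    have a1 : x 1 = 0 := by nlinarith only [h.2, hn, sq_nonneg (x 1), sq_nonneg (x 2)]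
    have a2 : x 2 = 0 := by nlinarith only [h.2, hn, sq_nonneg (x 1), sq_nonneg (x 2)]
    ext i; fin_cases i <;> simp [a0, a1, a2]
  rw [hin]
  have := bent_estimate hα hC hκα hx0 hxt hx1 hx2 ht1 ht2 hn hpos rfl hQ
  linarith

/-- At a boundary point of the support of a CR function, every exterior normal annihilates the
complex tangent directions. -/
theorem inner_eq_zero_of_tsupport {h : Z × ℝ → ℂ} (hh : ContDiff ℝ ∞ h) {Ω : Set (Z × ℝ)}
    (hΩ : IsOpen Ω) (hCR : G.IsCR h Ω) {p c : Z × ℝ} (hp : p ∈ tsupport h) (hpΩ : p ∈ Ω)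
    (hc : ∀ x, sqNorm (x - c) < sqNorm (p - c) → x ∉ tsupport h) (v : Z) :
    inner ℝ v (p.1 - c.1) + G.A p v * (p.2 - c.2) = 0 := by
  by_contra hne
  let ℓ : Z →ₗ[ℝ] ℝ := (innerₗ Z).flip (c.1 - p.1) + (c.2 - p.2) • (G.A p : Z →ₗ[ℝ] ℝ)
  have hℓ : ∀ u, ℓ u = inner ℝ u (c.1 - p.1) + G.A p u * (c.2 - p.2) := by
    intro u; simp [ℓ, mul_comm, inner_sub_right, real_inner_comm]
  obtain ⟨u, hu, hJu⟩ := G.exists_direction (ℓ := ℓ) (by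
    intro h0
    apply hne
    have h1 := hℓ v
    rw [h0, ← neg_sub p.1, inner_neg_right] at h1
    simp only [LinearMap.zero_apply] at h1
    linarith)
  rw [hℓ] at hu hJu
  obtain ⟨κ, g, t₀, ht₀, hin⟩ := G.exists_slice_inside p c hu hJu
  have hΩev : ∀ᶠ y in 𝓝 (p, (0 : Fin 3 → ℝ)), G.slice u κ g y.1 y.2 ∈ Ω := by
    apply (G.contDiff_slice u κ g).continuous.continuousAt.eventually_mem
    rw [slice_zero]
    exact hΩ.mem_nhds hpΩ
  obtain ⟨δ₁, hδ₁, hb₁⟩ := Metric.eventually_nhds_iff_ball.mp hΩev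
  obtain ⟨δ₂, hδ₂, hb₂⟩ := Metric.eventually_nhds_iff_ball.mp (G.eventually_re_sq u κ g p)
  set t := min t₀ (min (δ₁ / 2) (δ₂ / 2)) with ht
  have htpos : 0 < t := by positivity
  have ht1 : t < δ₁ := by
    have : t ≤ δ₁ / 2 := (min_le_right _ _).trans (min_le_left _ _)
    linarith
  have ht2 : t < δ₂ := by
    have : t ≤ δ₂ / 2 := (min_le_right _ _).trans (min_le_right _ _)
    linarith
  have htt₀ : t ≤ t₀ := min_le_left _ _
  set box : Set (Fin 3 → ℝ) := Set.Icc ![0, -t, -t] ![t, t, t] with hbox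
  have hboxmem : ∀ x ∈ box, 0 ≤ x 0 ∧ x 0 ≤ t ∧ |x 1| ≤ t ∧ |x 2| ≤ t := by
    intro x hx
    have a0 := hx.1 0; have a1 := hx.1 1; have a2 := hx.1 2
    have b0 := hx.2 0; have b1 := hx.2 1; have b2 := hx.2 2
    simp only [Matrix.cons_val_zero, Matrix.cons_val_one, Matrix.cons_val] at a0 a1 a2 b0 b1 b2
    exact ⟨a0, b0, abs_le.mpr ⟨a1, b1⟩, abs_le.mpr ⟨a2, b2⟩⟩
  have hnorm : ∀ x ∈ box, ‖x‖ ≤ t := by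
    intro x hx
    obtain ⟨a0, b0, h1, h2⟩ := hboxmem x hx
    rw [pi_norm_le_iff_of_nonneg htpos.le]
    intro i
    rw [Real.norm_eq_abs]
    fin_cases i
    · exact abs_le.mpr ⟨by change -t ≤ x 0; linarith, b0⟩
    · exact h1
    · exact h2
  set faces : Set (Fin 3 → ℝ) :=
    box ∩ {x | x 0 = t ∨ x 1 = -t ∨ x 1 = t ∨ x 2 = -t ∨ x 2 = t} with hfaces
  have hclosed : IsClosed {x : Fin 3 → ℝ | x 0 = t ∨ x 1 = -t ∨ x 1 = t ∨ x 2 = -t ∨ x 2 = t} := by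
    have : ∀ (i : Fin 3) (s : ℝ), IsClosed {x : Fin 3 → ℝ | x i = s} :=
      fun i s => isClosed_eq (continuous_apply i) continuous_const
    exact (this 0 t).union ((this 1 (-t)).union ((this 1 t).union ((this 2 (-t)).union (this 2 t))))
  have hcomp : IsCompact faces := isCompact_Icc.inter_right hclosed
  have hfev : ∀ᶠ b in 𝓝 p, ∀ x ∈ faces, G.slice u κ g b x ∉ tsupport h := by
    refine hcomp.eventually_forall_of_forall_eventually fun x hx => ?_
    have hx0 : x ≠ 0 := by
      rintro rfl
      have := hx.2
      simp [htpos.ne, htpos.ne'] at this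
    obtain ⟨a0, b0, h1, h2⟩ := hboxmem x hx.1
    have hnot : G.slice u κ g p x ∉ tsupport h :=
      hc _ (hin x hx0 a0 (b0.trans htt₀) (h1.trans htt₀) (h2.trans htt₀))
    exact ((G.contDiff_slice u κ g).continuous.continuousAt (x := (p, x))).eventually_mem
      ((isClosed_tsupport h).isOpen_compl.mem_nhds hnot)
  have hzero : ∀ᶠ b in 𝓝 p, h b = 0 := by
    filter_upwards [hfev, Metric.ball_mem_nhds p hδ₁, Metric.ball_mem_nhds p hδ₂] with b hb hb1 hb2
    obtain ⟨d1, d2, d3, d4⟩ := G.fderiv_normal_zero u κ g b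
    have := eq_zero_of_vanish_on_faces (η := t) (r := t) htpos.le htpos
      (h := fun x => h (G.slice u κ g b x)) (hh.comp (G.contDiff_slice_right u κ g b))
      (G.contDiff_normal₁_right u κ g b) (G.contDiff_normal₂_right u κ g b)
      (fun x hx => G.exists_annihilator u κ g hh hCR b x (hb₁ (b, x) ?_))
      (fun x hx hxf => image_eq_zero_of_notMem_tsupport (hb x ⟨hx, hxf⟩))
      (G.normal_apply_zero u κ g b).1 (G.normal_apply_zero u κ g b).2 d1 d2 d3 d4
      (fun x hx hx0 => hb₂ (b, t) ?_ x (hnorm x hx) hx0)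
    · rwa [slice_zero] at this
    · rw [Metric.mem_ball, Prod.dist_eq, max_lt_iff]
      refine ⟨hb1, ?_⟩
      rw [dist_zero_right]
      exact (hnorm x hx).trans_lt ht1
    · rw [Metric.mem_ball, Prod.dist_eq, max_lt_iff]
      refine ⟨hb2, ?_⟩
      rw [Real.dist_0_eq_abs, abs_of_pos htpos]
      exact ht2
  exact notMem_tsupport_iff_eventuallyEq.mpr hzero hp

end CRGraph

/-- `s` is the vertical component of the horizontal lift, with respect to `A`, of the segment from
`z₀` to `z₁`, starting at height `s₀`. -/
structure IsLift {Z : Type*} [NormedAddCommGroup Z] [NormedSpace ℝ Z] (A : Z × ℝ → Z →L[ℝ] ℝ)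
    (z₀ : Z) (s₀ : ℝ) (z₁ : Z) (s : ℝ → ℝ) : Prop where
  init : s 0 = s₀
  deriv : ∀ τ ∈ Set.Icc (0 : ℝ) 1,
    HasDerivAt s (A (z₀ + τ • (z₁ - z₀), s τ) (z₁ - z₀)) τ

section Lift

variable {Z : Type*} [NormedAddCommGroup Z] [NormedSpace ℝ Z] {A : Z × ℝ → Z →L[ℝ] ℝ}
  {K C : NNReal} {z₀ z₁ : Z} {s₀ : ℝ} {s : ℝ → ℝ}

lemma abs_lift_field_le (hC : ∀ x, ‖A x‖ ≤ C) (x : Z × ℝ) (v : Z) : |A x v| ≤ C * ‖v‖ :=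
  ((A x).le_opNorm v).trans (mul_le_mul_of_nonneg_right (hC x) (norm_nonneg v))

lemma abs_lift_field_sub_le (hA : LipschitzWith K A) (x y : Z × ℝ) (v : Z) :
    |A x v - A y v| ≤ K * dist x y * ‖v‖ := by
  have h1 : A x v - A y v = (A x - A y) v := by simp
  rw [h1]
  refine ((A x - A y).le_opNorm v).trans (mul_le_mul_of_nonneg_right ?_ (norm_nonneg v))
  rw [← dist_eq_norm]
  exact hA.dist_le_mul x y

lemma lipschitzWith_lift_field (hA : LipschitzWith K A) (z v : Z) :
    LipschitzWith (K * ‖v‖₊) fun s : ℝ => A (z, s) v := by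
  refine LipschitzWith.of_dist_le_mul fun s t => ?_
  rw [Real.dist_eq]
  refine (abs_lift_field_sub_le hA _ _ v).trans (le_of_eq ?_)
  rw [Prod.dist_eq, dist_self, max_eq_right dist_nonneg]
  push_cast
  ring

lemma IsLift.exists (hA : LipschitzWith K A) (hC : ∀ x, ‖A x‖ ≤ C) (z₀ : Z) (s₀ : ℝ) (z₁ : Z) :
    ∃ s, IsLift A z₀ s₀ z₁ s := by
  set v := z₁ - z₀
  have hP : IsPicardLindelof (fun (τ : ℝ) (s : ℝ) => A (z₀ + τ • v, s) v) (tmin := -1) (tmax := 2)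
      ⟨0, by norm_num, by norm_num⟩ s₀ (2 * (C * ‖v‖₊)) 0 (C * ‖v‖₊) (K * ‖v‖₊) := by
    refine ⟨fun t _ => (lipschitzWith_lift_field hA _ v).lipschitzOnWith, fun x _ => ?_,
      fun t _ x _ => ?_, ?_⟩
    · have := hA.continuous
      fun_prop
    · rw [Real.norm_eq_abs]
      exact_mod_cast abs_lift_field_le hC _ v
    · push_cast
      norm_num
      linarith
  obtain ⟨s, h0, hs⟩ := hP.exists_eq_forall_mem_Icc_hasDerivWithinAt (x := s₀) (by simp)
  refine ⟨s, h0, fun τ hτ => ?_⟩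
  exact (hs τ ⟨by linarith [hτ.1], by linarith [hτ.2]⟩).hasDerivAt
    (Icc_mem_nhds (by linarith [hτ.1]) (by linarith [hτ.2]))

lemma IsLift.continuousOn (h : IsLift A z₀ s₀ z₁ s) : ContinuousOn s (Set.Icc 0 1) :=
  fun τ hτ => (h.deriv τ hτ).continuousAt.continuousWithinAt

/-- Gronwall comparison of two lifts. -/
lemma IsLift.dist_le (hA : LipschitzWith K A) (hC : ∀ x, ‖A x‖ ≤ C)
    (h : IsLift A z₀ s₀ z₁ s) {y₀ y₁ : Z} {t₀ : ℝ} {t : ℝ → ℝ} (h' : IsLift A y₀ t₀ y₁ t) :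
    dist (s 1) (t 1) ≤ gronwallBound (dist s₀ t₀) (K * ‖z₁ - z₀‖ + 1)
      (K * (dist z₀ y₀ + dist z₁ y₁) * ‖y₁ - y₀‖ + C * ‖(y₁ - y₀) - (z₁ - z₀)‖) 1 := by
  have key := dist_le_of_approx_trajectories_ODE (K := K * ‖z₁ - z₀‖₊ + 1) (a := 0) (b := 1)
    (v := fun τ s => A (z₀ + τ • (z₁ - z₀), s) (z₁ - z₀))
    (fun τ => (lipschitzWith_lift_field hA _ _).weaken (by simp)) h.continuousOn
    (fun τ hτ => (h.deriv τ ⟨hτ.1, hτ.2.le⟩).hasDerivWithinAt) (fun τ _ => (dist_self _).le)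
    h'.continuousOn (fun τ hτ => (h'.deriv τ ⟨hτ.1, hτ.2.le⟩).hasDerivWithinAt)
    (εg := K * (dist z₀ y₀ + dist z₁ y₁) * ‖y₁ - y₀‖ + C * ‖(y₁ - y₀) - (z₁ - z₀)‖)
    (fun τ hτ => ?_) (δ := dist s₀ t₀) (by rw [h.init, h'.init]) 1 (by simp)
  · simpa using key
  · rw [Real.dist_eq]
    set v := z₁ - z₀
    set w := y₁ - y₀
    have e : A (y₀ + τ • w, t τ) w - A (z₀ + τ • v, t τ) v =
        (A (y₀ + τ • w, t τ) w - A (z₀ + τ • v, t τ) w) + A (z₀ + τ • v, t τ) (w - v) := by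
      simp
    rw [e]
    refine (abs_add_le _ _).trans (add_le_add ?_ (abs_lift_field_le hC _ _))
    refine (abs_lift_field_sub_le hA _ _ w).trans ?_
    gcongr
    rw [Prod.dist_eq, dist_self, max_eq_left dist_nonneg, dist_eq_norm]
    have e2 : y₀ + τ • w - (z₀ + τ • v) = (1 - τ) • (y₀ - z₀) + τ • (y₁ - z₁) := by
      simp only [v, w, smul_sub, sub_smul, one_smul]; abel
    rw [e2]
    refine (norm_add_le _ _).trans ?_
    rw [norm_smul, norm_smul, Real.norm_of_nonneg hτ.1, Real.norm_of_nonneg (by linarith [hτ.2]),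
      dist_comm z₀, dist_comm z₁, dist_eq_norm, dist_eq_norm]
    have := norm_nonneg (y₀ - z₀)
    have := norm_nonneg (y₁ - z₁)
    have := hτ.1
    have := hτ.2
    nlinarith

lemma IsLift.unique (hA : LipschitzWith K A) (hC : ∀ x, ‖A x‖ ≤ C)
    (h : IsLift A z₀ s₀ z₁ s) {t : ℝ → ℝ} (h' : IsLift A z₀ s₀ z₁ t) : s 1 = t 1 := by
  have := h.dist_le hA hC h'
  simp only [dist_self, add_zero, mul_zero, zero_mul, sub_self, norm_zero,
    gronwallBound_ε0_δ0] at this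
  exact dist_le_zero.mp this

lemma IsLift.reverse (h : IsLift A z₀ s₀ z₁ s) : IsLift A z₁ (s 1) z₀ fun τ => s (1 - τ) := by
  refine ⟨by simp, fun τ hτ => ?_⟩
  have h1 := h.deriv (1 - τ) ⟨by linarith [hτ.2], by linarith [hτ.1]⟩
  have h2 := h1.scomp τ ((hasDerivAt_id τ).const_sub 1)
  have e : z₀ + (1 - τ) • (z₁ - z₀) = z₁ + τ • (z₀ - z₁) := by
    simp only [smul_sub, sub_smul, one_smul]; abel
  rw [e] at h2
  have e' : A (z₁ + τ • (z₀ - z₁), s (1 - τ)) (z₀ - z₁) =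
      (-1 : ℝ) • A (z₁ + τ • (z₀ - z₁), s (1 - τ)) (z₁ - z₀) := by
    rw [← map_smul]; simp
  rw [e']
  exact h2

lemma IsLift.abs_sub_le (hC : ∀ x, ‖A x‖ ≤ C) (h : IsLift A z₀ s₀ z₁ s) {τ : ℝ}
    (hτ : τ ∈ Set.Icc (0 : ℝ) 1) : |s τ - s₀| ≤ C * ‖z₁ - z₀‖ := by
  have := (convex_Icc (0 : ℝ) 1).norm_image_sub_le_of_norm_hasDerivWithin_le
    (fun x hx => (h.deriv x hx).hasDerivWithinAt)
    (C := C * ‖z₁ - z₀‖) (fun x _ => abs_lift_field_le hC _ _) (x := 0) (by simp) hτ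
  rw [h.init, Real.norm_eq_abs, sub_zero] at this
  refine this.trans (mul_le_of_le_one_right (by positivity) ?_)
  rw [Real.norm_of_nonneg hτ.1]; exact hτ.2

/-- First order expansion of a lift. -/
lemma IsLift.abs_sub_linear_le (hA : LipschitzWith K A) (hC : ∀ x, ‖A x‖ ≤ C)
    (h : IsLift A z₀ s₀ z₁ s) :
    |s 1 - s₀ - A (z₀, s₀) (z₁ - z₀)| ≤ K * (1 + C) * ‖z₁ - z₀‖ ^ 2 := by
  set v := z₁ - z₀
  have hd : ∀ τ ∈ Set.Icc (0 : ℝ) 1, HasDerivWithinAt (fun τ => s τ - τ • A (z₀, s₀) v)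
      (A (z₀ + τ • v, s τ) v - A (z₀, s₀) v) (Set.Icc 0 1) τ := by
    intro τ hτ
    have h3 := (hasDerivAt_id τ).smul_const (A (z₀, s₀) v)
    rw [one_smul] at h3
    exact ((h.deriv τ hτ).sub h3).hasDerivWithinAt
  have := norm_image_sub_le_of_norm_deriv_le_segment_01' hd
    (C := K * (1 + C) * ‖v‖ ^ 2) (fun τ hτ => ?_)
  · have e : s 1 - s₀ - A (z₀, s₀) v = s 1 - (1 : ℝ) • A (z₀, s₀) v -
        (s 0 - (0 : ℝ) • A (z₀, s₀) v) := by rw [h.init]; simp; ring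
    rw [e]; exact this
  · rw [Real.norm_eq_abs]
    refine (abs_lift_field_sub_le hA _ _ v).trans ?_
    have h1 : dist (z₀ + τ • v, s τ) (z₀, s₀) ≤ (1 + C) * ‖v‖ := by
      rw [Prod.dist_eq]
      refine max_le ?_ ?_
      · rw [dist_eq_norm, add_sub_cancel_left, norm_smul, Real.norm_of_nonneg hτ.1]
        have := hτ.2
        have := norm_nonneg v
        have := C.2
        have h4 : 0 ≤ (C : ℝ) * ‖v‖ := by positivity
        nlinarith
      · refine (h.abs_sub_le hC ⟨hτ.1, hτ.2.le⟩).trans ?_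
        have := norm_nonneg v
        linarith
    calc K * dist (z₀ + τ • v, s τ) (z₀, s₀) * ‖v‖ ≤ K * ((1 + C) * ‖v‖) * ‖v‖ := by gcongr
      _ = _ := by ring

/-- The endpoint of the horizontal lift of a segment. -/
noncomputable def liftEnd (A : Z × ℝ → Z →L[ℝ] ℝ) (z₀ : Z) (s₀ : ℝ) (z₁ : Z) : ℝ :=
  Classical.epsilon fun e => ∃ s, IsLift A z₀ s₀ z₁ s ∧ s 1 = e

lemma IsLift.liftEnd_eq (hA : LipschitzWith K A) (hC : ∀ x, ‖A x‖ ≤ C)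
    (h : IsLift A z₀ s₀ z₁ s) : liftEnd A z₀ s₀ z₁ = s 1 := by
  obtain ⟨t, ht, e⟩ := Classical.epsilon_spec (p := fun e => ∃ s, IsLift A z₀ s₀ z₁ s ∧ s 1 = e)
    ⟨s 1, s, h, rfl⟩
  rw [liftEnd, ← e]
  exact ht.unique hA hC h

lemma liftEnd_reverse (hA : LipschitzWith K A) (hC : ∀ x, ‖A x‖ ≤ C) (z₀ : Z) (s₀ : ℝ) (z₁ : Z) :
    liftEnd A z₁ (liftEnd A z₀ s₀ z₁) z₀ = s₀ := by
  obtain ⟨s, hs⟩ := IsLift.exists hA hC z₀ s₀ z₁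
  rw [hs.liftEnd_eq hA hC, hs.reverse.liftEnd_eq hA hC]
  simp [hs.init]

lemma liftEnd_self (hA : LipschitzWith K A) (hC : ∀ x, ‖A x‖ ≤ C) (z₀ : Z) (s₀ : ℝ) :
    liftEnd A z₀ s₀ z₀ = s₀ := by
  have : IsLift A z₀ s₀ z₀ fun _ => s₀ := ⟨rfl, fun τ _ => by simpa using hasDerivAt_const τ s₀⟩
  exact this.liftEnd_eq hA hC

lemma continuous_liftEnd (hA : LipschitzWith K A) (hC : ∀ x, ‖A x‖ ≤ C) :
    Continuous fun x : Z × ℝ × Z => liftEnd A x.1 x.2.1 x.2.2 := by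
  rw [continuous_iff_continuousAt]
  rintro ⟨z₀, s₀, z₁⟩
  rw [ContinuousAt, tendsto_iff_dist_tendsto_zero]
  have hK : (K : ℝ) * ‖z₁ - z₀‖ + 1 ≠ 0 := by positivity
  set F : Z × ℝ × Z → ℝ := fun y => gronwallBound (dist s₀ y.2.1) (K * ‖z₁ - z₀‖ + 1)
      (K * (dist z₀ y.1 + dist z₁ y.2.2) * ‖y.2.2 - y.1‖ +
        C * ‖(y.2.2 - y.1) - (z₁ - z₀)‖) 1 with hF
  have hcont : Continuous F := by
    rw [hF]
    simp only [gronwallBound_of_K_ne_0 hK]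
    fun_prop
  have hF0 : F (z₀, s₀, z₁) = 0 := by
    simp [hF, gronwallBound_ε0_δ0]
  refine squeeze_zero (fun _ => dist_nonneg) (fun y => ?_) (hF0 ▸ hcont.tendsto (z₀, s₀, z₁))
  obtain ⟨s, hs⟩ := IsLift.exists hA hC z₀ s₀ z₁
  obtain ⟨t, ht⟩ := IsLift.exists hA hC y.1 y.2.1 y.2.2
  rw [dist_comm, hs.liftEnd_eq hA hC, ht.liftEnd_eq hA hC]
  exact hs.dist_le hA hC ht

end Lift

namespace CRGraph

variable {Z : Type*} [NormedAddCommGroup Z] [InnerProductSpace ℝ Z] (G : CRGraph Z)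

lemma exists_lipschitz_bound : ∃ K C : NNReal, LipschitzWith K G.A ∧ ∀ x, ‖G.A x‖ ≤ C := by
  obtain ⟨K, hK⟩ := G.contDiff_A.lipschitzWith_of_hasCompactSupport G.hasCompactSupport_A (by simp)
  obtain ⟨C, hC⟩ := G.contDiff_A.continuous.bounded_above_of_compact_support G.hasCompactSupport_A
  exact ⟨K, C.toNNReal, hK, fun x => (hC x).trans (Real.le_coe_toNNReal C)⟩

variable [FiniteDimensional ℝ Z]

/-- The support of a CR function is invariant under short horizontal lifts. -/
lemma exists_liftEnd_mem_tsupport {Ω : Set (Z × ℝ)} (hΩ : IsOpen Ω) (h0 : (0 : Z × ℝ) ∈ Ω) :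
    ∃ R > (0 : ℝ), ∀ h : Z × ℝ → ℂ, ContDiff ℝ ∞ h → G.IsCR h Ω → ∀ z₀ s₀ z₁, ‖z₀‖ < R →
      |s₀| < R → ‖z₁‖ < R → (z₀, s₀) ∈ tsupport h →
      (z₁, liftEnd G.A z₀ s₀ z₁) ∈ tsupport h := by
  obtain ⟨K, C, hK, hC⟩ := G.exists_lipschitz_bound
  let e := WithLp.prodContinuousLinearEquiv 2 ℝ Z ℝ
  have hsq : ∀ x y, sqNorm (e x - e y) = dist x y ^ 2 := by
    intro x y
    rw [dist_eq_norm, WithLp.prod_norm_sq_eq_of_L2, ← map_sub]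
    simp [sqNorm, e]
  have hΩ' : e ⁻¹' Ω ∈ 𝓝 (0 : WithLp 2 (Z × ℝ)) :=
    (hΩ.preimage e.continuous).mem_nhds (by simpa using h0)
  obtain ⟨ε, hε, hball⟩ := Metric.mem_nhds_iff.mp hΩ'
  let χ : ContDiffBump (0 : WithLp 2 (Z × ℝ)) := ⟨ε / 2, ε, by positivity, by linarith⟩
  let V : Z → WithLp 2 (Z × ℝ) → WithLp 2 (Z × ℝ) := fun v x => χ x • e.symm (v, G.A (e x) v)
  have hV : ∀ v, ∃ K, LipschitzWith K (V v) := by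
    intro v
    have h1 : ContDiff ℝ ∞ (V v) := by
      have h2 : ContDiff ℝ ∞ fun x => G.A (e x) v :=
        (G.contDiff_A.comp e.contDiff).clm_apply contDiff_const
      exact χ.contDiff.smul (e.symm.contDiff.comp (contDiff_const.prodMk h2))
    exact h1.lipschitzWith_of_hasCompactSupport χ.hasCompactSupport.smul_right (by simp)
  have hnear : ∀ᶠ y in 𝓝 (0 : Z × ℝ), e.symm y ∈ Metric.closedBall 0 (ε / 2) := by
    apply e.symm.continuous.continuousAt.eventually_mem
    rw [map_zero]
    exact Metric.closedBall_mem_nhds _ (by positivity)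
  obtain ⟨δ, hδ, hδb⟩ := Metric.eventually_nhds_iff_ball.mp hnear
  refine ⟨δ / (1 + 2 * C), by positivity, fun h hh hCR z₀ s₀ z₁ hz₀ hs₀ hz₁ hmem => ?_⟩
  set R := δ / (1 + 2 * C)
  have hRδ : R * (1 + 2 * C) = δ := by simp only [R]; field_simp
  have hC0 : (0 : ℝ) ≤ C := C.2
  have hR0 : 0 < R := by positivity
  obtain ⟨s, hs⟩ := IsLift.exists hK hC z₀ s₀ z₁
  rw [hs.liftEnd_eq hK hC]
  set v := z₁ - z₀
  have hv : ‖v‖ ≤ 2 * R := (norm_sub_le _ _).trans (by linarith)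
  have hcurve : ∀ τ ∈ Set.Icc (0 : ℝ) 1, (z₀ + τ • v, s τ) ∈ Metric.ball (0 : Z × ℝ) δ := by
    intro τ hτ
    rw [mem_ball_zero_iff, Prod.norm_def, max_lt_iff]
    constructor
    · have e1 : z₀ + τ • v = (1 - τ) • z₀ + τ • z₁ := by
        simp only [v, smul_sub, sub_smul, one_smul]; abel
      change ‖z₀ + τ • v‖ < δ
      rw [e1]
      have h1 := norm_add_le ((1 - τ) • z₀) (τ • z₁)
      rw [norm_smul, norm_smul, Real.norm_of_nonneg hτ.1,
        Real.norm_of_nonneg (by linarith [hτ.2])] at h1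
      have hRlt : R ≤ δ := by nlinarith
      have a1 := hτ.1
      have a2 := hτ.2
      rcases eq_or_lt_of_le a1 with h2 | h2
      · rw [← h2] at h1 ⊢; simp at h1 ⊢; linarith
      · nlinarith
    · have h1 := hs.abs_sub_le hC hτ
      have h2 : |s τ| ≤ |s τ - s₀| + |s₀| := by
        simpa using abs_add_le (s τ - s₀) s₀
      have h3 : (C : ℝ) * ‖v‖ ≤ C * (2 * R) := mul_le_mul_of_nonneg_left hv hC0
      change |s τ| < δ
      nlinarith
  obtain ⟨KV, hKV⟩ := hV v
  have hcl : IsClosed (e ⁻¹' tsupport h) := (isClosed_tsupport h).preimage e.continuous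
  let γ : ℝ → WithLp 2 (Z × ℝ) := fun τ => e.symm (z₀ + τ • v, s τ)
  have hγd : ∀ τ ∈ Set.Icc (0 : ℝ) 1, HasDerivAt γ (V v (γ τ)) τ := by
    intro τ hτ
    have h1 : HasDerivAt (fun τ => (z₀ + τ • v, s τ)) (v, G.A (z₀ + τ • v, s τ) v) τ := by
      have h2 := ((hasDerivAt_id τ).smul_const v).const_add z₀
      rw [one_smul] at h2
      exact h2.prodMk (hs.deriv τ hτ)
    have h3 := e.symm.hasFDerivAt.comp_hasDerivAt τ h1
    have h4 : χ (γ τ) = 1 := χ.one_of_mem_closedBall (hδb _ (hcurve τ hτ))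
    have h5 : V v (γ τ) = e.symm (v, G.A (z₀ + τ • v, s τ) v) := by
      simp only [V, h4, one_smul, γ, ContinuousLinearEquiv.apply_symm_apply]
    rw [h5]
    exact h3
  have := IsClosed.mem_of_trajectory hcl hKV ?_
    (fun τ hτ => (hγd τ hτ).continuousAt.continuousWithinAt)
    (fun τ hτ => (hγd τ ⟨hτ.1, hτ.2.le⟩).hasDerivWithinAt) (γ := γ) (a := 0) (b := 1) ?_
    (t := 1) (by simp)
  · simpa [γ, v] using this
  · intro p hp c hdisj
    by_cases hχ : χ p = 0
    · simp [V, hχ]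
    have hpΩ : e p ∈ Ω := by
      apply hball
      have : p ∈ Function.support χ := hχ
      rwa [χ.support_eq] at this
    have key := G.inner_eq_zero_of_tsupport hh hΩ hCR (p := e p) (c := e c) hp hpΩ (fun x hx => ?_) v
    · simp only [V]
      rw [real_inner_smul_left, WithLp.prod_inner_apply]
      have e1 : (e.symm (v, G.A (e p) v)).ofLp.1 = v := rfl
      have e2 : (e.symm (v, G.A (e p) v)).ofLp.2 = G.A (e p) v := rfl
      have e3 : (e p).1 - (e c).1 = (p - c).ofLp.1 := rfl
      have e4 : (e p).2 - (e c).2 = (p - c).ofLp.2 := rfl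
      rw [e3, e4] at key
      rw [e1, e2]
      have e5 : inner ℝ (G.A (e p) v) (p - c).ofLp.2 = G.A (e p) v * (p - c).ofLp.2 := by
        simp [mul_comm]
      rw [e5, key, mul_zero]
    · intro hx'
      have hd := Set.disjoint_left.mp hdisj
      refine @hd (e.symm x) ?_ (by simpa using hx')
      rw [Metric.mem_ball]
      rw [← e.apply_symm_apply x, hsq, hsq] at hx
      exact lt_of_pow_lt_pow_left₀ 2 dist_nonneg hx
  · simpa [γ, hs.init] using hmem

/-- Propagation of the support: if no horizontal graph passes through the origin, then a CR
function which vanishes near one point of a fixed neighbourhood vanishes near the origin. -/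
theorem eventually_mem_tsupport {Ω : Set (Z × ℝ)} (hΩ : IsOpen Ω) (h0 : (0 : Z × ℝ) ∈ Ω)
    (hmin : ¬∃ (f : Z → ℝ) (r : ℝ), 0 < r ∧ f 0 = 0 ∧
      ∀ z ∈ Metric.ball (0 : Z) r, HasFDerivAt f (G.A (z, f z)) z) :
    ∀ᶠ x in 𝓝 (0 : Z × ℝ), ∀ h : Z × ℝ → ℂ, ContDiff ℝ ∞ h → G.IsCR h Ω →
      0 ∈ tsupport h → x ∈ tsupport h := by
  obtain ⟨K, C, hK, hC⟩ := G.exists_lipschitz_bound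
  obtain ⟨R, hR, hprop⟩ := G.exists_liftEnd_mem_tsupport hΩ h0
  set E := liftEnd G.A with hE
  have hEc := continuous_liftEnd hK hC
  have hrev := liftEnd_reverse hK hC
  have hself := liftEnd_self hK hC
  rw [← hE] at hEc hrev hself
  have hbound : ∀ z₀ s₀ z₁, |E z₀ s₀ z₁| ≤ |s₀| + C * ‖z₁ - z₀‖ := by
    intro z₀ s₀ z₁
    obtain ⟨s, hs⟩ := IsLift.exists hK hC z₀ s₀ z₁
    rw [hE, hs.liftEnd_eq hK hC]
    have h1 := hs.abs_sub_le hC (τ := 1) (by simp)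
    have h2 : |s 1| ≤ |s 1 - s₀| + |s₀| := by simpa using abs_add_le (s 1 - s₀) s₀
    linarith
  have hC0 : (0 : ℝ) ≤ C := C.2
  set r := R / (2 * (3 * C + 1)) with hr
  have hr0 : 0 < r := by positivity
  have hrR : 2 * (3 * C + 1) * r = R := by rw [hr]; field_simp
  obtain ⟨z₀, hz₀, z₁, hz₁, hne⟩ : ∃ z₀ ∈ Metric.ball (0 : Z) r, ∃ z₁ ∈ Metric.ball (0 : Z) r,
      E z₀ (E 0 0 z₀) z₁ ≠ E 0 0 z₁ := by
    by_contra! hall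
    refine hmin ⟨E 0 0, r, hr0, hself 0 0, fun z hz => ?_⟩
    rw [hasFDerivAt_iff_isLittleO_nhds_zero]
    have hO : (fun v => E 0 0 (z + v) - E 0 0 z - G.A (z, E 0 0 z) v) =O[𝓝 0]
        fun v : Z => ‖v‖ ^ 2 := by
      refine Asymptotics.IsBigO.of_bound (K * (1 + C)) ?_
      have hmem : ∀ᶠ v in 𝓝 (0 : Z), z + v ∈ Metric.ball (0 : Z) r := by
        have : Continuous fun v : Z => z + v := by fun_prop
        apply this.continuousAt.eventually_mem
        rw [add_zero]
        exact Metric.isOpen_ball.mem_nhds hz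
      filter_upwards [hmem] with v hv
      obtain ⟨s, hs⟩ := IsLift.exists hK hC z (E 0 0 z) (z + v)
      have h1 := hs.abs_sub_linear_le hK hC
      rw [← hs.liftEnd_eq hK hC, ← hE, hall z hz _ hv, add_sub_cancel_left] at h1
      rw [Real.norm_eq_abs, Real.norm_of_nonneg (by positivity)]
      exact h1
    refine hO.trans_isLittleO ?_
    have := Asymptotics.isLittleO_norm_pow_id (E' := Z) (n := 2) (by norm_num)
    exact this
  rw [mem_ball_zero_iff] at hz₀ hz₁
  let ψ : ℝ → ℝ → ℝ := fun s' θ => E (θ • z₀) (E 0 s' (θ • z₀)) z₁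
  have hψc : Continuous fun y : ℝ × ℝ => ψ y.1 y.2 := by
    have h1 : Continuous fun y : ℝ × ℝ => E 0 y.1 (y.2 • z₀) :=
      hEc.comp (f := fun y : ℝ × ℝ => ((0 : Z), y.1, y.2 • z₀)) (by fun_prop)
    exact hEc.comp (f := fun y : ℝ × ℝ => (y.2 • z₀, E 0 y.1 (y.2 • z₀), z₁)) (by fun_prop)
  set mid := (ψ 0 0 + ψ 0 1) / 2 with hmid
  have hψne : ψ 0 0 ≠ ψ 0 1 := by
    simp only [ψ, zero_smul, one_smul, hself]
    exact fun h => hne h.symm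
  have hivt : ∀ s', (ψ s' 0 - mid) * (ψ s' 1 - mid) < 0 → ∃ θ ∈ Set.Icc (0 : ℝ) 1, ψ s' θ = mid := by
    intro s' hs'
    have hcont : ContinuousOn (ψ s') (Set.uIcc 0 1) :=
      (hψc.comp (f := fun θ => (s', θ)) (by fun_prop)).continuousOn
    have hm : mid ∈ Set.uIcc (ψ s' 0) (ψ s' 1) := by
      rw [Set.mem_uIcc]
      rcases mul_neg_iff.mp hs' with h | h
      · right; constructor <;> linarith [h.1, h.2]
      · left; constructor <;> linarith [h.1, h.2]
    obtain ⟨θ, hθ, e⟩ := intermediate_value_uIcc hcont hm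
    rw [Set.uIcc_of_le zero_le_one] at hθ
    exact ⟨θ, hθ, e⟩
  have hneg0 : (ψ 0 0 - mid) * (ψ 0 1 - mid) < 0 := by
    have := sq_pos_of_ne_zero (sub_ne_zero.mpr hψne)
    rw [hmid]
    nlinarith
  have hEx : Continuous fun x : Z × ℝ => E x.1 x.2 0 :=
    hEc.comp (f := fun x : Z × ℝ => (x.1, x.2, (0 : Z))) (by fun_prop)
  have hEx0 : E (0 : Z × ℝ).1 (0 : Z × ℝ).2 0 = 0 := hself 0 0
  have ev1 : ∀ᶠ x in 𝓝 (0 : Z × ℝ), (ψ (E x.1 x.2 0) 0 - mid) * (ψ (E x.1 x.2 0) 1 - mid) < 0 := by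
    have hc : Continuous fun x : Z × ℝ =>
        (ψ (E x.1 x.2 0) 0 - mid) * (ψ (E x.1 x.2 0) 1 - mid) :=
      ((hψc.comp (f := fun x : Z × ℝ => (E x.1 x.2 0, (0 : ℝ))) (by fun_prop)).sub
        continuous_const).mul ((hψc.comp (f := fun x : Z × ℝ => (E x.1 x.2 0, (1 : ℝ)))
        (by fun_prop)).sub continuous_const)
    apply (hc.tendsto 0).eventually_lt_const
    rw [hEx0]
    exact hneg0
  have ev2 : ∀ᶠ x in 𝓝 (0 : Z × ℝ), |E x.1 x.2 0| < r := by
    apply (hEx.abs.tendsto 0).eventually_lt_const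
    rw [hEx0, abs_zero]
    exact hr0
  have ev3 : ∀ᶠ x in 𝓝 (0 : Z × ℝ), ‖x.1‖ < R := by
    apply ((continuous_fst (X := Z) (Y := ℝ)).norm.tendsto 0).eventually_lt_const
    simpa using hR
  filter_upwards [ev1, ev2, ev3] with x hx1 hx2 hx3 h hh hCR hmem
  obtain ⟨θ₀, hθ₀, e₀⟩ := hivt 0 hneg0
  obtain ⟨θ, hθ, e⟩ := hivt _ hx1
  have hCr : 0 ≤ C * r := by positivity
  have hsm : ∀ θ ∈ Set.Icc (0 : ℝ) 1, ‖θ • z₀‖ < r := by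
    intro θ hθ
    rw [norm_smul, Real.norm_of_nonneg hθ.1]
    exact (mul_le_of_le_one_left (norm_nonneg _) hθ.2).trans_lt hz₀
  have hcb : ∀ s' θ, θ ∈ Set.Icc (0 : ℝ) 1 → |E 0 s' (θ • z₀)| ≤ |s'| + C * r := by
    intro s' θ hθ
    refine (hbound _ _ _).trans ?_
    rw [sub_zero]
    have := mul_le_mul_of_nonneg_left (hsm θ hθ).le hC0
    linarith
  have hstep := hprop h hh hCR
  have m1 := hstep 0 0 (θ₀ • z₀) (by simpa using hR) (by simpa using hR)
    (by linarith [hsm θ₀ hθ₀]) hmem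
  have b1 := hcb 0 θ₀ hθ₀
  rw [abs_zero, zero_add] at b1
  have m2 := hstep _ _ z₁ (by linarith [hsm θ₀ hθ₀]) (by linarith) (by linarith) m1
  have e₀' : E (θ₀ • z₀) (E 0 0 (θ₀ • z₀)) z₁ = mid := e₀
  rw [e₀'] at m2
  have bmid : |mid| ≤ 3 * (C * r) := by
    rw [← e₀']
    refine (hbound _ _ _).trans ?_
    have h1 : ‖z₁ - θ₀ • z₀‖ ≤ 2 * r := (norm_sub_le _ _).trans (by linarith [hsm θ₀ hθ₀])
    have := mul_le_mul_of_nonneg_left h1 hC0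
    linarith
  have m3 := hstep _ _ (θ • z₀) (by linarith) (by linarith) (by linarith [hsm θ hθ]) m2
  have e' : E (θ • z₀) (E 0 (E x.1 x.2 0) (θ • z₀)) z₁ = mid := e
  rw [← e', hrev] at m3
  have b3 := hcb (E x.1 x.2 0) θ hθ
  have m4 := hstep _ _ 0 (by linarith [hsm θ hθ]) (by linarith) (by simpa using hR) m3
  rw [hrev] at m4
  have m5 := hstep _ _ x.1 (by simpa using hR) (by linarith) hx3 m4
  rwa [hrev] at m5

end CRGraph

lemma exists_contDiff_eventuallyEq {E F : Type*} [NormedAddCommGroup E] [NormedSpace ℝ E]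
    [FiniteDimensional ℝ E] [NormedAddCommGroup F] [NormedSpace ℝ F] {f : E → F} {q : E}
    {U : Set E} (hU : U ∈ 𝓝 q) (hf : ContDiffOn ℝ ∞ f U) :
    ∃ g : E → F, ContDiff ℝ ∞ g ∧ HasCompactSupport g ∧ g =ᶠ[𝓝 q] f := by
  obtain ⟨r, hr, hrU⟩ := Metric.mem_nhds_iff.1 (interior_mem_nhds.2 hU)
  let χ : ContDiffBump q := ⟨r / 4, r / 2, by positivity, by linarith⟩
  refine ⟨fun x => χ x • f x, ?_, χ.hasCompactSupport.smul_right, ?_⟩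
  · refine contDiff_iff_contDiffAt.2 fun x => ?_
    by_cases hx : x ∈ Metric.ball q r
    · have : U ∈ 𝓝 x := mem_interior_iff_mem_nhds.1 (hrU hx)
      exact χ.contDiff.contDiffAt.smul (hf.contDiffAt this)
    · have : (fun x => χ x • f x) =ᶠ[𝓝 x] fun _ => 0 := by
        have h2 : (Metric.closedBall q (r / 2))ᶜ ∈ 𝓝 x := by
          refine Metric.isClosed_closedBall.isOpen_compl.mem_nhds fun h => hx ?_
          exact Metric.closedBall_subset_ball (by linarith) h
        filter_upwards [h2] with y hy
        have : χ y = 0 := χ.zero_of_le_dist (by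
          simp only [Set.mem_compl_iff, Metric.mem_closedBall, not_le] at hy
          exact hy.le)
        simp [this]
      exact contDiffAt_const.congr_of_eventuallyEq this
  · filter_upwards [χ.eventuallyEq_one] with y hy
    simp [hy]

/-- A graph `Im w = φ(z, Re w)` in complex affine coordinates `(z, w)` of `ℂ^N`, where the `w`-axis
is a coordinate axis. -/
structure HoloGraph (N : ℕ) (Z : Type*) [NormedAddCommGroup Z] [InnerProductSpace ℝ Z] where
  /-- The base point. -/
  p : CPt N
  /-- The complex structure on the base. -/
  J : Z →L[ℝ] Z
  J_sq : ∀ v, J (J v) = -v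
  /-- The linear part of the coordinate system. -/
  L : (Z × ℂ) ≃L[ℝ] CPt N
  L_J : ∀ v c, L (J v, Complex.I * c) = Complex.I • L (v, c)
  /-- The index of the transversal axis. -/
  m : Fin N
  /-- The scale of the transversal axis. -/
  a : ℂ
  L_I : L (0, Complex.I) = Pi.single m a
  /-- The graphing function. -/
  φ : Z × ℝ → ℝ
  contDiff_φ : ContDiff ℝ ∞ φ
  hasCompactSupport_φ : HasCompactSupport φ
  φ_zero : φ 0 = 0

namespace HoloGraph

variable {N : ℕ} {Z : Type*} [NormedAddCommGroup Z] [InnerProductSpace ℝ Z] (H : HoloGraph N Z)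

/-- The parametrization of the graph. -/
noncomputable def Γ (x : Z × ℝ) : CPt N := H.p + H.L (x.1, x.2 + Complex.I * (H.φ x : ℝ))

/-- The projection to the parameter space. -/
noncomputable def proj (y : CPt N) : Z × ℝ := ((H.L.symm (y - H.p)).1, (H.L.symm (y - H.p)).2.re)

/-- The defining function of the graph. -/
noncomputable def ρ (y : CPt N) : ℝ := (H.L.symm (y - H.p)).2.im - H.φ (H.proj y)

lemma proj_Γ (x : Z × ℝ) : H.proj (H.Γ x) = x := by
  simp [proj, Γ]

lemma ρ_Γ (x : Z × ℝ) : H.ρ (H.Γ x) = 0 := by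
  rw [ρ, proj_Γ]
  simp [Γ]

lemma Γ_proj {y : CPt N} (hy : H.ρ y = 0) : H.Γ (H.proj y) = y := by
  rw [ρ, sub_eq_zero] at hy
  rw [Γ, ← hy]
  have : (((H.proj y).1, ((H.proj y).2 : ℂ) + Complex.I * ((H.L.symm (y - H.p)).2.im : ℝ)) : Z × ℂ)
      = H.L.symm (y - H.p) := by
    refine Prod.ext rfl ?_
    rw [mul_comm]
    exact Complex.re_add_im _
  rw [this]
  simp

lemma Γ_zero : H.Γ 0 = H.p := by
  simp [Γ, H.φ_zero]

lemma contDiff_Γ : ContDiff ℝ ∞ H.Γ := by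
  have h1 : ContDiff ℝ ∞ (fun x : Z × ℝ => ((x.2 : ℝ) : ℂ) + Complex.I * (H.φ x : ℝ)) :=
    (Complex.ofRealCLM.contDiff.comp contDiff_snd).add
      (contDiff_const.mul (Complex.ofRealCLM.contDiff.comp H.contDiff_φ))
  exact contDiff_const.add (H.L.contDiff.comp (contDiff_fst.prodMk h1))

lemma contDiff_symm : ContDiff ℝ ∞ fun y => H.L.symm (y - H.p) :=
  H.L.symm.contDiff.comp (contDiff_id.sub contDiff_const)

lemma contDiff_proj : ContDiff ℝ ∞ H.proj :=
  (contDiff_fst.comp H.contDiff_symm).prodMk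
    (Complex.reCLM.contDiff.comp (contDiff_snd.comp H.contDiff_symm))

lemma contDiff_ρ : ContDiff ℝ ∞ H.ρ :=
  (Complex.imCLM.contDiff.comp (contDiff_snd.comp H.contDiff_symm)).sub
    (H.contDiff_φ.comp H.contDiff_proj)

lemma hasFDerivAt_φ (x : Z × ℝ) : HasFDerivAt H.φ (fderiv ℝ H.φ x) x :=
  (H.contDiff_φ.differentiable (by simp) x).hasFDerivAt

lemma fderiv_Γ (x v : Z × ℝ) :
    fderiv ℝ H.Γ x v = H.L (v.1, v.2 + Complex.I * (fderiv ℝ H.φ x v : ℝ)) := by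
  have h1 := (Complex.ofRealCLM.hasFDerivAt (x := H.φ x)).comp x (H.hasFDerivAt_φ x)
  have h2 := (Complex.ofRealCLM.hasFDerivAt (x := x.2)).comp x (hasFDerivAt_snd (p := x))
  have h3 := (H.L.hasFDerivAt.comp x
    ((hasFDerivAt_fst (p := x)).prodMk (h2.add (h1.const_mul Complex.I)))).const_add H.p
  exact congrArg (· v) h3.fderiv

lemma hasFDerivAt_symm (y : CPt N) : HasFDerivAt (fun y => H.L.symm (y - H.p))
    (H.L.symm : CPt N →L[ℝ] Z × ℂ) y := by
  have h := H.L.symm.hasFDerivAt.comp y ((hasFDerivAt_id (𝕜 := ℝ) y).sub_const H.p)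
  exact h

lemma fderiv_ρ (y : CPt N) (v : Z) (c : ℂ) :
    fderiv ℝ H.ρ y (H.L (v, c)) = c.im - fderiv ℝ H.φ (H.proj y) (v, c.re) := by
  have h1 := H.hasFDerivAt_symm y
  have h2 : HasFDerivAt H.proj _ y := ((hasFDerivAt_fst (𝕜 := ℝ)).comp y h1).prodMk
    (Complex.reCLM.hasFDerivAt.comp y ((hasFDerivAt_snd (𝕜 := ℝ)).comp y h1))
  have h3 := (Complex.imCLM.hasFDerivAt.comp y ((hasFDerivAt_snd (𝕜 := ℝ)).comp y h1)).sub
    ((H.hasFDerivAt_φ (H.proj y)).comp y h2)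
  have := congrArg (· (H.L (v, c))) h3.fderiv
  refine this.trans ?_
  simp

/-- The tangent space of the graph is the range of the differential of the parametrization. -/
lemma exists_fderiv_Γ_eq (x : Z × ℝ) {W : CPt N} (hW : fderiv ℝ H.ρ (H.Γ x) W = 0) :
    ∃ v, fderiv ℝ H.Γ x v = W := by
  obtain ⟨⟨v, c⟩, rfl⟩ := H.L.surjective W
  rw [fderiv_ρ, proj_Γ, sub_eq_zero] at hW
  refine ⟨(v, c.re), ?_⟩
  rw [fderiv_Γ, ← hW, mul_comm]
  simp

lemma fderiv_ρ_fderiv_Γ (x v : Z × ℝ) : fderiv ℝ H.ρ (H.Γ x) (fderiv ℝ H.Γ x v) = 0 := by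
  rw [fderiv_Γ, fderiv_ρ, proj_Γ]
  simp

lemma fderiv_ρ_single (y : CPt N) : fderiv ℝ H.ρ y (Pi.single H.m H.a) = 1 := by
  rw [← H.L_I, fderiv_ρ, Complex.I_im, Complex.I_re, ← Prod.zero_eq_mk, map_zero, sub_zero]

lemma fderiv_ρ_ne_zero (y : CPt N) : fderiv ℝ H.ρ y ≠ 0 := fun h => by
  have := H.fderiv_ρ_single y
  simp [h] at this

/-- A function vanishing on the graph near a point has differential proportional to that of the
defining function. -/
lemma exists_fderiv_eq {u : CPt N → ℂ} (hu : ContDiff ℝ ∞ u) {O : Set (CPt N)} (hO : IsOpen O)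
    (h0 : ∀ y ∈ O, H.ρ y = 0 → u y = 0) {q : CPt N} (hq : q ∈ O) (hρ : H.ρ q = 0) :
    ∃ l : ℂ, ∀ W, fderiv ℝ u q W = (fderiv ℝ H.ρ q W : ℝ) * l := by
  have ht : ∀ W, fderiv ℝ H.ρ q W = 0 → fderiv ℝ u q W = 0 := by
    intro W hW
    rw [← H.Γ_proj hρ] at hW hq ⊢
    obtain ⟨v, rfl⟩ := H.exists_fderiv_Γ_eq _ hW
    have h1 : HasFDerivAt (u ∘ H.Γ) _ (H.proj q) :=
      (hu.differentiable (by simp) _).hasFDerivAt.comp (H.proj q)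
      (H.contDiff_Γ.differentiable (by simp) _).hasFDerivAt
    have h2 : u ∘ H.Γ =ᶠ[𝓝 (H.proj q)] fun _ => 0 := by
      filter_upwards [H.contDiff_Γ.continuous.continuousAt.preimage_mem_nhds (hO.mem_nhds hq)]
        with x hx using h0 _ hx (H.ρ_Γ x)
    have h3 := h1.unique ((hasFDerivAt_const (0 : ℂ) _).congr_of_eventuallyEq h2)
    exact congrArg (· v) h3
  refine ⟨fderiv ℝ u q (Pi.single H.m H.a), fun W => ?_⟩
  have := ht (W - fderiv ℝ H.ρ q W • (Pi.single H.m H.a : CPt N)) (by simp [H.fderiv_ρ_single])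
  rw [map_sub, map_smul, sub_eq_zero] at this
  simpa using this

end HoloGraph

open scoped ComplexConjugate in
lemma fderiv_eq_sum_wirtinger {N : ℕ} (u : CPt N → ℂ) (q V : CPt N) :
    fderiv ℝ u q V = ∑ l, (V l * wz l u q + conj (V l) * wzb l u q) := by
  have hV : V = ∑ l, ((V l).re • (Pi.single l 1 : CPt N) + (V l).im • (Pi.single l Complex.I : CPt N)) := by
    ext j
    rw [Finset.sum_apply, Finset.sum_eq_single j]
    · simp [Complex.re_add_im]
    · intro b _ hb
      simp [Pi.single_eq_of_ne hb.symm]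
    · simp
  conv_lhs => rw [hV]
  rw [map_sum]
  refine Finset.sum_congr rfl fun l _ => ?_
  rw [map_add, map_smul, map_smul, wz, wzb, Complex.real_smul, Complex.real_smul]
  generalize fderiv ℝ u q (Pi.single l 1) = a
  generalize fderiv ℝ u q (Pi.single l Complex.I) = b
  apply Complex.ext
  · simp
    ring
  · simp
    ring

open scoped ComplexConjugate in
lemma fderiv_I_smul_sub {N : ℕ} (u : CPt N → ℂ) (q V : CPt N) :
    fderiv ℝ u q (Complex.I • V) - Complex.I * fderiv ℝ u q V =
      -2 * Complex.I * ∑ l, conj (V l) * wzb l u q := by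
  rw [fderiv_eq_sum_wirtinger, fderiv_eq_sum_wirtinger, Finset.mul_sum, Finset.mul_sum,
    ← Finset.sum_sub_distrib]
  refine Finset.sum_congr rfl fun l _ => ?_
  simp only [Pi.smul_apply, smul_eq_mul, map_mul, Complex.conj_I]
  ring

lemma fderiv_ofReal_apply {E : Type*} [NormedAddCommGroup E] [NormedSpace ℝ E] {f : E → ℝ} {q : E}
    (hf : DifferentiableAt ℝ f q) (V : E) :
    fderiv ℝ (fun y => (f y : ℂ)) q V = (fderiv ℝ f q V : ℝ) :=
  congrArg (· V) ((Complex.ofRealCLM.hasFDerivAt (x := f q)).comp q hf.hasFDerivAt).fderiv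

namespace HoloGraph

variable {N : ℕ} {Z : Type*} [NormedAddCommGroup Z] [InnerProductSpace ℝ Z] (H : HoloGraph N Z)

/-- The horizontal connection of the graph. -/
noncomputable def conn (x : Z × ℝ) : Z →L[ℝ] ℝ :=
  (1 + fderiv ℝ H.φ x (0, 1) ^ 2)⁻¹ •
    (((fderiv ℝ H.φ x).comp (ContinuousLinearMap.inl ℝ Z ℝ)).comp H.J -
      fderiv ℝ H.φ x (0, 1) • (fderiv ℝ H.φ x).comp (ContinuousLinearMap.inl ℝ Z ℝ))

lemma conn_apply (x : Z × ℝ) (v : Z) : H.conn x v = (1 + fderiv ℝ H.φ x (0, 1) ^ 2)⁻¹ *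
    (fderiv ℝ H.φ x (H.J v, 0) - fderiv ℝ H.φ x (0, 1) * fderiv ℝ H.φ x (v, 0)) := rfl

lemma fderiv_φ_split (x : Z × ℝ) (v : Z) (s : ℝ) :
    fderiv ℝ H.φ x (v, s) = fderiv ℝ H.φ x (v, 0) + s * fderiv ℝ H.φ x (0, 1) := by
  have : ((v, s) : Z × ℝ) = (v, 0) + s • (0, 1) := by simp
  rw [this, map_add, map_smul, smul_eq_mul]

lemma fderiv_φ_neg (x : Z × ℝ) (v : Z) :
    fderiv ℝ H.φ x (-v, 0) = - fderiv ℝ H.φ x (v, 0) := by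
  rw [← map_neg]
  simp

lemma contDiff_fderiv_φ : ContDiff ℝ ∞ (fderiv ℝ H.φ) :=
  H.contDiff_φ.fderiv_right (by simp)

lemma contDiff_conn : ContDiff ℝ ∞ H.conn := by
  have h1 := H.contDiff_fderiv_φ
  have h2 : ContDiff ℝ ∞ fun x => fderiv ℝ H.φ x (0, 1) := h1.clm_apply contDiff_const
  have h3 : ContDiff ℝ ∞ fun x => (fderiv ℝ H.φ x).comp (ContinuousLinearMap.inl ℝ Z ℝ) :=
    h1.clm_comp contDiff_const
  exact ((contDiff_const.add (h2.pow 2)).inv fun x => by positivity).smul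
    ((h3.clm_comp contDiff_const).sub (h2.smul h3))

lemma hasCompactSupport_conn : HasCompactSupport H.conn := by
  refine (H.hasCompactSupport_φ.fderiv (𝕜 := ℝ)).mono fun x hx => ?_
  contrapose! hx
  rw [Function.notMem_support] at hx ⊢
  simp [conn, hx]

/-- The associated tangential Cauchy–Riemann structure. -/
noncomputable def crGraph : CRGraph Z where
  J := H.J
  φ := H.φ
  A := H.conn
  J_sq := H.J_sq
  contDiff_φ := H.contDiff_φ
  contDiff_A := H.contDiff_conn
  hasCompactSupport_A := H.hasCompactSupport_conn
  compat x v := by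
    have hd : (1 + fderiv ℝ H.φ x (0, 1) ^ 2)⁻¹ * (1 + fderiv ℝ H.φ x (0, 1) ^ 2) = 1 :=
      inv_mul_cancel₀ (by positivity)
    rw [H.fderiv_φ_split, H.fderiv_φ_split x v, conn_apply, conn_apply, H.J_sq, fderiv_φ_neg]
    generalize (1 + fderiv ℝ H.φ x (0, 1) ^ 2)⁻¹ = d at *
    generalize fderiv ℝ H.φ x (0, 1) = s at *
    generalize fderiv ℝ H.φ x (v, 0) = a at *
    generalize fderiv ℝ H.φ x (H.J v, 0) = b at *
    apply Complex.ext
    · simp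
      linear_combination (-a) * hd
    · simp
      linear_combination (-b) * hd

/-- The horizontal lift is compatible with the complex structure. -/
lemma fderiv_Γ_J (x : Z × ℝ) (v : Z) :
    fderiv ℝ H.Γ x (H.J v, H.conn x (H.J v)) = Complex.I • fderiv ℝ H.Γ x (v, H.conn x v) := by
  rw [fderiv_Γ, fderiv_Γ, ← H.L_J]
  exact congrArg (fun t => H.L (H.J v, t)) (H.crGraph.compat x v)

open scoped ComplexConjugate in
lemma isCR_comp_Γ {u : CPt N → ℂ} (hu : ContDiff ℝ ∞ u) {O : Set (CPt N)}
    (h : ∀ q ∈ O, H.ρ q = 0 → ∀ c : CPt N,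
      ∑ l, c l * wzb l (fun y => (H.ρ y : ℂ)) q = 0 → ∑ l, c l * wzb l u q = 0) :
    H.crGraph.IsCR (u ∘ H.Γ) (H.Γ ⁻¹' O) := by
  intro x hx v
  have hd : fderiv ℝ (u ∘ H.Γ) x = (fderiv ℝ u (H.Γ x)).comp (fderiv ℝ H.Γ x) :=
    fderiv_comp x (hu.differentiable (by simp) _) (H.contDiff_Γ.differentiable (by simp) _)
  rw [hd]
  change fderiv ℝ u (H.Γ x) (fderiv ℝ H.Γ x (H.J v, H.conn x (H.J v))) =
    Complex.I * fderiv ℝ u (H.Γ x) (fderiv ℝ H.Γ x (v, H.conn x v))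
  have hρ : ∑ l, conj (fderiv ℝ H.Γ x (v, H.conn x v) l) *
      wzb l (fun y => (H.ρ y : ℂ)) (H.Γ x) = 0 := by
    have h1 := fderiv_I_smul_sub (fun y => (H.ρ y : ℂ)) (H.Γ x) (fderiv ℝ H.Γ x (v, H.conn x v))
    have hdiff : DifferentiableAt ℝ H.ρ (H.Γ x) := H.contDiff_ρ.differentiable (by simp) _
    rw [← fderiv_Γ_J, fderiv_ofReal_apply hdiff, fderiv_ofReal_apply hdiff,
      fderiv_ρ_fderiv_Γ, fderiv_ρ_fderiv_Γ] at h1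
    simpa using h1
  have h2 := fderiv_I_smul_sub u (H.Γ x) (fderiv ℝ H.Γ x (v, H.conn x v))
  rw [h _ hx (H.ρ_Γ x) (fun l => conj (fderiv ℝ H.Γ x (v, H.conn x v) l)) hρ, mul_zero,
    sub_eq_zero] at h2
  rw [fderiv_Γ_J, h2]

lemma containsComplexHypersurfaceThrough {M O : Set (CPt N)} (hO : IsOpen O) (hp : H.p ∈ O)
    (hM : ∀ y ∈ O, H.ρ y = 0 → y ∈ M) (e : (Fin (N - 1) → ℂ) ≃L[ℝ] Z)
    (he : ∀ y, e (Complex.I • y) = H.J (e y))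
    (hf : ∃ (f : Z → ℝ) (r : ℝ), 0 < r ∧ f 0 = 0 ∧ ∀ z ∈ Metric.ball (0 : Z) r,
      HasFDerivAt f (H.crGraph.A (z, f z)) z) :
    ContainsComplexHypersurfaceThrough N M H.p := by
  obtain ⟨f, r, hr, hf0, hf⟩ := hf
  let ψ : (Fin (N - 1) → ℂ) → CPt N := fun y => H.Γ (e y, f (e y))
  have hfd : ∀ z ∈ Metric.ball (0 : Z) r, HasFDerivAt (fun z => H.Γ (z, f z))
      ((fderiv ℝ H.Γ (z, f z)).comp ((ContinuousLinearMap.id ℝ Z).prod (H.conn (z, f z)))) z :=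
    fun z hz => (H.contDiff_Γ.differentiable (by simp) _).hasFDerivAt.comp z
      ((hasFDerivAt_id z).prodMk (hf z hz))
  have hψd : ∀ y, e y ∈ Metric.ball (0 : Z) r → HasFDerivAt ψ
      (((fderiv ℝ H.Γ (e y, f (e y))).comp ((ContinuousLinearMap.id ℝ Z).prod
        (H.conn (e y, f (e y))))).comp (e : (Fin (N - 1) → ℂ) →L[ℝ] Z)) y :=
    fun y hy => (hfd (e y) hy).comp y e.hasFDerivAt
  have hψ0 : ψ 0 = H.p := by
    simp only [ψ, map_zero, hf0]
    exact H.Γ_zero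
  have h0 : e 0 ∈ Metric.ball (0 : Z) r := by simpa using hr
  have hU : {y | e y ∈ Metric.ball (0 : Z) r ∧ ψ y ∈ O} ∈ 𝓝 (0 : Fin (N - 1) → ℂ) := by
    refine Filter.inter_mem
      (e.continuous.continuousAt.preimage_mem_nhds (Metric.isOpen_ball.mem_nhds h0)) ?_
    exact (hψd 0 h0).continuousAt.preimage_mem_nhds (hO.mem_nhds (by rwa [hψ0]))
  obtain ⟨r', hr', hsub⟩ := Metric.mem_nhds_iff.1 hU
  have hC : ∀ y, e y ∈ Metric.ball (0 : Z) r → ∃ P : (Fin (N - 1) → ℂ) →L[ℂ] CPt N,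
      HasFDerivAt ψ P y ∧ ∀ w, P w = fderiv ℝ H.Γ (e y, f (e y)) (e w, H.conn (e y, f (e y)) (e w)) := by
    intro y hy
    have hd := hψd y hy
    set P := (((fderiv ℝ H.Γ (e y, f (e y))).comp ((ContinuousLinearMap.id ℝ Z).prod
        (H.conn (e y, f (e y))))).comp (e : (Fin (N - 1) → ℂ) →L[ℝ] Z)) with hP
    have hPI : ∀ w, P (Complex.I • w) = Complex.I • P w := by
      intro w
      change fderiv ℝ H.Γ _ (e (Complex.I • w), H.conn _ (e (Complex.I • w))) = _
      rw [he, fderiv_Γ_J]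
      rfl
    let P' : (Fin (N - 1) → ℂ) →L[ℂ] CPt N :=
      { P with
        map_smul' := fun c w => by
          have : c • w = c.re • w + c.im • (Complex.I • w) := by
            conv_lhs => rw [← Complex.re_add_im c, add_smul, mul_smul]
            simp
          change P (c • w) = c • P w
          rw [this, map_add, map_smul, map_smul, hPI]
          conv_rhs => rw [← Complex.re_add_im c, add_smul, mul_smul]
          simp }
    refine ⟨P', hasFDerivAt_of_restrictScalars ℝ hd rfl, fun w => rfl⟩
  refine ⟨ψ, r', hr', fun y hy => ?_, hψ0, fun y hy => ?_, ?_⟩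
  · obtain ⟨P, hP, -⟩ := hC y (hsub hy).1
    exact hP.differentiableAt.differentiableWithinAt
  · exact hM _ (hsub hy).2 (H.ρ_Γ _)
  · obtain ⟨P, hP, hP'⟩ := hC 0 h0
    rw [hP.fderiv]
    intro w w' hw
    rw [hP', hP', fderiv_Γ, fderiv_Γ] at hw
    exact e.injective (congrArg Prod.fst (H.L.injective hw))

end HoloGraph

section Implicit

variable {Z : Type*} [NormedAddCommGroup Z] [NormedSpace ℝ Z]

/-- The straightening map of a hypersurface `R = 0`. -/
def straighten (R : Z × ℂ → ℝ) (x : Z × ℂ) : Z × ℂ := (x.1, ⟨x.2.re, R x⟩)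

lemma contDiffAt_straighten {R : Z × ℂ → ℝ} {x : Z × ℂ} (hR : ContDiffAt ℝ ∞ R x) :
    ContDiffAt ℝ ∞ (straighten R) x := by
  have h : ContDiffAt ℝ ∞ (fun x : Z × ℂ => ((x.2.re : ℝ) : ℂ) + ((R x : ℝ) : ℂ) * Complex.I) x := by
    refine ContDiffAt.add ?_ (ContDiffAt.mul ?_ contDiffAt_const)
    · exact (Complex.ofRealCLM.contDiff.comp (Complex.reCLM.contDiff.comp contDiff_snd)).contDiffAt
    · exact Complex.ofRealCLM.contDiff.contDiffAt.comp x hR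
  refine contDiffAt_fst.prodMk (h.congr_of_eventuallyEq (.of_forall fun y => ?_))
  apply Complex.ext <;> simp

lemma exists_equiv_hasFDerivAt_straighten [FiniteDimensional ℝ Z] {R : Z × ℂ → ℝ} {x : Z × ℂ}
    (hR : DifferentiableAt ℝ R x) (h0 : fderiv ℝ R x (0, Complex.I) ≠ 0) :
    ∃ P : (Z × ℂ) ≃L[ℝ] (Z × ℂ), HasFDerivAt (straighten R) (P : (Z × ℂ) →L[ℝ] (Z × ℂ)) x := by
  have h1 := (Complex.ofRealCLM.hasFDerivAt (x := R x)).comp x hR.hasFDerivAt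
  have h2 := (Complex.ofRealCLM.hasFDerivAt (x := x.2.re)).comp x
    ((Complex.reCLM.hasFDerivAt (x := x.2)).comp x (hasFDerivAt_snd (𝕜 := ℝ) (p := x)))
  have h3 := (hasFDerivAt_fst (𝕜 := ℝ) (p := x)).prodMk (h2.add (h1.mul_const Complex.I))
  set P₀ := (ContinuousLinearMap.fst ℝ Z ℂ).prod ((Complex.ofRealCLM.comp
    (Complex.reCLM.comp (ContinuousLinearMap.snd ℝ Z ℂ))) +
      Complex.I • (Complex.ofRealCLM.comp (fderiv ℝ R x))) with hP₀
  have hs : HasFDerivAt (straighten R) P₀ x := by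
    refine HasFDerivAt.congr_of_eventuallyEq (h3.congr_fderiv ?_) (.of_forall fun y => ?_)
    · rfl
    · refine Prod.ext rfl ?_
      apply Complex.ext <;> simp [straighten]
  have hinj : Function.Injective P₀ := by
    rw [injective_iff_map_eq_zero]
    rintro ⟨v, c⟩ hvc
    have hv : v = 0 := congrArg Prod.fst hvc
    subst hv
    have h4 : ((c.re : ℝ) : ℂ) + Complex.I * ((fderiv ℝ R x (0, c) : ℝ) : ℂ) = 0 :=
      congrArg Prod.snd hvc
    have hre : c.re = 0 := by simpa using congrArg Complex.re h4
    have him : fderiv ℝ R x (0, c) = 0 := by simpa using congrArg Complex.im h4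
    have hc : ((0, c) : Z × ℂ) = c.im • (0, Complex.I) := by
      refine Prod.ext (by simp) ?_
      apply Complex.ext <;> simp [hre]
    rw [hc, map_smul, smul_eq_mul, mul_eq_zero, or_iff_left h0] at him
    exact Prod.ext rfl (Complex.ext hre him)
  refine ⟨(LinearEquiv.ofInjectiveEndo (P₀ : (Z × ℂ) →ₗ[ℝ] (Z × ℂ)) hinj).toContinuousLinearEquiv, ?_⟩
  exact hs

lemma exists_graph_function [FiniteDimensional ℝ Z] {R : Z × ℂ → ℝ} {U : Set (Z × ℂ)}
    (hU : IsOpen U) (h0U : 0 ∈ U) (hR : ContDiffOn ℝ ∞ R U) (hR0 : R 0 = 0)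
    (hdR : fderiv ℝ R 0 (0, Complex.I) ≠ 0) :
    ∃ φ : Z × ℝ → ℝ, ContDiff ℝ ∞ φ ∧ HasCompactSupport φ ∧ φ 0 = 0 ∧
      ∀ᶠ x in 𝓝 (0 : Z × ℂ), R x = 0 ↔ x.2.im = φ (x.1, x.2.re) := by
  have hat : ∀ x ∈ U, ContDiffAt ℝ ∞ R x := fun x hx => hR.contDiffAt (hU.mem_nhds hx)
  have hcont : ContinuousOn (fun x => fderiv ℝ R x (0, Complex.I)) U :=
    (hR.continuousOn_fderiv_of_isOpen hU (by simp)).clm_apply continuousOn_const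
  set G := U ∩ (fun x => fderiv ℝ R x (0, Complex.I)) ⁻¹' {0}ᶜ with hG
  have hGo : IsOpen G := hcont.isOpen_inter_preimage hU isOpen_compl_singleton
  have h0G : (0 : Z × ℂ) ∈ G := ⟨h0U, hdR⟩
  obtain ⟨P, hP⟩ := exists_equiv_hasFDerivAt_straighten
    ((hat 0 h0U).differentiableAt (by simp)) hdR
  set h := (contDiffAt_straighten (hat 0 h0U)).toOpenPartialHomeomorph (straighten R) hP (by simp)
    with hh
  have hcoe : ∀ x, h x = straighten R x := fun x => rfl
  have h0s : (0 : Z × ℂ) ∈ h.source :=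
    (contDiffAt_straighten (hat 0 h0U)).mem_toOpenPartialHomeomorph_source hP (by simp)
  have hst0 : h 0 = 0 := by
    rw [hcoe, straighten, hR0]
    rfl
  have h0t : (0 : Z × ℂ) ∈ h.target := by
    rw [← hst0]
    exact h.map_source h0s
  have hsymm0 : h.symm 0 = 0 := by
    conv_lhs => rw [← hst0]
    exact h.left_inv h0s
  set T := h.target ∩ h.symm ⁻¹' G with hT
  have hTo : IsOpen T := h.symm.isOpen_inter_preimage hGo
  have hTs : ContDiffOn ℝ ∞ h.symm T := by
    rintro y ⟨hyt, hyG⟩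
    obtain ⟨Q, hQ⟩ := exists_equiv_hasFDerivAt_straighten
      ((hat _ hyG.1).differentiableAt (by simp)) hyG.2
    exact (h.contDiffAt_symm hyt hQ (contDiffAt_straighten (hat _ hyG.1))).contDiffWithinAt
  let j : Z × ℝ → Z × ℂ := fun x => (x.1, (x.2 : ℂ))
  have hj : ContDiff ℝ ∞ j := contDiff_fst.prodMk (Complex.ofRealCLM.contDiff.comp contDiff_snd)
  have hj0 : j 0 = 0 := by simp [j]
  have hjT : j ⁻¹' T ∈ 𝓝 (0 : Z × ℝ) := by
    refine hj.continuous.continuousAt.preimage_mem_nhds (hTo.mem_nhds ?_)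
    rw [hj0]
    exact ⟨h0t, by rw [Set.mem_preimage, hsymm0]; exact h0G⟩
  have hφ₀ : ContDiffOn ℝ ∞ (fun x => (h.symm (j x)).2.im) (j ⁻¹' T) :=
    Complex.imCLM.contDiff.comp_contDiffOn (contDiff_snd.comp_contDiffOn
      (hTs.comp hj.contDiffOn (Set.mapsTo_preimage _ _)))
  obtain ⟨φ, hφ, hφc, hφe⟩ := exists_contDiff_eventuallyEq hjT hφ₀
  refine ⟨φ, hφ, hφc, ?_, ?_⟩
  · rw [hφe.self_of_nhds]
    change (h.symm (j 0)).2.im = 0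
    rw [hj0, hsymm0]
    rfl
  let k : Z × ℂ → Z × ℝ := fun x => (x.1, x.2.re)
  have hk : Continuous k := by fun_prop
  have hk0 : Filter.Tendsto k (𝓝 0) (𝓝 0) := hk.tendsto' 0 0 rfl
  filter_upwards [hk0.eventually hφe, hk0.eventually hjT, h.open_source.mem_nhds h0s]
    with x hx1 hx2 hx3
  change _ ↔ _ = φ (k x)
  rw [hx1]
  have hx2' : j (k x) ∈ h.target := hx2.1
  constructor
  · intro hRx
    have : h x = j (k x) := by
      rw [hcoe, straighten, hRx]
      refine Prod.ext rfl ?_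
      apply Complex.ext <;> simp [j, k]
    rw [← this, h.left_inv hx3]
  · intro him
    have h5 := h.right_inv hx2'
    rw [hcoe, straighten] at h5
    have h6 : h.symm (j (k x)) = x := by
      have h7 : (h.symm (j (k x))).1 = x.1 := congrArg (fun y => y.1) h5
      have h8 : (h.symm (j (k x))).2.re = x.2.re := congrArg (fun y => y.2.re) h5
      exact Prod.ext h7 (Complex.ext h8 him.symm)
    rw [h6] at h5
    exact congrArg (fun y => y.2.im) h5

end Implicit

lemma exists_single_fderiv_ne_zero {N : ℕ} {P : CPt N →L[ℝ] ℝ} (hP : P ≠ 0) :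
    ∃ (m : Fin N) (a : ℂ), a ≠ 0 ∧ P (Pi.single m a) ≠ 0 := by
  by_contra! h
  refine hP (ContinuousLinearMap.ext fun V => ?_)
  have : V = ∑ l, (Pi.single l (V l) : CPt N) := (Finset.univ_sum_single V).symm
  rw [this, map_sum]
  refine (Finset.sum_eq_zero fun l _ => ?_).trans rfl
  by_cases hl : V l = 0
  · simp [hl]
  · exact h l _ hl

/-- Complex linear coordinates whose last axis is the `m`-th coordinate axis. -/
noncomputable def axisCoord {n : ℕ} (m : Fin (n + 1)) (b : ℂ) (hb : b ≠ 0) :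
    (EuclideanSpace ℂ (Fin n) × ℂ) ≃L[ℝ] CPt (n + 1) :=
  LinearEquiv.toContinuousLinearEquiv
    { toFun := fun x => m.insertNth (b * x.2) (fun i => x.1 i)
      invFun := fun y => (WithLp.toLp 2 (fun i => y (m.succAbove i)), b⁻¹ * y m)
      map_add' := fun x y => by
        ext i
        refine Fin.succAboveCases m ?_ (fun j => ?_) i
        · simp [mul_add]
        · simp
      map_smul' := fun c x => by
        ext i
        refine Fin.succAboveCases m ?_ (fun j => ?_) i
        · simp [mul_left_comm]
        · simp
      left_inv := fun x => by
        refine Prod.ext ?_ ?_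
        · ext i
          simp
        · simp [hb]
      right_inv := fun y => by
        ext i
        refine Fin.succAboveCases m ?_ (fun j => ?_) i
        · simp [hb]
        · simp }

lemma axisCoord_apply {n : ℕ} (m : Fin (n + 1)) (b : ℂ) (hb : b ≠ 0)
    (x : EuclideanSpace ℂ (Fin n) × ℂ) :
    axisCoord m b hb x = m.insertNth (b * x.2) (fun i => x.1 i) := rfl

theorem exists_holoGraph {n : ℕ} {M U : Set (CPt (n + 1))} {ρ : CPt (n + 1) → ℝ}
    {p : CPt (n + 1)} (hp : p ∈ M) (hρ : DefiningFn (n + 1) M U ρ p) :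
    ∃ H : HoloGraph (n + 1) (EuclideanSpace ℂ (Fin n)), H.p = p ∧
      (∃ e : (Fin n → ℂ) ≃L[ℝ] EuclideanSpace ℂ (Fin n), ∀ y, e (Complex.I • y) = H.J (e y)) ∧
      ∃ O, IsOpen O ∧ p ∈ O ∧ ∀ y ∈ O, y ∈ M ↔ H.ρ y = 0 := by
  obtain ⟨hUo, hpU, hsm, hMU, hd⟩ := hρ
  obtain ⟨m, a, ha, hPa⟩ := exists_single_fderiv_ne_zero (hd p hpU)
  have hb : -Complex.I * a ≠ 0 := mul_ne_zero (neg_ne_zero.2 Complex.I_ne_zero) ha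
  set L := axisCoord m (-Complex.I * a) hb with hL
  have hLI : L (0, Complex.I) = Pi.single m a := by
    rw [hL, axisCoord_apply]
    ext i
    refine Fin.succAboveCases m ?_ (fun j => ?_) i
    · simp only [Fin.insertNth_apply_same, Pi.single_eq_same]
      linear_combination (-a) * Complex.I_mul_I
    · simp
  let J : EuclideanSpace ℂ (Fin n) →L[ℝ] EuclideanSpace ℂ (Fin n) :=
    LinearMap.toContinuousLinearMap
      { toFun := fun v => WithLp.toLp 2 (fun i => Complex.I * v i)
        map_add' := fun v w => by ext i; simp [mul_add]
        map_smul' := fun c v => by ext i; simp [mul_left_comm] }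
  have hJ : ∀ v, J v = WithLp.toLp 2 (fun i => Complex.I * v i) := fun v => rfl
  have hLJ : ∀ v c, L (J v, Complex.I * c) = Complex.I • L (v, c) := by
    intro v c
    rw [hL, axisCoord_apply, axisCoord_apply]
    ext i
    refine Fin.succAboveCases m ?_ (fun j => ?_) i
    · simp only [Fin.insertNth_apply_same, Pi.smul_apply, smul_eq_mul]
      ring
    · simp [hJ]
  let Λ : EuclideanSpace ℂ (Fin n) × ℂ → CPt (n + 1) := fun x => p + L x
  have hΛ : ContDiff ℝ ∞ Λ := contDiff_const.add L.contDiff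
  have hΛ0 : Λ 0 = p := by simp [Λ]
  have hR0 : (ρ ∘ Λ) 0 = 0 := by
    have : p ∈ {z | z ∈ U ∧ ρ z = 0} := hMU ▸ ⟨hp, hpU⟩
    rw [Function.comp_apply, hΛ0]
    exact this.2
  have hdR : fderiv ℝ (ρ ∘ Λ) 0 (0, Complex.I) ≠ 0 := by
    have h1 : HasFDerivAt Λ (L : _ →L[ℝ] _) 0 := L.hasFDerivAt.const_add p
    have h2 : HasFDerivAt ρ (fderiv ℝ ρ p) (Λ 0) := by
      rw [hΛ0]
      exact ((hsm.contDiffAt (hUo.mem_nhds hpU)).differentiableAt (by simp)).hasFDerivAt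
    rw [(h2.comp 0 h1).fderiv]
    change fderiv ℝ ρ p (L (0, Complex.I)) ≠ 0
    rwa [hLI]
  obtain ⟨φ, hφ, hφc, hφ0, hφe⟩ := exists_graph_function (hUo.preimage hΛ.continuous)
    (by rwa [Set.mem_preimage, hΛ0]) (hsm.comp hΛ.contDiffOn (Set.mapsTo_preimage _ _)) hR0 hdR
  let H : HoloGraph (n + 1) (EuclideanSpace ℂ (Fin n)) :=
    { p := p
      J := J
      J_sq := fun v => by
        ext i
        simp [hJ, ← mul_assoc]
      L := L
      L_J := hLJ
      m := m
      a := a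
      L_I := hLI
      φ := φ
      contDiff_φ := hφ
      hasCompactSupport_φ := hφc
      φ_zero := hφ0 }
  refine ⟨H, rfl, ⟨(PiLp.continuousLinearEquiv 2 ℝ (fun _ : Fin n => ℂ)).symm, fun y => ?_⟩, ?_⟩
  · ext i
    simp [H, hJ]
  have hsymm : Filter.Tendsto (fun y => L.symm (y - p)) (𝓝 p) (𝓝 0) := by
    refine Continuous.tendsto' (by fun_prop) _ _ (by simp)
  have hev : ∀ᶠ y in 𝓝 p, y ∈ M ↔ H.ρ y = 0 := by
    filter_upwards [hsymm.eventually hφe, hUo.mem_nhds hpU] with y hy hyU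
    have h1 : y ∈ M ↔ ρ y = 0 := by
      have := congrArg (y ∈ ·) hMU
      simpa [hyU] using this
    rw [h1, HoloGraph.ρ, sub_eq_zero]
    have h2 : (ρ ∘ Λ) (L.symm (y - p)) = ρ y := by simp [Λ]
    rw [h2] at hy
    exact hy
  obtain ⟨O, hO, hOo, hpO⟩ := eventually_nhds_iff.1 hev
  exact ⟨O, hOo, hpO, hO⟩

namespace CommDer

variable {ι A : Type*} [CommRing A] [Algebra ℂ A] (D : CommDer ι A)

lemma pow_add_single_nat (ν : ι →₀ ℕ) (i : ι) (k : ℕ) (a : A) :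
    D.pow (ν + Finsupp.single i k) a = (D.der i)^[k] (D.pow ν a) := by
  induction k with
  | zero => simp
  | succ k ih =>
    rw [Finsupp.single_add, ← add_assoc, pow_add_single, ih, Function.iterate_succ_apply']

lemma pow_foldr {κ : Type*} (f : κ → ι) (α : κ → ℕ) (ν : ι →₀ ℕ) (a : A) (l : List κ) :
    (l.foldr (fun m F => (D.der (f m))^[α m] ∘ F) id) (D.pow ν a) =
      D.pow (ν + (l.map fun m => Finsupp.single (f m) (α m)).sum) a := by
  induction l with
  | nil => simp
  | cons m l ih =>
    rw [List.foldr_cons, Function.comp_apply, ih, List.map_cons, List.sum_cons,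
      ← pow_add_single_nat, add_assoc, add_comm (Finsupp.single _ _)]

end CommDer

/-- The algebra of smooth complex valued functions on `ℂ^N`. -/
noncomputable def smoothAlg (N : ℕ) : Subalgebra ℂ (CPt N → ℂ) where
  carrier := {u | ContDiff ℝ ∞ u}
  mul_mem' {a b} ha hb := by
    rw [Set.mem_ofPred_eq] at *
    exact ContDiff.mul ha hb
  add_mem' {a b} ha hb := by
    rw [Set.mem_ofPred_eq] at *
    exact ContDiff.add ha hb
  algebraMap_mem' _ := by
    rw [Set.mem_ofPred_eq]
    exact contDiff_const

namespace smoothAlg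

variable {N : ℕ}

lemma contDiff (u : smoothAlg N) : ContDiff ℝ ∞ (u : CPt N → ℂ) := u.2

lemma differentiableAt (u : smoothAlg N) (q : CPt N) : DifferentiableAt ℝ (u : CPt N → ℂ) q :=
  (contDiff u).differentiable (by simp) q

/-- The directional derivative. -/
noncomputable def dirDer (v : CPt N) : Derivation ℂ (smoothAlg N) (smoothAlg N) :=
  Derivation.mk'
    { toFun := fun u => ⟨fun x => fderiv ℝ (u : CPt N → ℂ) x v, (contDiff u).fderiv_apply_const v⟩
      map_add' := fun a b => by
        ext x
        exact congrArg (· v) (fderiv_add (differentiableAt a x) (differentiableAt b x))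
      map_smul' := fun c a => by
        ext x
        exact congrArg (· v) (fderiv_const_smul (differentiableAt a x) c) }
    fun a b => by
      ext x
      have h := congrArg (· v) (fderiv_mul (differentiableAt a x) (differentiableAt b x))
      exact h

lemma dirDer_comm (v w : CPt N) (u : smoothAlg N) : dirDer v (dirDer w u) = dirDer w (dirDer v u) := by
  ext x
  exact (contDiff u).fderiv_apply_comm _ _ x

variable (N) in
/-- The Wirtinger derivations. -/
noncomputable def wirtinger : CommDer (Fin N ⊕ Fin N) (smoothAlg N) where
  der := Sum.elim
    (fun l => (1 / 2 : ℂ) • (dirDer (Pi.single l 1) - Complex.I • dirDer (Pi.single l Complex.I)))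
    (fun l => (1 / 2 : ℂ) • (dirDer (Pi.single l 1) + Complex.I • dirDer (Pi.single l Complex.I)))
  comm i j a := by
    rcases i with i | i <;> rcases j with j | j <;>
    · simp only [Sum.elim_inl, Sum.elim_inr, Derivation.smul_apply, Derivation.sub_apply,
        Derivation.add_apply, Derivation.map_smul, map_sub, map_add]
      rw [dirDer_comm (Pi.single i 1) (Pi.single j 1), dirDer_comm (Pi.single i 1),
        dirDer_comm (Pi.single i Complex.I) (Pi.single j 1), dirDer_comm (Pi.single i Complex.I)]
      module

lemma coe_der_inl (l : Fin N) (u : smoothAlg N) :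
    ((wirtinger N).der (Sum.inl l) u : CPt N → ℂ) = wz l u := rfl

lemma coe_der_inr (l : Fin N) (u : smoothAlg N) :
    ((wirtinger N).der (Sum.inr l) u : CPt N → ℂ) = wzb l u := rfl

/-- Evaluation at a point. -/
noncomputable def ev (q : CPt N) : smoothAlg N →ₐ[ℂ] ℂ :=
  (Pi.evalAlgHom ℂ (fun _ : CPt N => ℂ) q).comp (smoothAlg N).val

@[simp] lemma ev_apply (q : CPt N) (u : smoothAlg N) : ev q u = (u : CPt N → ℂ) q := rfl

lemma foldr_wz (α : Fin N → ℕ) (u : smoothAlg N) (l : List (Fin N)) :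
    (l.foldr (fun m F => (wz m)^[α m] ∘ F) id) (u : CPt N → ℂ) =
      ((l.foldr (fun m F => ((wirtinger N).der (Sum.inl m))^[α m] ∘ F) id) u : smoothAlg N) := by
  have hit : ∀ (m : Fin N) (k : ℕ) (u : smoothAlg N),
      (wz m)^[k] (u : CPt N → ℂ) = (((wirtinger N).der (Sum.inl m))^[k] u : smoothAlg N) := by
    intro m k u
    induction k generalizing u with
    | zero => rfl
    | succ k ih => rw [Function.iterate_succ_apply, Function.iterate_succ_apply, ← ih]; rfl
  induction l with
  | nil => rfl
  | cons m l ih => rw [List.foldr_cons, List.foldr_cons, Function.comp_apply, Function.comp_apply, ih, hit]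

lemma foldr_wzb (α : Fin N → ℕ) (u : smoothAlg N) (l : List (Fin N)) :
    (l.foldr (fun m F => (wzb m)^[α m] ∘ F) id) (u : CPt N → ℂ) =
      ((l.foldr (fun m F => ((wirtinger N).der (Sum.inr m))^[α m] ∘ F) id) u : smoothAlg N) := by
  have hit : ∀ (m : Fin N) (k : ℕ) (u : smoothAlg N),
      (wzb m)^[k] (u : CPt N → ℂ) = (((wirtinger N).der (Sum.inr m))^[k] u : smoothAlg N) := by
    intro m k u
    induction k generalizing u with
    | zero => rfl
    | succ k ih => rw [Function.iterate_succ_apply, Function.iterate_succ_apply, ← ih]; rfl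
  induction l with
  | nil => rfl
  | cons m l ih => rw [List.foldr_cons, List.foldr_cons, Function.comp_apply, Function.comp_apply, ih, hit]

lemma sum_map_single (μ : Fin N ⊕ Fin N →₀ ℕ) :
    ((List.finRange N).map fun m => Finsupp.single (Sum.inr m) (μ (Sum.inr m))).sum +
      ((List.finRange N).map fun m => Finsupp.single (Sum.inl m) (μ (Sum.inl m))).sum = μ := by
  classical
  have h : ∀ f : Fin N → (Fin N ⊕ Fin N →₀ ℕ), ((List.finRange N).map f).sum = ∑ m, f m := fun f => by
    rw [← List.ofFn_eq_map, List.sum_ofFn]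
  rw [h, h]
  ext i
  rcases i with i | i <;> simp [Finsupp.single_apply]

lemma cTaylor_eq (u : smoothAlg N) (q : CPt N) :
    cTaylor (u : CPt N → ℂ) q = (wirtinger N).taylor (ev q) u := by
  ext μ
  rw [CommDer.coeff_taylor]
  change wpow _ _ _ q / _ = _
  rw [wpow, foldr_wzb, foldr_wz]
  have h1 := (wirtinger N).pow_foldr Sum.inr (fun m => μ (Sum.inr m)) 0 u (List.finRange N)
  rw [CommDer.pow_zero, zero_add] at h1
  rw [h1, CommDer.pow_foldr, sum_map_single, Fintype.prod_sum_type]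
  rfl

open scoped ComplexConjugate in
/-- Complex conjugation. -/
noncomputable def conjHom : smoothAlg N →+* smoothAlg N where
  toFun u := ⟨fun x => conj ((u : CPt N → ℂ) x), Complex.conjCLE.contDiff.comp (contDiff u)⟩
  map_one' := by ext; simp
  map_zero' := by ext; simp
  map_mul' a b := by ext; simp
  map_add' a b := by ext; simp

open scoped ComplexConjugate in
@[simp] lemma conjHom_apply (u : smoothAlg N) (x : CPt N) :
    (conjHom u : CPt N → ℂ) x = conj ((u : CPt N → ℂ) x) := rfl

lemma conjHom_conjHom (u : smoothAlg N) : conjHom (conjHom u) = u := by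
  ext x
  simp

open scoped ComplexConjugate in
lemma fderiv_conjHom (u : smoothAlg N) (x v : CPt N) :
    fderiv ℝ (conjHom u : CPt N → ℂ) x v = conj (fderiv ℝ (u : CPt N → ℂ) x v) :=
  congrArg (· v) ((Complex.conjCLE.hasFDerivAt (x := (u : CPt N → ℂ) x)).comp x
    (differentiableAt u x).hasFDerivAt).fderiv

lemma conjHom_der (i : Fin N ⊕ Fin N) (u : smoothAlg N) :
    conjHom ((wirtinger N).der i u) = (wirtinger N).der i.swap (conjHom u) := by
  ext x
  rcases i with i | i
  · rw [Sum.swap_inl, coe_der_inr, conjHom_apply, coe_der_inl, wz, wzb, fderiv_conjHom, fderiv_conjHom]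
    simp [map_ofNat (starRingEnd ℂ) 2]
  · rw [Sum.swap_inr, coe_der_inl, conjHom_apply, coe_der_inr, wz, wzb, fderiv_conjHom, fderiv_conjHom]
    simp [sub_eq_add_neg, map_ofNat (starRingEnd ℂ) 2]

/-- Near a point where it does not vanish, a smooth function has a smooth inverse. -/
lemma exists_local_inverse (u : smoothAlg N) {q : CPt N} (hq : (u : CPt N → ℂ) q ≠ 0) :
    ∃ (v : smoothAlg N) (O : Set (CPt N)), IsOpen O ∧ q ∈ O ∧
      ∀ y ∈ O, (v : CPt N → ℂ) y * (u : CPt N → ℂ) y = 1 := by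
  have hU : IsOpen ((u : CPt N → ℂ) ⁻¹' {0}ᶜ) := isOpen_compl_singleton.preimage (contDiff u).continuous
  have hinv : ContDiffOn ℝ ∞ (fun y => ((u : CPt N → ℂ) y)⁻¹) ((u : CPt N → ℂ) ⁻¹' {0}ᶜ) :=
    (contDiff u).contDiffOn.inv fun y hy => hy
  obtain ⟨v, hv, -, hve⟩ := exists_contDiff_eventuallyEq (hU.mem_nhds hq) hinv
  have hev : ∀ᶠ y in 𝓝 q, v y * (u : CPt N → ℂ) y = 1 := by
    filter_upwards [hve, hU.mem_nhds hq] with y hy hy'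
    rw [hy]
    exact inv_mul_cancel₀ hy'
  obtain ⟨O, hO, hOo, hqO⟩ := eventually_nhds_iff.1 hev
  exact ⟨⟨v, hv⟩, O, hOo, hqO, hO⟩

end smoothAlg

namespace CommDer

variable {ι A : Type*} [CommRing A] [Algebra ℂ A] (D : CommDer ι A)

/-- The derivation induced on the quotient by an invariant ideal. -/
noncomputable def quotDer (I : Ideal A) (δ : Derivation ℂ A A) (h : ∀ a ∈ I, δ a ∈ I) :
    Derivation ℂ (A ⧸ I) (A ⧸ I) :=
  have key : ∀ a, Ideal.Quotient.mk I (δ (Quotient.out (Ideal.Quotient.mk I a))) =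
      Ideal.Quotient.mk I (δ a) := fun a => by
    rw [Ideal.Quotient.eq, ← map_sub]
    exact h _ (Ideal.Quotient.eq.1 (Quotient.out_eq _))
  Derivation.mk'
    { toFun := fun x => Ideal.Quotient.mk I (δ (Quotient.out x))
      map_add' := fun x y => by
        obtain ⟨a, rfl⟩ := Ideal.Quotient.mk_surjective x
        obtain ⟨b, rfl⟩ := Ideal.Quotient.mk_surjective y
        rw [← map_add, key, key, key, map_add, map_add]
      map_smul' := fun c x => by
        obtain ⟨a, rfl⟩ := Ideal.Quotient.mk_surjective x
        have hs : ∀ b, c • Ideal.Quotient.mk I b = Ideal.Quotient.mk I (c • b) := fun b => rfl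
        rw [hs, key, key, Derivation.map_smul, RingHom.id_apply, hs] }
    fun x y => by
      obtain ⟨a, rfl⟩ := Ideal.Quotient.mk_surjective x
      obtain ⟨b, rfl⟩ := Ideal.Quotient.mk_surjective y
      change Ideal.Quotient.mk I (δ (Quotient.out (Ideal.Quotient.mk I a * Ideal.Quotient.mk I b))) =
        _ • Ideal.Quotient.mk I (δ (Quotient.out (Ideal.Quotient.mk I b))) +
        _ • Ideal.Quotient.mk I (δ (Quotient.out (Ideal.Quotient.mk I a)))
      rw [← map_mul, key, key, key, Derivation.leibniz, map_add]
      rfl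

lemma quotDer_mk (I : Ideal A) (δ : Derivation ℂ A A) (h : ∀ a ∈ I, δ a ∈ I) (a : A) :
    quotDer I δ h (Ideal.Quotient.mk I a) = Ideal.Quotient.mk I (δ a) := by
  change Ideal.Quotient.mk I (δ (Quotient.out (Ideal.Quotient.mk I a))) = _
  rw [Ideal.Quotient.eq, ← map_sub]
  exact h _ (Ideal.Quotient.eq.1 (Quotient.out_eq _))

/-- The commuting derivations induced on the quotient by an invariant ideal. -/
noncomputable def quot (I : Ideal A) (h : ∀ i, ∀ a ∈ I, D.der i a ∈ I) : CommDer ι (A ⧸ I) where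
  der i := quotDer I (D.der i) (h i)
  comm i j x := by
    obtain ⟨a, rfl⟩ := Ideal.Quotient.mk_surjective x
    simp only [quotDer_mk, D.comm i j]

variable {I : Ideal A} (h : ∀ i, ∀ a ∈ I, D.der i a ∈ I)

@[simp] lemma quot_mk (i : ι) (a : A) :
    (D.quot I h).der i (Ideal.Quotient.mk I a) = Ideal.Quotient.mk I (D.der i a) :=
  quotDer_mk I (D.der i) (h i) a

lemma comp_quot_pow_mk {κ : Type*} (f : κ → ι) (μ : κ →₀ ℕ) (a : A) :
    ((D.quot I h).comp f).pow μ (Ideal.Quotient.mk I a) =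
      Ideal.Quotient.mk I ((D.comp f).pow μ a) :=
  (CommDer.map_pow (D.comp f) ((D.quot I h).comp f) (Ideal.Quotient.mk I).toAddMonoidHom
    (fun i a => (D.quot_mk h (f i) a).symm) μ a).symm

end CommDer

namespace CRFrame

variable {N : ℕ} {A : Type*} [CommRing A] [Algebra ℂ A] {m : Fin N}

/-- The frame induced on the quotient by an invariant ideal. -/
noncomputable def quot (F : CRFrame N A m) (I : Ideal A) (h : ∀ i, ∀ a ∈ I, F.S.der i a ∈ I)
    (h' : ∀ i, ∀ a ∈ I, F.S'.der i a ∈ I) : CRFrame N (A ⧸ I) m where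
  S := F.S.quot I h
  S' := F.S'.quot I h'
  c j := Ideal.Quotient.mk I (F.c j)
  c' j := Ideal.Quotient.mk I (F.c' j)
  κ := Ideal.Quotient.mk I F.κ
  κ' := Ideal.Quotient.mk I F.κ'
  hκ := by rw [← map_mul, F.hκ, map_one]
  hL j x := by
    obtain ⟨a, rfl⟩ := Ideal.Quotient.mk_surjective x
    simp only [CommDer.quot_mk, F.hL, map_sub, map_mul]
  hL' j x := by
    obtain ⟨a, rfl⟩ := Ideal.Quotient.mk_surjective x
    simp only [CommDer.quot_mk, F.hL', map_sub, map_mul]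
  hZ x := by
    obtain ⟨a, rfl⟩ := Ideal.Quotient.mk_surjective x
    simp only [CommDer.quot_mk, F.hZ, map_mul]
  hc := by rw [F.hc, map_one]
  hc' := by rw [F.hc', map_one]

/-- The frame attached to a defining element. -/
noncomputable def ofDefining (D : CommDer (Fin N ⊕ Fin N) A) (ρ g gb : A)
    (hg : g * D.der (Sum.inr m) ρ = 1) (hgb : gb * D.der (Sum.inl m) ρ = 1) : CRFrame N A m where
  S := D.tangential (Sum.inr m) ρ g hg
  S' := (D.tangential (Sum.inl m) ρ gb hgb).comp Sum.swap
  c j := gb * D.der (Sum.inl j) ρ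
  c' j := g * D.der (Sum.inr j) ρ
  κ := -(gb * D.der (Sum.inr m) ρ)
  κ' := -(g * D.der (Sum.inl m) ρ)
  hκ := by linear_combination (gb * D.der (Sum.inl m) ρ) * hg + hgb
  hL j b := by
    rw [CommDer.comp_der, Sum.swap_inr]
    simp only [CommDer.tangential_der]
    linear_combination (-g * D.der (Sum.inl j) ρ * D.der (Sum.inr m) b) * hgb
  hL' j b := by
    rw [CommDer.comp_der, CommDer.comp_der, Sum.swap_inl, Sum.swap_inl]
    simp only [CommDer.tangential_der]
    linear_combination (-gb * D.der (Sum.inr j) ρ * D.der (Sum.inl m) b) * hg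
  hZ b := by
    rw [CommDer.comp_der, Sum.swap_inl]
    simp only [CommDer.tangential_der]
    linear_combination (-D.der (Sum.inr m) b) * (gb * D.der (Sum.inl m) ρ) * hg -
      D.der (Sum.inr m) b * hgb
  hc := hgb
  hc' := hg

end CRFrame

open scoped Topology ContDiff ComplexConjugate

namespace HoloGraph

variable {N : ℕ} {Z : Type*} [NormedAddCommGroup Z] [InnerProductSpace ℝ Z] (H : HoloGraph N Z)

/-- The defining function as an element of the algebra of smooth functions. -/
noncomputable def rho : smoothAlg N :=
  ⟨fun y => (H.ρ y : ℂ), Complex.ofRealCLM.contDiff.comp H.contDiff_ρ⟩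

lemma rho_apply (y : CPt N) : (H.rho : CPt N → ℂ) y = (H.ρ y : ℂ) := rfl

lemma conjHom_rho : smoothAlg.conjHom H.rho = H.rho := by
  ext y
  rw [smoothAlg.conjHom_apply, rho_apply, Complex.conj_ofReal]

lemma conj_wz_rho (l : Fin N) (y : CPt N) : conj (wz l H.rho y) = wzb l H.rho y := by
  have h := smoothAlg.conjHom_der (Sum.inl l) H.rho
  rw [conjHom_rho] at h
  exact congrFun (congrArg Subtype.val h) y

lemma wzb_rho_ne_zero (y : CPt N) : wzb H.m H.rho y ≠ 0 := by
  intro h0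
  have h1 : wz H.m H.rho y = 0 := by
    rw [← conj_wz_rho] at h0
    simpa using h0
  have h2 := fderiv_eq_sum_wirtinger (H.rho : CPt N → ℂ) y (Pi.single H.m H.a)
  have h3 : fderiv ℝ (H.rho : CPt N → ℂ) y (Pi.single H.m H.a) = 1 := by
    have := fderiv_ofReal_apply (f := H.ρ) (q := y)
      (H.contDiff_ρ.differentiable (by simp) y) (Pi.single H.m H.a)
    rw [H.fderiv_ρ_single, Complex.ofReal_one] at this
    exact this
  rw [h3, Finset.sum_eq_single H.m] at h2
  · rw [h0, h1] at h2
    simp at h2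
  · intro l _ hl
    simp [Pi.single_eq_of_ne hl]
  · simp

/-- The inverse of the transversal derivative of the defining function. -/
noncomputable def g : smoothAlg N :=
  ⟨fun y => (wzb H.m H.rho y)⁻¹,
    (smoothAlg.contDiff ((smoothAlg.wirtinger N).der (Sum.inr H.m) H.rho)).inv
      fun y => H.wzb_rho_ne_zero y⟩

lemma g_mul : H.g * (smoothAlg.wirtinger N).der (Sum.inr H.m) H.rho = 1 := by
  ext y
  exact inv_mul_cancel₀ (H.wzb_rho_ne_zero y)

lemma conj_g_mul :
    smoothAlg.conjHom H.g * (smoothAlg.wirtinger N).der (Sum.inl H.m) H.rho = 1 := by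
  have h := congrArg smoothAlg.conjHom H.g_mul
  rwa [map_mul, smoothAlg.conjHom_der, conjHom_rho, map_one] at h

/-- The frame of the hypersurface on the algebra of smooth functions. -/
noncomputable def frame : CRFrame N (smoothAlg N) H.m :=
  CRFrame.ofDefining (smoothAlg.wirtinger N) H.rho H.g (smoothAlg.conjHom H.g) H.g_mul H.conj_g_mul

lemma frame_S_der (i : Fin N ⊕ Fin N) (u : smoothAlg N) :
    H.frame.S.der i u = (smoothAlg.wirtinger N).der i u -
      H.g * (smoothAlg.wirtinger N).der i H.rho * (smoothAlg.wirtinger N).der (Sum.inr H.m) u :=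
  CommDer.tangential_der _ _ _ _ H.g_mul _ _

lemma frame_S'_der (i : Fin N ⊕ Fin N) (u : smoothAlg N) :
    H.frame.S'.der i u = (smoothAlg.wirtinger N).der i.swap u -
      smoothAlg.conjHom H.g * (smoothAlg.wirtinger N).der i.swap H.rho *
        (smoothAlg.wirtinger N).der (Sum.inl H.m) u :=
  CommDer.tangential_der _ _ _ _ H.conj_g_mul _ _

lemma frame_c (j : Fin N) :
    H.frame.c j = smoothAlg.conjHom H.g * (smoothAlg.wirtinger N).der (Sum.inl j) H.rho := rfl

lemma frame_c' (j : Fin N) :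
    H.frame.c' j = H.g * (smoothAlg.wirtinger N).der (Sum.inr j) H.rho := rfl

lemma conjHom_S_der (i : Fin N ⊕ Fin N) (u : smoothAlg N) :
    smoothAlg.conjHom (H.frame.S.der i u) = H.frame.S'.der i (smoothAlg.conjHom u) := by
  rw [frame_S_der, frame_S'_der, map_sub, map_mul, map_mul, smoothAlg.conjHom_der,
    smoothAlg.conjHom_der, smoothAlg.conjHom_der, conjHom_rho, Sum.swap_inr]

lemma conjHom_c (j : Fin N) : smoothAlg.conjHom (H.frame.c j) = H.frame.c' j := by
  rw [frame_c, frame_c', map_mul, smoothAlg.conjHom_conjHom, smoothAlg.conjHom_der, conjHom_rho,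
    Sum.swap_inl]

/-- The ideal of the functions vanishing on the part of the hypersurface in `O`. -/
noncomputable def vanish (O : Set (CPt N)) : Ideal (smoothAlg N) where
  carrier := {u | ∀ y ∈ O, H.ρ y = 0 → (u : CPt N → ℂ) y = 0}
  zero_mem' := by
    rw [Set.mem_ofPred_eq]
    exact fun _ _ _ => rfl
  add_mem' {a b} ha hb := by
    rw [Set.mem_ofPred_eq] at *
    intro y hy h
    change (a : CPt N → ℂ) y + (b : CPt N → ℂ) y = 0
    rw [ha y hy h, hb y hy h, add_zero]
  smul_mem' c a ha := by
    rw [Set.mem_ofPred_eq] at *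
    intro y hy h
    change (c : CPt N → ℂ) y * (a : CPt N → ℂ) y = 0
    rw [ha y hy h, mul_zero]

variable {H} in
lemma exists_der_eq {O : Set (CPt N)} (hO : IsOpen O) {u : smoothAlg N} (hu : u ∈ H.vanish O)
    {q : CPt N} (hq : q ∈ O) (hρ : H.ρ q = 0) : ∃ l : ℂ, ∀ i,
      ((smoothAlg.wirtinger N).der i u : CPt N → ℂ) q =
        l * ((smoothAlg.wirtinger N).der i H.rho : CPt N → ℂ) q := by
  obtain ⟨l, hl⟩ := H.exists_fderiv_eq (smoothAlg.contDiff u) hO hu hq hρ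
  have hr : ∀ W, fderiv ℝ (H.rho : CPt N → ℂ) q W = (fderiv ℝ H.ρ q W : ℝ) := fun W =>
    fderiv_ofReal_apply (H.contDiff_ρ.differentiable (by simp) q) W
  refine ⟨l, ?_⟩
  rintro (i | i)
  · rw [smoothAlg.coe_der_inl, smoothAlg.coe_der_inl, wz, wz, hl, hl, hr, hr]
    ring
  · rw [smoothAlg.coe_der_inr, smoothAlg.coe_der_inr, wzb, wzb, hl, hl, hr, hr]
    ring

lemma S_mem_vanish {O : Set (CPt N)} (hO : IsOpen O) (i : Fin N ⊕ Fin N) (u : smoothAlg N)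
    (hu : u ∈ H.vanish O) : H.frame.S.der i u ∈ H.vanish O := by
  intro q hq hρ
  obtain ⟨l, hl⟩ := exists_der_eq hO hu hq hρ
  rw [frame_S_der]
  change ((smoothAlg.wirtinger N).der i u : CPt N → ℂ) q - (H.g : CPt N → ℂ) q *
    ((smoothAlg.wirtinger N).der i H.rho : CPt N → ℂ) q *
      ((smoothAlg.wirtinger N).der (Sum.inr H.m) u : CPt N → ℂ) q = 0
  have h1 : (H.g : CPt N → ℂ) q * ((smoothAlg.wirtinger N).der (Sum.inr H.m) H.rho : CPt N → ℂ) q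
    = 1 := congrFun (congrArg Subtype.val H.g_mul) q
  rw [hl, hl]
  linear_combination (-l * ((smoothAlg.wirtinger N).der i H.rho : CPt N → ℂ) q) * h1

lemma conjHom_mem_vanish {O : Set (CPt N)} {u : smoothAlg N} (hu : u ∈ H.vanish O) :
    smoothAlg.conjHom u ∈ H.vanish O := by
  intro q hq hρ
  rw [smoothAlg.conjHom_apply, hu q hq hρ, map_zero]

lemma S'_mem_vanish {O : Set (CPt N)} (hO : IsOpen O) (i : Fin N ⊕ Fin N) (u : smoothAlg N)
    (hu : u ∈ H.vanish O) : H.frame.S'.der i u ∈ H.vanish O := by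
  rw [← smoothAlg.conjHom_conjHom u, ← conjHom_S_der]
  exact H.conjHom_mem_vanish (H.S_mem_vanish hO i _ (H.conjHom_mem_vanish hu))

/-- A function with nonzero tangential Taylor series at `p` is nonzero at points of the
hypersurface arbitrarily close to `p`. -/
lemma exists_ne_zero_of_taylor_ne_zero {u : smoothAlg N}
    (hu : H.frame.S.taylor (smoothAlg.ev H.p) u ≠ 0) {O : Set (CPt N)} (hO : IsOpen O)
    (hp : H.p ∈ O) : ∃ q ∈ O, H.ρ q = 0 ∧ (u : CPt N → ℂ) q ≠ 0 := by
  by_contra! hcon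
  have hmem : u ∈ H.vanish O := hcon
  apply hu
  ext μ
  have hpow : ∀ μ, H.frame.S.pow μ u ∈ H.vanish O := by
    intro μ
    induction μ using CommDer.pow_induction with
    | h0 => rwa [CommDer.pow_zero]
    | h1 μ i ih =>
      rw [CommDer.pow_add_single]
      exact H.S_mem_vanish hO i _ ih
  have hρ : H.ρ H.p = 0 := by
    rw [← H.Γ_zero]
    exact H.ρ_Γ 0
  rw [CommDer.coeff_taylor, smoothAlg.ev_apply, hpow μ H.p hp hρ, zero_div, map_zero]

end HoloGraph

/-- The index set of the jets of order less than `n` of a field on `ℂ^N`. -/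
abbrev JetIndex (N n : ℕ) := {x : (Fin N →₀ ℕ) × Fin N // x.1.degree < n}

instance (N n : ℕ) : Finite (JetIndex N n) := by
  have h : Set.Finite {μ : Fin N →₀ ℕ | μ.degree < n} := by
    refine (Set.finite_Iic (Finsupp.equivFunOnFinite.symm fun _ => n)).subset ?_
    intro μ hμ i
    rw [Set.mem_ofPred_eq] at hμ
    exact (Finsupp.le_degree i μ).trans hμ.le
  have : Finite {μ : Fin N →₀ ℕ // μ.degree < n} := h
  refine Finite.of_injective (β := {μ : Fin N →₀ ℕ // μ.degree < n} × Fin N)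
    (fun x => (⟨x.1.1, x.2⟩, x.1.2)) ?_
  rintro ⟨⟨μ, i⟩, hμ⟩ ⟨⟨ν, j⟩, hν⟩ h
  simpa using h

lemma RingHom.isUnit_of_map_mul_eq_one {A B : Type*} [CommRing A] [CommRing B] (π : A →+* B)
    {v d e d' : A} (h : π (v * (d * e * d')) = 1) :
    IsUnit (π d) ∧ IsUnit (π e) ∧ IsUnit (π d') := by
  rw [map_mul] at h
  have hunit := IsUnit.of_mul_eq_one_right (π v) h
  rw [map_mul, map_mul] at hunit
  have hde := isUnit_of_mul_isUnit_left hunit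
  exact ⟨isUnit_of_mul_isUnit_left hde, isUnit_of_mul_isUnit_right hde,
    isUnit_of_mul_isUnit_right hunit⟩

lemma RingHom.map_det_of {A B n : Type*} [CommRing A] [CommRing B] [Fintype n] [DecidableEq n]
    (π : A →+* B) {f : n → n → A} {f' : n → n → B} (h : ∀ i j, f' i j = π (f i j)) :
    (Matrix.of f').det = π (Matrix.of f).det := by
  rw [RingHom.map_det]
  congr 1
  ext i j
  exact h i j

namespace CRFrame

variable {N : ℕ} {A : Type*} [CommRing A] [Algebra ℂ A] {m : Fin N} (F : CRFrame N A m)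

/-- The jet components of a field along the frame. -/
noncomputable def jetFn (X : Fin N → A) {n : ℕ} (s : JetIndex N n) : A :=
  (F.S.comp Sum.inl).pow s.1.1 (X s.1.2)

variable {F} {I : Ideal A} (hI : ∀ i, ∀ a ∈ I, F.S.der i a ∈ I)
  (hI' : ∀ i, ∀ a ∈ I, F.S'.der i a ∈ I)

lemma mk_jetFn (X : Fin N → A) {n : ℕ} (s : JetIndex N n) :
    Ideal.Quotient.mk I (F.jetFn X s) =
      ((F.quot I hI hI').S.comp Sum.inl).pow s.1.1 (Ideal.Quotient.mk I (X s.1.2)) :=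
  (CommDer.comp_quot_pow_mk _ hI _ _ _).symm

lemma jet_quot (X : Fin N → A) (n : ℕ) :
    (F.quot I hI hI').jet (fun i => Ideal.Quotient.mk I (X i)) n =
      Submodule.span _ (Set.range fun s : JetIndex N n => Ideal.Quotient.mk I (F.jetFn X s)) := by
  rw [CRFrame.jet]
  congr 1
  ext b
  rw [Set.mem_ofPred_eq]
  constructor
  · rintro ⟨μ, i, hμ, rfl⟩
    exact ⟨⟨(μ, i), hμ⟩, mk_jetFn hI hI' X _⟩
  · rintro ⟨s, rfl⟩
    exact ⟨s.1.1, s.1.2, s.2, mk_jetFn hI hI' X _⟩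

/-- Modulo an ideal modulo which the frame is finitely nondegenerate, the jets of an
infinitesimal automorphism form a closed system. -/
theorem closed_system_mod (hI : ∀ i, ∀ a ∈ I, F.S.der i a ∈ I)
    (hI' : ∀ i, ∀ a ∈ I, F.S'.der i a ∈ I) {k : ℕ} {X Y : Fin N → A}
    (hX : ∀ i j, F.S.der (Sum.inr j) (X i) ∈ I) (hY : ∀ i j, F.S'.der (Sum.inr j) (Y i) ∈ I)
    (hXY : ∑ i, F.c i * X i - F.κ * ∑ i, F.c' i * Y i ∈ I)
    (t : Fin N → Fin N →₀ ℕ) (ht : ∀ a, (t a).degree ≤ k) (i₀ j₀ : Fin N) {v : A}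
    (hv : v * ((Matrix.of fun a i => (F.S.comp Sum.inr).pow (t a) (F.c i)).det *
      F.S.der (Sum.inr i₀) (F.c j₀) *
      (Matrix.of fun a i => (F.S'.comp Sum.inr).pow (t a) (F.c' i)).det) - 1 ∈ I)
    (j : Fin N) (s : JetIndex N (2 * k + 1)) :
    F.S.der (Sum.inr j) (F.jetFn X s) ∈ I ∧ ∃ a : JetIndex N (2 * k + 1) → A,
      ∑ᶠ s', a s' * F.jetFn X s' - F.S.der (Sum.inl j) (F.jetFn X s) ∈ I := by
  set π := Ideal.Quotient.mk I with hπ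
  obtain ⟨hdu, heu, hdu'⟩ := RingHom.isUnit_of_map_mul_eq_one π
    ((Ideal.Quotient.eq.2 hv).trans (map_one π))
  set Q := F.quot I hI hI' with hQ
  have hX' : ∀ i j, Q.S.der (Sum.inr j) (π (X i)) = 0 := fun i j =>
    (CommDer.quot_mk _ hI _ _).trans (Ideal.Quotient.eq_zero_iff_mem.2 (hX i j))
  have hY' : ∀ i j, Q.S'.der (Sum.inr j) (π (Y i)) = 0 := fun i j =>
    (CommDer.quot_mk _ hI' _ _).trans (Ideal.Quotient.eq_zero_iff_mem.2 (hY i j))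
  have hXY' : ∑ i, Q.c i * π (X i) = Q.κ * ∑ i, Q.c' i * π (Y i) := by
    change ∑ i, π (F.c i) * π (X i) = π F.κ * ∑ i, π (F.c' i) * π (Y i)
    simp only [← map_mul, ← map_sum]
    exact Ideal.Quotient.eq.2 hXY
  have hdet : IsUnit (Matrix.of fun a i => (Q.S.comp Sum.inr).pow (t a) (Q.c i)).det := by
    rw [RingHom.map_det_of π (f := fun a i => (F.S.comp Sum.inr).pow (t a) (F.c i))
      (f' := fun a i => (Q.S.comp Sum.inr).pow (t a) (Q.c i))
      fun a i => CommDer.comp_quot_pow_mk F.S hI _ _ _]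
    exact hdu
  have hdet' : IsUnit (Matrix.of fun a i => (Q.S'.comp Sum.inr).pow (t a) (Q.c' i)).det := by
    rw [RingHom.map_det_of π (f := fun a i => (F.S'.comp Sum.inr).pow (t a) (F.c' i))
      (f' := fun a i => (Q.S'.comp Sum.inr).pow (t a) (Q.c' i))
      fun a i => CommDer.comp_quot_pow_mk F.S' hI' _ _ _]
    exact hdu'
  have heu' : IsUnit (Q.S.der (Sum.inr i₀) (Q.c j₀)) := by
    have : Q.S.der (Sum.inr i₀) (Q.c j₀) = π (F.S.der (Sum.inr i₀) (F.c j₀)) :=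
      CommDer.quot_mk _ hI _ _
    rw [this]
    exact heu
  have hmem : π (F.jetFn X s) ∈ Q.jet (fun i => π (X i)) (2 * k + 1) := by
    rw [jet_quot]
    exact Submodule.subset_span ⟨s, rfl⟩
  constructor
  · have h0 := CRFrame.inr_pow_eq_zero (F := Q) (X := fun i => π (X i)) hX' j s.1.2 s.1.1
    rw [hQ, ← mk_jetFn hI hI' X s] at h0
    rw [← Ideal.Quotient.eq_zero_iff_mem, ← h0]
    exact (CommDer.quot_mk _ hI _ _).symm
  · have h1 := CRFrame.inl_mem_jet_of_nondegenerate (F := Q) hX' hY' hXY' t ht hdet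
      hdet' i₀ j₀ heu' j hmem
    have := Fintype.ofFinite (JetIndex N (2 * k + 1))
    rw [hQ, jet_quot, Submodule.mem_span_range_iff_exists_fun] at h1
    obtain ⟨b, hb⟩ := h1
    choose a ha using fun s' => Ideal.Quotient.mk_surjective (b s')
    refine ⟨a, ?_⟩
    rw [finsum_eq_sum_of_fintype, ← Ideal.Quotient.eq, map_sum]
    refine Eq.trans ?_ (hb.trans (CommDer.quot_mk _ hI _ _))
    refine Finset.sum_congr rfl fun s' _ => ?_
    rw [map_mul, smul_eq_mul, ← ha]

end CRFrame

namespace HoloGraph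

variable {N : ℕ} {Z : Type*} [NormedAddCommGroup Z] [InnerProductSpace ℝ Z] (H : HoloGraph N Z)

lemma not_exists_formal {M : Set (CPt N)} (hnd : ¬ HoloDegenerateAt N M H.p) {O : Set (CPt N)}
    (hO : IsOpen O) (hp : H.p ∈ O) (hM : ∀ y ∈ O, y ∈ M ↔ H.ρ y = 0) :
    ¬ ∃ a : Fin N → MvPowerSeries (Fin N) ℂ, (∃ j, a j ≠ 0) ∧
      (smoothAlg.wirtinger N).taylor (smoothAlg.ev H.p) H.rho ∣ ∑ j, embZ (a j) *
        (smoothAlg.wirtinger N).taylor (smoothAlg.ev H.p)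
          ((smoothAlg.wirtinger N).der (Sum.inl j) H.rho) := by
  rintro ⟨a, ha, hdvd⟩
  refine hnd ⟨O, H.ρ, ⟨hO, hp, H.contDiff_ρ.contDiffOn, ?_, fun z _ => H.fderiv_ρ_ne_zero z⟩,
    a, ha, ?_⟩
  · ext y
    rw [Set.mem_ofPred_eq]
    exact ⟨fun h => ⟨h.2, (hM y h.2).1 h.1⟩, fun h => ⟨(hM y h.1).2 h.2, h.1⟩⟩
  · simp only [← smoothAlg.cTaylor_eq, smoothAlg.coe_der_inl] at hdvd
    exact hdvd

/-- Arbitrarily close to the base point there are points of the hypersurface near which the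
jets of order at most `2 (N - 1)` of an infinitesimal automorphism form a closed system. -/
theorem exists_closed_system (hN : 2 ≤ N) {M : Set (CPt N)} (hnd : ¬ HoloDegenerateAt N M H.p)
    {O : Set (CPt N)} (hO : IsOpen O) (hp : H.p ∈ O) (hM : ∀ y ∈ O, y ∈ M ↔ H.ρ y = 0)
    {O₁ : Set (CPt N)} (hO₁ : IsOpen O₁) (hp₁ : H.p ∈ O₁) :
    ∃ q ∈ O₁, H.ρ q = 0 ∧ ∃ O₂ : Set (CPt N), IsOpen O₂ ∧ q ∈ O₂ ∧ O₂ ⊆ O₁ ∧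
      ∀ X : Fin N → smoothAlg N,
        (∀ i j, H.frame.S.der (Sum.inr j) (X i) ∈ H.vanish O₂) →
        (∑ i, ((smoothAlg.wirtinger N).der (Sum.inl i) H.rho * X i +
          (smoothAlg.wirtinger N).der (Sum.inr i) H.rho * smoothAlg.conjHom (X i)) ∈
            H.vanish O₂) →
        ∀ (j : Fin N) (s : JetIndex N (2 * (N - 1) + 1)),
          H.frame.S.der (Sum.inr j) (H.frame.jetFn X s) ∈ H.vanish O₂ ∧
          ∃ a : JetIndex N (2 * (N - 1) + 1) → smoothAlg N,
            ∀ y ∈ O₂, H.ρ y = 0 → (H.frame.S.der (Sum.inl j) (H.frame.jetFn X s) : CPt N → ℂ) y =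
              ∑ᶠ s', (a s' : CPt N → ℂ) y * (H.frame.jetFn X s' : CPt N → ℂ) y := by
  obtain ⟨t, i₀, j₀, ht, htay⟩ := CommDer.exists_generic_nondegenerate hN (smoothAlg.wirtinger N)
    (smoothAlg.ev H.p) H.rho H.g (smoothAlg.conjHom H.g) H.m H.g_mul H.conj_g_mul
    (by
      rw [smoothAlg.ev_apply, rho_apply, ← H.Γ_zero, H.ρ_Γ, Complex.ofReal_zero])
    (H.not_exists_formal hnd hO hp hM)
  set d : smoothAlg N :=
    (Matrix.of fun a i => (H.frame.S.comp Sum.inr).pow (t a) (H.frame.c i)).det with hd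
  set e : smoothAlg N := H.frame.S.der (Sum.inr i₀) (H.frame.c j₀) with he
  obtain ⟨q, hq, hρq, hqne⟩ := H.exists_ne_zero_of_taylor_ne_zero (u := d * e) htay hO₁ hp₁
  obtain ⟨v, O₂, hO₂, hqO₂, hv⟩ := smoothAlg.exists_local_inverse (d * e * smoothAlg.conjHom d)
    (q := q) (by
      change (d : CPt N → ℂ) q * (e : CPt N → ℂ) q * conj ((d : CPt N → ℂ) q) ≠ 0
      change (d : CPt N → ℂ) q * (e : CPt N → ℂ) q ≠ 0 at hqne
      refine mul_ne_zero hqne ?_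
      rw [ne_eq, map_eq_zero]
      exact left_ne_zero_of_mul hqne)
  refine ⟨q, hq, hρq, O₂ ∩ O₁, hO₂.inter hO₁, ⟨hqO₂, hq⟩, Set.inter_subset_right, ?_⟩
  intro X hX hXY j s
  have hOO := hO₂.inter hO₁
  have hXY' : ∑ i, H.frame.c i * X i -
      H.frame.κ * ∑ i, H.frame.c' i * smoothAlg.conjHom (X i) ∈ H.vanish (O₂ ∩ O₁) := by
    have : ∑ i, H.frame.c i * X i -
        H.frame.κ * ∑ i, H.frame.c' i * smoothAlg.conjHom (X i) = smoothAlg.conjHom H.g *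
        ∑ i, ((smoothAlg.wirtinger N).der (Sum.inl i) H.rho * X i +
          (smoothAlg.wirtinger N).der (Sum.inr i) H.rho * smoothAlg.conjHom (X i)) := by
      have hκ : H.frame.κ = -(smoothAlg.conjHom H.g *
        (smoothAlg.wirtinger N).der (Sum.inr H.m) H.rho) := rfl
      rw [Finset.mul_sum, Finset.mul_sum, ← Finset.sum_sub_distrib]
      refine Finset.sum_congr rfl fun i _ => ?_
      rw [hκ, frame_c, frame_c']
      linear_combination (smoothAlg.conjHom H.g * (smoothAlg.wirtinger N).der (Sum.inr i) H.rho *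
        smoothAlg.conjHom (X i)) * H.g_mul
    rw [this]
    exact Ideal.mul_mem_left _ _ hXY
  have hdet : (Matrix.of fun a i => (H.frame.S'.comp Sum.inr).pow (t a) (H.frame.c' i)).det =
      smoothAlg.conjHom d := by
    refine RingHom.map_det_of smoothAlg.conjHom fun a i => ?_
    rw [← conjHom_c]
    exact (CommDer.map_pow (H.frame.S.comp Sum.inr) (H.frame.S'.comp Sum.inr)
      smoothAlg.conjHom (fun i a => H.conjHom_S_der _ _) _ _).symm
  obtain ⟨h1, a, ha⟩ := CRFrame.closed_system_mod (F := H.frame) (I := H.vanish (O₂ ∩ O₁))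
    (H.S_mem_vanish hOO) (H.S'_mem_vanish hOO) (Y := fun i => smoothAlg.conjHom (X i)) hX
    (fun i j => by
      rw [← conjHom_S_der]
      exact H.conjHom_mem_vanish (hX i j)) hXY' t ht i₀ j₀ (v := v)
    (by
      rw [hdet]
      intro y hy _
      change (v : CPt N → ℂ) y *
        ((d * e * smoothAlg.conjHom d : smoothAlg N) : CPt N → ℂ) y - 1 = 0
      rw [hv y hy.1, sub_self]) j s
  refine ⟨h1, a, fun y hy hρ => ?_⟩
  have := Fintype.ofFinite (JetIndex N (2 * (N - 1) + 1))
  rw [finsum_eq_sum_of_fintype] at ha ⊢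
  have h3 := ha y hy hρ
  rw [← smoothAlg.ev_apply, map_sub, map_sum, sub_eq_zero] at h3
  simp only [map_mul, smoothAlg.ev_apply] at h3
  exact h3.symm

end HoloGraph

/-- A solution of a linear homogeneous system which vanishes at `0` vanishes at `1`. -/
lemma eq_zero_of_linear_system {J : Type*} [Fintype J] {F : ℝ → J → ℂ} {C : J → J → ℝ → ℂ}
    (hC : ∀ s s', Continuous (C s s'))
    (hF : ∀ t ∈ Set.Icc (0 : ℝ) 1, ∀ s,
      HasDerivAt (fun t => F t s) (∑ s', C s s' t * F t s') t)
    (h0 : F 0 = 0) : F 1 = 0 := by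
  have hbd : ∃ K : ℝ, ∀ t ∈ Set.Icc (0 : ℝ) 1, ∀ s s', ‖C s s' t‖ ≤ K := by
    choose K hK using fun x : J × J => isCompact_Icc.exists_bound_of_continuousOn
      (s := Set.Icc (0 : ℝ) 1) (hC x.1 x.2).continuousOn
    refine ⟨∑ x, |K x|, fun t ht s s' => ?_⟩
    refine (hK (s, s') t ht).trans ((le_abs_self _).trans ?_)
    exact Finset.single_le_sum (f := fun x => |K x|) (fun x _ => abs_nonneg _) (Finset.mem_univ _)
  obtain ⟨K, hK⟩ := hbd
  have hF' : ∀ t ∈ Set.Icc (0 : ℝ) 1, HasDerivAt F (fun s => ∑ s', C s s' t * F t s') t :=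
    fun t ht => hasDerivAt_pi.2 fun s => hF t ht s
  have hgr := norm_le_gronwallBound_of_norm_deriv_right_le (f := F)
    (f' := fun t s => ∑ s', C s s' t * F t s') (δ := 0) (K := |Fintype.card J * K|) (ε := 0)
    (a := 0) (b := 1)
    (fun t ht => (hF' t ht).continuousAt.continuousWithinAt)
    (fun t ht => (hF' t ⟨ht.1, ht.2.le⟩).hasDerivWithinAt)
    (by simp [h0])
    (fun t ht => by
      rw [add_zero]
      refine (pi_norm_le_iff_of_nonneg (by positivity)).2 fun s => ?_
      refine (norm_sum_le _ _).trans ?_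
      calc ∑ s', ‖C s s' t * F t s'‖ ≤ ∑ _s' : J, K * ‖F t‖ := by
            refine Finset.sum_le_sum fun s' _ => ?_
            rw [norm_mul]
            have h1 := hK t ⟨ht.1, ht.2.le⟩ s s'
            have h2 := norm_le_pi_norm (F t) s'
            have h3 := norm_nonneg (C s s' t)
            exact mul_le_mul h1 h2 (norm_nonneg _) (h3.trans h1)
        _ = Fintype.card J * K * ‖F t‖ := by
            rw [Finset.sum_const, Finset.card_univ, nsmul_eq_mul, mul_assoc]
        _ ≤ |Fintype.card J * K| * ‖F t‖ := by
            gcongr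
            exact le_abs_self _)
    1 ⟨zero_le_one, le_rfl⟩
  rw [gronwallBound_ε0_δ0] at hgr
  exact norm_le_zero_iff.1 hgr

namespace HoloGraph

variable {N : ℕ} {Z : Type*} [NormedAddCommGroup Z] [InnerProductSpace ℝ Z] (H : HoloGraph N Z)

/-- Derivatives along the hypersurface in terms of the frame. -/
lemma fderiv_eq_sum_frame (u : smoothAlg N) {y W : CPt N} (hW : fderiv ℝ H.ρ y W = 0) :
    fderiv ℝ (u : CPt N → ℂ) y W =
      ∑ l, (W l * (H.frame.S.der (Sum.inl l) u : CPt N → ℂ) y +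
        conj (W l) * (H.frame.S.der (Sum.inr l) u : CPt N → ℂ) y) := by
  have h1 := fderiv_eq_sum_wirtinger (u : CPt N → ℂ) y W
  have h2 := fderiv_eq_sum_wirtinger (H.rho : CPt N → ℂ) y W
  have h3 : fderiv ℝ (H.rho : CPt N → ℂ) y W = (fderiv ℝ H.ρ y W : ℝ) :=
    fderiv_ofReal_apply (H.contDiff_ρ.differentiable (by simp) y) W
  rw [h3, hW, Complex.ofReal_zero] at h2
  have h4 : ∀ i, (H.frame.S.der i u : CPt N → ℂ) y =
      ((smoothAlg.wirtinger N).der i u : CPt N → ℂ) y - (H.g : CPt N → ℂ) y *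
      ((smoothAlg.wirtinger N).der i H.rho : CPt N → ℂ) y * wzb H.m (u : CPt N → ℂ) y := fun i => by
    rw [frame_S_der]
    rfl
  simp only [h4, smoothAlg.coe_der_inl, smoothAlg.coe_der_inr]
  rw [h1]
  have h5 : ∀ l, W l * (wz l (u : CPt N → ℂ) y - (H.g : CPt N → ℂ) y *
        wz l (H.rho : CPt N → ℂ) y * wzb H.m (u : CPt N → ℂ) y) +
      conj (W l) * (wzb l (u : CPt N → ℂ) y - (H.g : CPt N → ℂ) y *
        wzb l (H.rho : CPt N → ℂ) y * wzb H.m (u : CPt N → ℂ) y) =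
      (W l * wz l (u : CPt N → ℂ) y + conj (W l) * wzb l (u : CPt N → ℂ) y) -
      (W l * wz l (H.rho : CPt N → ℂ) y + conj (W l) * wzb l (H.rho : CPt N → ℂ) y) *
        ((H.g : CPt N → ℂ) y * wzb H.m (u : CPt N → ℂ) y) := fun l => by ring
  rw [Finset.sum_congr rfl fun l _ => h5 l, Finset.sum_sub_distrib, ← Finset.sum_mul, ← h2]
  ring

/-- A field whose jets form a closed system and vanish at a point vanishes near that point. -/
lemma eventually_eq_zero_of_jet {O : Set (CPt N)} (hO : IsOpen O) {q : CPt N} (hq : q ∈ O)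
    (hρ : H.ρ q = 0) {X : Fin N → smoothAlg N} {n : ℕ}
    (hsys : ∀ (j : Fin N) (s : JetIndex N (n + 1)),
      H.frame.S.der (Sum.inr j) (H.frame.jetFn X s) ∈ H.vanish O ∧
      ∃ a : JetIndex N (n + 1) → smoothAlg N, ∀ y ∈ O, H.ρ y = 0 →
        (H.frame.S.der (Sum.inl j) (H.frame.jetFn X s) : CPt N → ℂ) y =
          ∑ᶠ s', (a s' : CPt N → ℂ) y * (H.frame.jetFn X s' : CPt N → ℂ) y)
    (h0 : ∀ s : JetIndex N (n + 1), (H.frame.jetFn X s : CPt N → ℂ) q = 0) :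
    ∀ᶠ x in 𝓝 (H.proj q), ∀ i, (X i : CPt N → ℂ) (H.Γ x) = 0 := by
  have := Fintype.ofFinite (JetIndex N (n + 1))
  simp only [finsum_eq_sum_of_fintype] at hsys
  have hzero : ∀ j s, H.frame.S.der (Sum.inr j) (H.frame.jetFn X s) ∈ H.vanish O :=
    fun j s => (hsys j s).1
  choose a ha using fun j s => (hsys j s).2
  have hΓq : H.Γ (H.proj q) = q := H.Γ_proj hρ
  have hmem : H.Γ ⁻¹' O ∈ 𝓝 (H.proj q) :=
    (hO.preimage H.contDiff_Γ.continuous).mem_nhds (by rwa [Set.mem_preimage, hΓq])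
  obtain ⟨r, hr, hball⟩ := Metric.mem_nhds_iff.1 hmem
  filter_upwards [Metric.ball_mem_nhds _ hr] with x hx i
  set γ : ℝ → Z × ℝ := fun t => H.proj q + t • (x - H.proj q) with hγ
  have hγc : Continuous γ := by fun_prop
  have hγd : ∀ t, HasDerivAt γ (x - H.proj q) t := fun t => by
    have := ((hasDerivAt_id t).smul_const (x - H.proj q)).const_add (H.proj q)
    rw [one_smul] at this
    exact this
  have hγmem : ∀ t ∈ Set.Icc (0 : ℝ) 1, H.Γ (γ t) ∈ O := fun t ht => by
    apply hball
    rw [Metric.mem_ball, dist_eq_norm] at hx ⊢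
    have : γ t - H.proj q = t • (x - H.proj q) := by simp [hγ]
    rw [this, norm_smul, Real.norm_of_nonneg ht.1]
    exact (mul_le_of_le_one_left (norm_nonneg _) ht.2).trans_lt hx
  set W : ℝ → CPt N := fun t => fderiv ℝ H.Γ (γ t) (x - H.proj q) with hW
  have hWc : Continuous W :=
    ((H.contDiff_Γ.continuous_fderiv (by simp)).comp hγc).clm_apply continuous_const
  have hfin := eq_zero_of_linear_system
    (F := fun t s => (H.frame.jetFn X s : CPt N → ℂ) (H.Γ (γ t)))
    (C := fun s s' t => ∑ l, W t l * (a l s s' : CPt N → ℂ) (H.Γ (γ t)))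
    (fun s s' => by
      refine continuous_finsetSum _ fun l _ => ?_
      exact ((continuous_apply l).comp hWc).mul ((smoothAlg.contDiff (a l s s')).continuous.comp
        (H.contDiff_Γ.continuous.comp hγc)))
    (fun t ht s => by
      have hd : HasDerivAt (fun t => (H.frame.jetFn X s : CPt N → ℂ) (H.Γ (γ t)))
          (fderiv ℝ (H.frame.jetFn X s : CPt N → ℂ) (H.Γ (γ t)) (W t)) t :=
        (smoothAlg.differentiableAt _ _).hasFDerivAt.comp_hasDerivAt t
          ((H.contDiff_Γ.differentiable (by simp) _).hasFDerivAt.comp_hasDerivAt t (hγd t))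
      convert hd using 1
      rw [H.fderiv_eq_sum_frame _ (H.fderiv_ρ_fderiv_Γ _ _)]
      simp only [Finset.sum_mul]
      rw [Finset.sum_comm]
      refine Finset.sum_congr rfl fun l _ => ?_
      rw [hzero l s _ (hγmem t ht) (H.ρ_Γ _), mul_zero, add_zero,
        ha l s _ (hγmem t ht) (H.ρ_Γ _), Finset.mul_sum]
      exact Finset.sum_congr rfl fun s' _ => mul_assoc _ _ _)
    (by
      ext s
      change (H.frame.jetFn X s : CPt N → ℂ) (H.Γ (γ 0)) = 0
      have : γ 0 = H.proj q := by simp [hγ]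
      rw [this, hΓq, h0])
  have h1 : γ 1 = x := by simp [hγ]
  have h2 := congrFun hfin ⟨(0, i), by simp⟩
  simpa [h1, CRFrame.jetFn] using h2

end HoloGraph

/-- The differential of the flow of a `C¹` vector field `X` at a point `q` is
`id + t • DX(q) + o(t)`. -/
theorem exists_norm_fderiv_flow_sub_le {E : Type*} [NormedAddCommGroup E] [NormedSpace ℝ E]
    {X : E → E} {W : Set E} {q : E} {φ : ℝ → E → E} {ε : ℝ}
    (hW : IsOpen W) (hq : q ∈ W) (hX : ContDiffOn ℝ 1 X W) (hε : 0 < ε)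
    (h0 : ∀ z ∈ W, φ 0 z = z)
    (hφ : ∀ t : ℝ, |t| < ε → ∀ z ∈ W, HasDerivAt (fun s => φ s z) (X (φ t z)) t)
    (hd : ∀ t : ℝ, |t| < ε → DifferentiableAt ℝ (φ t) q) {η : ℝ} (hη : 0 < η) :
    ∃ t, 0 < t ∧ t < ε ∧
      ‖fderiv ℝ (φ t) q - ContinuousLinearMap.id ℝ E - t • fderiv ℝ X q‖ ≤ η * t := by
  set A := fderiv ℝ X q with hA
  have hcont : ContinuousAt (fderiv ℝ X) q :=
    (hX.continuousOn_fderiv_of_isOpen hW le_rfl).continuousAt (hW.mem_nhds hq)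
  obtain ⟨r, hr, hball⟩ : ∃ r > 0, Metric.ball q r ⊆ {y | ‖fderiv ℝ X y - A‖ ≤ η / 6} ∩ W := by
    refine Metric.mem_nhds_iff.1 (Filter.inter_mem ?_ (hW.mem_nhds hq))
    have := hcont.eventually (Metric.closedBall_mem_nhds A (show 0 < η / 6 by positivity))
    filter_upwards [this] with y hy
    rwa [dist_eq_norm] at hy
  have hB : ∀ u ∈ Metric.ball q r, ∀ v ∈ Metric.ball q r,
      ‖X u - X v - A (u - v)‖ ≤ η / 6 * ‖u - v‖ := fun u hu v hv => by
    refine (convex_ball q r).norm_image_sub_le_of_norm_hasFDerivWithin_le' (f' := fderiv ℝ X)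
      (fun y hy => ?_) (fun y hy => (hball hy).1) hv hu
    exact ((hX.differentiableOn one_ne_zero).differentiableAt
      (hW.mem_nhds (hball hy).2)).hasFDerivAt.hasFDerivWithinAt
  set K : ℝ := ‖A‖ + η / 6 with hK
  have hK0 : 0 < K := by positivity
  have hlip : ∀ u ∈ Metric.ball q r, ∀ v ∈ Metric.ball q r, ‖X u - X v‖ ≤ K * ‖u - v‖ :=
    fun u hu v hv => by
    have h1 := hB u hu v hv
    have h2 := A.le_opNorm (u - v)
    have h3 : ‖X u - X v‖ ≤ ‖X u - X v - A (u - v)‖ + ‖A (u - v)‖ := by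
      simpa using norm_add_le (X u - X v - A (u - v)) (A (u - v))
    rw [hK, add_mul]
    linarith
  set C : ℝ := ‖X q‖ + K * r with hC
  have hC0 : 0 < C := by positivity
  have hqr : q ∈ Metric.ball q r := Metric.mem_ball_self hr
  have hXC : ∀ u ∈ Metric.ball q r, ‖X u‖ ≤ C := fun u hu => by
    have h1 := hlip u hu q hqr
    have h2 : ‖X u‖ ≤ ‖X u - X q‖ + ‖X q‖ := by simpa using norm_add_le (X u - X q) (X q)
    rw [Metric.mem_ball, dist_eq_norm] at hu
    have := mul_le_mul_of_nonneg_left hu.le hK0.le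
    rw [hC]
    linarith
  obtain ⟨T, hT0, hTε, hTC, hTK, hTη⟩ : ∃ T : ℝ, 0 < T ∧ T < ε ∧ (C + 1) * T < r / 2 ∧
      K * T ≤ 1 ∧ K * K * T ≤ η / 6 := by
    have hlim : ∀ c : ℝ, Filter.Tendsto (fun T : ℝ => c * T) (𝓝[>] 0) (𝓝 0) := fun c => by
      have : Filter.Tendsto (fun T : ℝ => c * T) (𝓝 0) (𝓝 (c * 0)) :=
        (continuous_const.mul continuous_id).tendsto 0
      rw [mul_zero] at this
      exact this.mono_left nhdsWithin_le_nhds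
    have h1 := (hlim (C + 1)).eventually (gt_mem_nhds (show 0 < r / 2 by positivity))
    have h2 := (hlim K).eventually (ge_mem_nhds (show (0 : ℝ) < 1 by norm_num))
    have h3 := (hlim (K * K)).eventually (ge_mem_nhds (show 0 < η / 6 by positivity))
    have h4 := (hlim 1).eventually (gt_mem_nhds hε)
    obtain ⟨T, g1, g2, g3, g4, g5⟩ :=
      (h1.and (h2.and (h3.and (h4.and self_mem_nhdsWithin)))).exists
    exact ⟨T, g5, by simpa using g4, g1, g2, g3⟩
  have habs : ∀ s ∈ Set.Icc (0 : ℝ) T, |s| < ε := fun s hs => by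
    rw [abs_of_nonneg hs.1]; linarith [hs.2]
  have hhalf : ∀ z ∈ Metric.ball q (r / 2), z ∈ W := fun z hz =>
    (hball (Metric.ball_subset_ball (by linarith) hz)).2
  have hcts : ∀ z ∈ W, ContinuousOn (fun s => φ s z) (Set.Icc 0 T) := fun z hz s hs =>
    (hφ s (habs s hs) z hz).continuousAt.continuousWithinAt
  have hconf : ∀ z ∈ Metric.ball q (r / 2), ∀ s ∈ Set.Icc (0 : ℝ) T,
      φ s z ∈ Metric.ball q r := by
    intro z hz
    have hzW := hhalf z hz
    have hbd : ∀ s ∈ Set.Icc (0 : ℝ) T, ‖z - q‖ + (C + 1) * s < r := fun s hs => by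
      rw [Metric.mem_ball, dist_eq_norm] at hz
      nlinarith [mul_le_mul_of_nonneg_left hs.2 (show 0 ≤ C + 1 by positivity)]
    have key := image_norm_le_of_norm_deriv_right_lt_deriv_boundary
      (f := fun s => φ s z - q) (f' := fun s => X (φ s z)) (a := 0) (b := T)
      (B := fun s => ‖z - q‖ + (C + 1) * s) (B' := fun _ => C + 1)
      ((hcts z hzW).sub continuousOn_const)
      (fun s hs => ((hφ s (habs s ⟨hs.1, hs.2.le⟩) z hzW).sub_const q).hasDerivWithinAt)
      (by simp [h0 z hzW])
      (fun s => by
        have := ((hasDerivAt_id s).const_mul (C + 1)).const_add ‖z - q‖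
        rw [mul_one] at this
        exact this)
      (fun s hs hs' => by
        have : φ s z ∈ Metric.ball q r := by
          rw [Metric.mem_ball, dist_eq_norm, hs']
          exact hbd s ⟨hs.1, hs.2.le⟩
        exact (hXC _ this).trans_lt (by linarith))
    intro s hs
    rw [Metric.mem_ball, dist_eq_norm]
    exact (key hs).trans_lt (hbd s hs)
  have hq2 : q ∈ Metric.ball q (r / 2) := Metric.mem_ball_self (by positivity)
  have hmain : ∀ z ∈ Metric.ball q (r / 2),
      ‖(φ T z - z - T • A z) - (φ T q - q - T • A q)‖ ≤ η * T * ‖z - q‖ := by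
    intro z hz
    have hzW := hhalf z hz
    set d : ℝ → E := fun s => φ s z - φ s q with hdd
    have hd0 : d 0 = z - q := by simp [hdd, h0 z hzW, h0 q hq]
    have hdd' : ∀ s ∈ Set.Icc (0 : ℝ) T, HasDerivAt d (X (φ s z) - X (φ s q)) s := fun s hs =>
      (hφ s (habs s hs) z hzW).sub (hφ s (habs s hs) q hq)
    have hdc : ContinuousOn d (Set.Icc 0 T) := (hcts z hzW).sub (hcts q hq)
    have hd3 : ∀ s ∈ Set.Icc (0 : ℝ) T, ‖d s‖ ≤ 3 * ‖z - q‖ := fun s hs => by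
      have := norm_le_gronwallBound_of_norm_deriv_right_le (f := d)
        (f' := fun s => X (φ s z) - X (φ s q)) (δ := ‖z - q‖) (K := K) (ε := 0) (a := 0) (b := T)
        hdc (fun s hs => (hdd' s ⟨hs.1, hs.2.le⟩).hasDerivWithinAt) (by rw [hd0])
        (fun s hs => by
          rw [add_zero]
          exact hlip _ (hconf z hz s ⟨hs.1, hs.2.le⟩) _ (hconf q hq2 s ⟨hs.1, hs.2.le⟩)) s hs
      rw [gronwallBound_ε0, sub_zero] at this
      have h3 : Real.exp (K * s) ≤ 3 := by
        refine (Real.exp_le_exp.2 (show K * s ≤ 1 from ?_)).trans Real.exp_one_lt_three.le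
        exact (mul_le_mul_of_nonneg_left hs.2 hK0.le).trans hTK
      nlinarith [norm_nonneg (z - q)]
    have hder : ∀ s ∈ Set.Icc (0 : ℝ) T, ‖X (φ s z) - X (φ s q)‖ ≤ K * (3 * ‖z - q‖) :=
      fun s hs => (hlip _ (hconf z hz s hs) _ (hconf q hq2 s hs)).trans
        (mul_le_mul_of_nonneg_left (hd3 s hs) hK0.le)
    have hinc : ∀ s ∈ Set.Icc (0 : ℝ) T, ‖d s - d 0‖ ≤ K * (3 * ‖z - q‖) * s := fun s hs => by
      have := norm_image_sub_le_of_norm_deriv_right_le_segment hdc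
        (fun s hs => (hdd' s ⟨hs.1, hs.2.le⟩).hasDerivWithinAt)
        (fun s hs => hder s ⟨hs.1, hs.2.le⟩) s hs
      rwa [sub_zero] at this
    have hfin := norm_image_sub_le_of_norm_deriv_right_le_segment
      (f := fun s => d s - s • A (z - q)) (f' := fun s => X (φ s z) - X (φ s q) - A (z - q))
      (a := 0) (b := T) (C := η * ‖z - q‖)
      (hdc.sub (by fun_prop))
      (fun s hs => by
        have := (hdd' s ⟨hs.1, hs.2.le⟩).fun_sub ((hasDerivAt_id s).smul_const (A (z - q)))
        rw [one_smul] at this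
        exact this.hasDerivWithinAt)
      (fun s hs => by
        have hs' : s ∈ Set.Icc (0 : ℝ) T := ⟨hs.1, hs.2.le⟩
        have h1 := hB _ (hconf z hz s hs') _ (hconf q hq2 s hs')
        have h2 := hd3 s hs'
        have h3 := hinc s hs'
        have h4 := A.le_opNorm (d s - d 0)
        have e : X (φ s z) - X (φ s q) - A (z - q) =
            (X (φ s z) - X (φ s q) - A (φ s z - φ s q)) + A (d s - d 0) := by
          rw [hd0]; simp only [hdd, map_sub]; abel
        rw [e]
        refine (norm_add_le _ _).trans ?_
        have h5 : ‖A‖ * ‖d s - d 0‖ ≤ K * (K * (3 * ‖z - q‖) * T) := by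
          refine mul_le_mul (by rw [hK]; linarith) (h3.trans ?_) (norm_nonneg _) hK0.le
          exact mul_le_mul_of_nonneg_left hs'.2 (by positivity)
        have h6 : η / 6 * ‖φ s z - φ s q‖ ≤ η / 6 * (3 * ‖z - q‖) :=
          mul_le_mul_of_nonneg_left h2 (by positivity)
        have h7 : K * K * T * (3 * ‖z - q‖) ≤ η / 6 * (3 * ‖z - q‖) :=
          mul_le_mul_of_nonneg_right hTη (by positivity)
        linarith) T ⟨hT0.le, le_rfl⟩
    have e : (φ T z - z - T • A z) - (φ T q - q - T • A q) =
        (d T - T • A (z - q)) - (d 0 - (0 : ℝ) • A (z - q)) := by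
      rw [hd0]; simp only [hdd, map_sub, smul_sub, zero_smul, sub_zero]; abel
    rw [e]
    refine hfin.trans (le_of_eq (by ring))
  refine ⟨T, hT0, hTε, ?_⟩
  have hfd : HasFDerivAt (fun z => φ T z - z - T • A z)
      (fderiv ℝ (φ T) q - ContinuousLinearMap.id ℝ E - T • A) q :=
    ((hd T (habs T ⟨hT0.le, le_rfl⟩)).hasFDerivAt.fun_sub (hasFDerivAt_id q)).fun_sub
      (A.hasFDerivAt.fun_const_smul T)
  refine hfd.le_of_lip' (by positivity) ?_
  filter_upwards [Metric.ball_mem_nhds q (show 0 < r / 2 by positivity)] with z hz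
  exact hmain z hz

/-- A linear condition on differentials which holds for the identity and for all small time flow
maps holds for the differential of the vector field. -/
theorem clm_fderiv_eq_zero_of_flow {E : Type*} [NormedAddCommGroup E] [NormedSpace ℝ E]
    {X : E → E} {W : Set E} {q : E} {φ : ℝ → E → E} {ε : ℝ}
    (hW : IsOpen W) (hq : q ∈ W) (hX : ContDiffOn ℝ 1 X W) (hε : 0 < ε)
    (h0 : ∀ z ∈ W, φ 0 z = z)
    (hφ : ∀ t : ℝ, |t| < ε → ∀ z ∈ W, HasDerivAt (fun s => φ s z) (X (φ t z)) t)
    (hd : ∀ t : ℝ, |t| < ε → DifferentiableAt ℝ (φ t) q)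
    {F : Type*} [NormedAddCommGroup F] [NormedSpace ℝ F] (Λ : (E →L[ℝ] E) →L[ℝ] F)
    (hid : Λ (ContinuousLinearMap.id ℝ E) = 0)
    (hΛ : ∀ t : ℝ, |t| < ε → Λ (fderiv ℝ (φ t) q) = 0) : Λ (fderiv ℝ X q) = 0 := by
  rw [← norm_le_zero_iff]
  refine le_of_forall_pos_le_add fun δ hδ => ?_
  obtain ⟨t, ht, htε, hle⟩ := exists_norm_fderiv_flow_sub_le hW hq hX hε h0 hφ hd
    (show 0 < δ / (‖Λ‖ + 1) by positivity)
  have h1 := Λ.le_opNorm (fderiv ℝ (φ t) q - ContinuousLinearMap.id ℝ E - t • fderiv ℝ X q)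
  rw [map_sub, map_sub, hid, hΛ t (by rwa [abs_of_pos ht]), map_smul, sub_zero, zero_sub,
    norm_neg, norm_smul, Real.norm_of_nonneg ht.le] at h1
  have h2 : t * ‖Λ (fderiv ℝ X q)‖ ≤ t * δ := by
    refine h1.trans ((mul_le_mul_of_nonneg_left hle (norm_nonneg _)).trans ?_)
    have : ‖Λ‖ * (δ / (‖Λ‖ + 1)) ≤ δ := by
      rw [mul_div_assoc', div_le_iff₀ (by positivity)]
      nlinarith [norm_nonneg Λ]
    nlinarith
  linarith [le_of_mul_le_mul_left h2 ht]

/-- The components of an infinitesimal CR automorphism are CR functions. -/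
theorem IsInfinitesimalCRAut.sum_wzb_eq_zero {N : ℕ} {M V : Set (CPt N)} {X : CPt N → CPt N}
    (h : IsInfinitesimalCRAut N M X V) {q : CPt N} (hq : q ∈ M ∩ V) {U : Set (CPt N)}
    {ρ : CPt N → ℝ} (hρ : DefiningFn N M U ρ q) {c : CPt N}
    (hc : ∑ l, c l * wzb l (fun w => ((ρ w : ℝ) : ℂ)) q = 0) (j : Fin N) :
    ∑ l, c l * wzb l (fun w => X w j) q = 0 := by
  obtain ⟨hV, hX, -, hflow⟩ := h
  obtain ⟨ε, hε, W, hW, hqW, hWV, φ, h0, hφ, hCR⟩ := hflow q hq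
  have hd : ∀ t : ℝ, |t| < ε → DifferentiableAt ℝ (φ t) q := fun t ht =>
    ((hCR t ht).2.1.differentiableOn (by simp)).differentiableAt (hW.mem_nhds hqW)
  let L : (CPt N →L[ℝ] CPt N) →ₗ[ℝ] ℂ :=
    { toFun := fun P => ∑ l, c l * ((1 / 2) * (P (Pi.single l 1) j +
        Complex.I * P (Pi.single l Complex.I) j))
      map_add' := fun P Q => by
        rw [← Finset.sum_add_distrib]
        exact Finset.sum_congr rfl fun l _ => by simp only [add_apply, Pi.add_apply]; ring
      map_smul' := fun t P => by
        simp only [RingHom.id_apply, Finset.smul_sum]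
        exact Finset.sum_congr rfl fun l _ => by
          simp only [smul_apply, Pi.smul_apply, Complex.real_smul]; ring }
  have hL : ∀ f : CPt N → CPt N, DifferentiableAt ℝ f q →
      L (fderiv ℝ f q) = ∑ l, c l * wzb l (fun w => f w j) q := fun f hf => by
    have : fderiv ℝ (fun w => f w j) q = (ContinuousLinearMap.proj j).comp (fderiv ℝ f q) :=
      (hasFDerivAt_pi'.1 hf.hasFDerivAt j).fderiv
    simp only [L, wzb, this]
    rfl
  have hXq : DifferentiableAt ℝ X q :=
    (hX.differentiableOn (by simp)).differentiableAt (hV.mem_nhds hq.2)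
  rw [← hL X hXq]
  refine clm_fderiv_eq_zero_of_flow hW hqW ((hX.mono hWV).of_le (by simp)) hε h0 hφ hd
    (LinearMap.toContinuousLinearMap L) ?_ ?_
  · simp only [LinearMap.coe_toContinuousLinearMap', L, LinearMap.coe_mk, AddHom.coe_mk,
      ContinuousLinearMap.id_apply]
    refine Finset.sum_eq_zero fun l _ => ?_
    rcases eq_or_ne j l with rfl | hjl
    · simp
    · simp [hjl]
  · intro t ht
    rw [LinearMap.coe_toContinuousLinearMap', hL _ (hd t ht)]
    exact (hCR t ht).2.2.2.2.2.1 q ⟨hq.1, hqW⟩ U ρ hρ c hc j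

lemma card_jetIndex_le (N d : ℕ) : Nat.card (JetIndex N (d + 1)) ≤ N * (N + d).choose d := by
  let f : JetIndex N (d + 1) → Sym (Fin (N + 1)) d × Fin N := fun s =>
    (⟨Finsupp.toMultiset (Finsupp.cons (d - s.1.1.degree) s.1.1), by
      have hs : s.1.1.degree ≤ d := Nat.lt_succ_iff.1 s.2
      have h2 : s.1.1.degree = ∑ i, s.1.1 i := Finsupp.degree_eq_sum _
      rw [Finsupp.card_toMultiset, Finsupp.sum_fintype _ _ (by simp), Fin.sum_univ_succ]
      simp only [Finsupp.cons_zero, Finsupp.cons_succ, id]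
      omega⟩, s.1.2)
  have hf : Function.Injective f := by
    intro s t h
    have h1 := Multiset.toFinsupp.symm.injective (congrArg (fun x => x.1.1) h)
    refine Subtype.ext (Prod.ext ?_ (congrArg (fun x => x.2) h :))
    ext i
    simpa using DFunLike.congr_fun h1 i.succ
  refine (Nat.card_le_card_of_injective f hf).trans ?_
  rw [Nat.card_prod, Nat.card_eq_fintype_card, Nat.card_eq_fintype_card, Fintype.card_fin,
    Sym.card_sym_eq_choose, Fintype.card_fin, mul_comm]
  refine Nat.mul_le_mul_left _ (le_of_eq ?_)
  congr 1
  omega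

lemma two_mul_mul_choose_le {n : ℕ} (hn : 1 ≤ n) :
    2 * ((n + 1) * (n + 1 + 2 * n).choose (2 * n)) ≤
      (2 * (n + 1) - 1) * Nat.choose (4 * (n + 1) - 3) (2 * (n + 1) - 2) := by
  have e1 : 2 * (n + 1) - 1 = 2 * n + 1 := by omega
  have e2 : 4 * (n + 1) - 3 = 4 * n + 1 := by omega
  have e3 : 2 * (n + 1) - 2 = 2 * n := by omega
  have e4 : n + 1 + 2 * n = 3 * n + 1 := by omega
  rw [e1, e2, e3, e4]
  have h1 : (3 * n + 2).choose (2 * n) ≤ (4 * n + 1).choose (2 * n) :=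
    Nat.choose_le_choose _ (by omega)
  have h2 := Nat.choose_mul_succ_eq (3 * n + 1) (2 * n)
  rw [show 3 * n + 1 + 1 = 3 * n + 2 from rfl, show 3 * n + 2 - 2 * n = n + 2 by omega] at h2
  refine le_trans ?_ (Nat.mul_le_mul_left _ h1)
  refine Nat.le_of_mul_le_mul_right ?_ (show 0 < n + 2 by omega)
  rw [mul_assoc (2 * n + 1), ← h2]
  have h3 : 2 * (n + 1) * (n + 2) ≤ (2 * n + 1) * (3 * n + 2) := by nlinarith
  calc _ = (3 * n + 1).choose (2 * n) * (2 * (n + 1) * (n + 2)) := by ring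
    _ ≤ (3 * n + 1).choose (2 * n) * ((2 * n + 1) * (3 * n + 2)) := Nat.mul_le_mul_left _ h3
    _ = _ := by ring

namespace HoloGraph

variable {N : ℕ} {Z : Type*} [NormedAddCommGroup Z] [InnerProductSpace ℝ Z] (H : HoloGraph N Z)

/-- `X` is tangent to the graph over `O` and its components are CR functions there. -/
def IsCRField (O : Set (CPt N)) (X : Fin N → smoothAlg N) : Prop :=
  (∀ y ∈ O, H.ρ y = 0 → ∀ c : CPt N, ∑ l, c l * wzb l (fun w => (H.ρ w : ℂ)) y = 0 →
    ∀ i, ∑ l, c l * wzb l (X i : CPt N → ℂ) y = 0) ∧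
  ∑ i, ((smoothAlg.wirtinger N).der (Sum.inl i) H.rho * X i +
    (smoothAlg.wirtinger N).der (Sum.inr i) H.rho * smoothAlg.conjHom (X i)) ∈ H.vanish O

variable {H}

lemma IsCRField.mono {O O' : Set (CPt N)} (h : O' ⊆ O) {X : Fin N → smoothAlg N}
    (hX : H.IsCRField O X) : H.IsCRField O' X :=
  ⟨fun y hy => hX.1 y (h hy), fun y hy => hX.2 y (h hy)⟩

lemma IsCRField.sum {O : Set (CPt N)} {ι : Type*} [Fintype ι] {X : ι → Fin N → smoothAlg N}
    (hX : ∀ k, H.IsCRField O (X k)) (c : ι → ℝ) :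
    H.IsCRField O (fun i => ∑ k, (c k : ℂ) • X k i) := by
  constructor
  · intro y hy hρ b hb i
    have e : ∀ l, wzb l ((∑ k, (c k : ℂ) • X k i : smoothAlg N) : CPt N → ℂ) y =
        ∑ k, (c k : ℂ) * wzb l (X k i : CPt N → ℂ) y := fun l => by
      rw [← smoothAlg.coe_der_inr, ← smoothAlg.ev_apply, map_sum, map_sum]
      refine Finset.sum_congr rfl fun k _ => ?_
      rw [Derivation.map_smul, map_smul, smul_eq_mul]
      rfl
    simp only [e, Finset.mul_sum]
    rw [Finset.sum_comm]
    refine Finset.sum_eq_zero fun k _ => ?_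
    rw [← mul_zero (c k : ℂ), ← (hX k).1 y hy hρ b hb i, Finset.mul_sum]
    exact Finset.sum_congr rfl fun l _ => by ring
  · have e : ∀ i, smoothAlg.conjHom (∑ k, (c k : ℂ) • X k i) =
        ∑ k, (c k : ℂ) • smoothAlg.conjHom (X k i) := fun i => by
      rw [map_sum]
      refine Finset.sum_congr rfl fun k _ => Subtype.ext (funext fun y => ?_)
      change conj ((c k : ℂ) * _) = (c k : ℂ) * conj _
      rw [map_mul, Complex.conj_ofReal]
    have e2 : ∑ i, ((smoothAlg.wirtinger N).der (Sum.inl i) H.rho * ∑ k, (c k : ℂ) • X k i +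
        (smoothAlg.wirtinger N).der (Sum.inr i) H.rho *
          smoothAlg.conjHom (∑ k, (c k : ℂ) • X k i)) =
        ∑ k, (c k : ℂ) • ∑ i, ((smoothAlg.wirtinger N).der (Sum.inl i) H.rho * X k i +
          (smoothAlg.wirtinger N).der (Sum.inr i) H.rho * smoothAlg.conjHom (X k i)) := by
      simp only [e, Finset.mul_sum, ← Finset.sum_add_distrib, Finset.smul_sum, smul_add,
        mul_smul_comm]
      exact Finset.sum_comm
    rw [e2]
    refine Ideal.sum_mem _ fun k _ => ?_
    rw [Algebra.smul_def]
    exact Ideal.mul_mem_left _ _ (hX k).2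

lemma IsCRField.der_mem_vanish {O : Set (CPt N)} {X : Fin N → smoothAlg N}
    (hX : H.IsCRField O X) (i j : Fin N) : H.frame.S.der (Sum.inr j) (X i) ∈ H.vanish O := by
  intro y hy hρ
  have hg : (H.g : CPt N → ℂ) y * wzb H.m (fun w => (H.ρ w : ℂ)) y = 1 :=
    congrFun (congrArg Subtype.val H.g_mul) y
  have hs : ∀ u : CPt N → ℂ, ∑ l, (Pi.single j 1 - Pi.single H.m ((H.g : CPt N → ℂ) y *
      wzb j (fun w => (H.ρ w : ℂ)) y) : CPt N) l * wzb l u y =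
      wzb j u y - (H.g : CPt N → ℂ) y * wzb j (fun w => (H.ρ w : ℂ)) y * wzb H.m u y := fun u => by
    simp [sub_mul, Finset.sum_sub_distrib, Pi.single_apply]
  have := hX.1 y hy hρ _ (by rw [hs]; linear_combination (-wzb j (fun w => (H.ρ w : ℂ)) y) * hg) i
  rw [hs] at this
  rw [frame_S_der]
  exact this

/-- Among more CR fields than there are real jet parameters there is a linear relation near the
base point. -/
theorem exists_linear_relation [FiniteDimensional ℝ Z] (hN : 2 ≤ N) {M : Set (CPt N)}
    (hnd : ¬ HoloDegenerateAt N M H.p) {O : Set (CPt N)} (hO : IsOpen O) (hp : H.p ∈ O)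
    (hM : ∀ y ∈ O, y ∈ M ↔ H.ρ y = 0)
    (hmin : ¬ ∃ (f : Z → ℝ) (r : ℝ), 0 < r ∧ f 0 = 0 ∧
      ∀ z ∈ Metric.ball (0 : Z) r, HasFDerivAt f (H.crGraph.A (z, f z)) z)
    {m : ℕ} (hm : 2 * Nat.card (JetIndex N (2 * (N - 1) + 1)) < m)
    {X : Fin m → Fin N → smoothAlg N} (hX : ∀ k, H.IsCRField O (X k)) :
    ∃ c : Fin m → ℝ, c ≠ 0 ∧ ∀ᶠ y in 𝓝 H.p, H.ρ y = 0 →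
      ∀ j, ∑ k, (c k : ℂ) * (X k j : CPt N → ℂ) y = 0 := by
  have hp0 : H.proj H.p = 0 := by rw [← H.Γ_zero, H.proj_Γ]
  have hprop := H.crGraph.eventually_mem_tsupport (hO.preimage H.contDiff_Γ.continuous)
    (show (0 : Z × ℝ) ∈ H.Γ ⁻¹' O by rwa [Set.mem_preimage, H.Γ_zero]) hmin
  obtain ⟨G, hG, hGo, h0G⟩ := eventually_nhds_iff.1 hprop
  obtain ⟨q, hq, hρq, O₂, hO₂, hqO₂, hsub, hsys⟩ := H.exists_closed_system hN hnd hO hp hM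
    (hO.inter (hGo.preimage H.contDiff_proj.continuous))
    ⟨hp, by rwa [Set.mem_preimage, hp0]⟩
  have := Fintype.ofFinite (JetIndex N (2 * (N - 1) + 1))
  obtain ⟨c, hc, k₀, hk₀⟩ := Fintype.not_linearIndependent_iff.1
    (fun hli : LinearIndependent ℝ (fun k : Fin m =>
      (fun s => (H.frame.jetFn (X k) s : CPt N → ℂ) q : JetIndex N (2 * (N - 1) + 1) → ℂ)) => by
      have h1 := hli.fintype_card_le_finrank
      rw [Module.finrank_pi_fintype, Fintype.card_fin] at h1
      simp only [Complex.finrank_real_complex, Finset.sum_const, Finset.card_univ, smul_eq_mul,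
        ← Nat.card_eq_fintype_card] at h1
      omega)
  refine ⟨c, fun h => hk₀ (congrFun h k₀), ?_⟩
  set Y : Fin N → smoothAlg N := fun i => ∑ k, (c k : ℂ) • X k i with hY
  have hYO : H.IsCRField O Y := IsCRField.sum hX c
  have hY2 : H.IsCRField O₂ Y := hYO.mono fun y hy => (hsub hy).1
  have hYapp : ∀ j y, (Y j : CPt N → ℂ) y = ∑ k, (c k : ℂ) * (X k j : CPt N → ℂ) y :=
    fun j y => by
    rw [← smoothAlg.ev_apply, hY, map_sum]
    exact Finset.sum_congr rfl fun k _ => by rw [map_smul, smul_eq_mul, smoothAlg.ev_apply]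
  have hjet : ∀ s : JetIndex N (2 * (N - 1) + 1), (H.frame.jetFn Y s : CPt N → ℂ) q = 0 :=
    fun s => by
    have h1 : H.frame.jetFn Y s = ∑ k, (c k : ℂ) • H.frame.jetFn (X k) s := by
      simp only [CRFrame.jetFn, hY]
      have := map_sum (AddMonoidHom.mk' ((H.frame.S.comp Sum.inl).pow s.1.1)
        ((H.frame.S.comp Sum.inl).pow_add s.1.1)) (fun k => (c k : ℂ) • X k s.1.2) Finset.univ
      refine this.trans (Finset.sum_congr rfl fun k _ => ?_)
      exact (H.frame.S.comp Sum.inl).pow_smul _ _ _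
    have h2 := congrFun hc s
    rw [Finset.sum_apply] at h2
    rw [h1, ← smoothAlg.ev_apply, map_sum, ← Pi.zero_apply (M := fun _ => ℂ) s, ← h2]
    exact Finset.sum_congr rfl fun k _ => by
      rw [map_smul, smul_eq_mul, smoothAlg.ev_apply, Pi.smul_apply, Complex.real_smul]
  have hvan := H.eventually_eq_zero_of_jet hO₂ hqO₂ hρq
    (hsys Y hY2.der_mem_vanish hY2.2) hjet
  have hzero : ∀ j, (Y j : CPt N → ℂ) ∘ H.Γ =ᶠ[𝓝 0] 0 := fun j => by
    rw [← notMem_tsupport_iff_eventuallyEq]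
    intro h0
    refine notMem_tsupport_iff_eventuallyEq.2 ?_ (hG _ hq.2 _
      ((smoothAlg.contDiff (Y j)).comp H.contDiff_Γ)
      (H.isCR_comp_Γ (smoothAlg.contDiff (Y j)) fun y hy hρ b hb => hYO.1 y hy hρ b hb j) h0)
    filter_upwards [hvan] with x hx
    exact hx j
  have htend : Filter.Tendsto H.proj (𝓝 H.p) (𝓝 0) := by
    rw [← hp0]; exact H.contDiff_proj.continuous.tendsto _
  filter_upwards [htend.eventually (Filter.eventually_all.2 hzero)] with y hy hρ j
  have := hy j
  rw [Function.comp_apply, H.Γ_proj hρ, hYapp] at this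
  exact this

end HoloGraph

lemma wzb_congr {N : ℕ} {u v : CPt N → ℂ} {q : CPt N} (h : u =ᶠ[𝓝 q] v) (l : Fin N) :
    wzb l u q = wzb l v q := by
  rw [wzb, wzb, h.fderiv_eq]

lemma HoloGraph.definingFn {N : ℕ} {Z : Type*} [NormedAddCommGroup Z] [InnerProductSpace ℝ Z]
    (H : HoloGraph N Z) {M O : Set (CPt N)} (hO : IsOpen O) (hM : ∀ y ∈ O, y ∈ M ↔ H.ρ y = 0)
    {q : CPt N} (hq : q ∈ O) : DefiningFn N M O H.ρ q := by
  refine ⟨hO, hq, H.contDiff_ρ.contDiffOn, Set.ext fun z => ?_, fun z _ => H.fderiv_ρ_ne_zero z⟩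
  rw [Set.mem_inter_iff, Set.mem_ofPred_eq, and_comm]
  exact and_congr_right fun hz => hM z hz

/-- Global smooth functions agreeing near `p` with the components of an infinitesimal CR
automorphism form a CR field. -/
lemma IsInfinitesimalCRAut.isCRField {N : ℕ} {Z : Type*} [NormedAddCommGroup Z]
    [InnerProductSpace ℝ Z] (H : HoloGraph N Z) {M V O : Set (CPt N)} {X : CPt N → CPt N}
    (hX : IsInfinitesimalCRAut N M X V) (hO : IsOpen O) (hOV : O ⊆ V)
    (hM : ∀ y ∈ O, y ∈ M ↔ H.ρ y = 0) {Y : Fin N → smoothAlg N}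
    (hY : ∀ y ∈ O, ∀ j, (Y j : CPt N → ℂ) y = X y j) : H.IsCRField O Y := by
  constructor
  · intro y hy hρ c hc j
    have e : ∀ l, wzb l (Y j : CPt N → ℂ) y = wzb l (fun w => X w j) y :=
      wzb_congr (Filter.eventually_of_mem (hO.mem_nhds hy) fun w hw => hY w hw j)
    simp only [e]
    exact hX.sum_wzb_eq_zero ⟨(hM y hy).2 hρ, hOV hy⟩ (H.definingFn hO hM hy) hc j
  · intro y hy hρ
    have ht := hX.2.2.1 y ⟨(hM y hy).2 hρ, hOV hy⟩ O H.ρ (H.definingFn hO hM hy)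
    have h1 := fderiv_ofReal_apply (H.contDiff_ρ.differentiable (by simp) y) (X y)
    rw [fderiv_eq_sum_wirtinger, ht, Complex.ofReal_zero] at h1
    rw [← smoothAlg.ev_apply, map_sum, ← h1]
    refine Finset.sum_congr rfl fun l _ => ?_
    rw [map_add, map_mul, map_mul, mul_comm, mul_comm (conj _), ← hY y hy l]
    rfl

/-- Theorem 3.  If `M ⊂ ℂ^N` is a smooth real hypersurface which is
holomorphically nondegenerate and minimal at `p₀`, then any finite family of infinitesimal
CR automorphisms near `p₀` whose germs at `p₀` are linearly independent over `ℝ` has at most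
`(2N−1)·C(4N−3, 2N−2)` members, i.e. `dim_ℝ aut(M, p₀) ≤ (2N−1)·C(4N−3, 2N−2)`. -/
theorem statement2 (N : ℕ) (hN : 1 ≤ N) (M : Set (CPt N)) (hM : IsHypersurface N M)
    (p₀ : CPt N) (hp₀ : p₀ ∈ M)
    (hnd : ¬ HoloDegenerateAt N M p₀)
    (hmin : ¬ ContainsComplexHypersurfaceThrough N M p₀) :
    ∀ (m : ℕ) (X : Fin m → CPt N → CPt N) (V : Set (CPt N)),
      p₀ ∈ V → (∀ i, IsInfinitesimalCRAut N M (X i) V) →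
      (∀ c : Fin m → ℝ,
        (∃ W : Set (CPt N), IsOpen W ∧ p₀ ∈ W ∧ ∀ z ∈ M ∩ W, (∑ i, c i • X i z) = 0) →
        c = 0) →
      m ≤ (2 * N - 1) * Nat.choose (4 * N - 3) (2 * N - 2) := by
  intro m X V hV hX hind
  obtain ⟨n, rfl⟩ : ∃ n, N = n + 1 := ⟨N - 1, by omega⟩
  rcases Nat.eq_zero_or_pos n with rfl | hn
  · refine absurd ⟨fun _ => p₀, 1, one_pos, differentiableOn_const _, rfl, fun _ _ => hp₀, ?_⟩ hmin
    exact fun a b _ => funext fun i : Fin 0 => i.elim0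
  by_contra! hlt
  have hcard := (Nat.mul_le_mul_left 2 (card_jetIndex_le (n + 1) (2 * n))).trans
    (two_mul_mul_choose_le hn)
  obtain ⟨U, ρ, hρ⟩ := hM p₀ hp₀
  obtain ⟨H, rfl, ⟨e, he⟩, O, hO, hpO, hMO⟩ := exists_holoGraph hp₀ hρ
  have hVo : IsOpen V := (hX ⟨0, by omega⟩).1
  have hext : ∀ k j, ∃ g : CPt (n + 1) → ℂ, ContDiff ℝ ∞ g ∧ HasCompactSupport g ∧
      g =ᶠ[𝓝 H.p] fun y => X k y j := fun k j =>
    exists_contDiff_eventuallyEq (hVo.mem_nhds hV) (contDiffOn_pi.1 (hX k).2.1 j)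
  choose g hg _ hgX using hext
  obtain ⟨O', hO'X, hO', hpO'⟩ := eventually_nhds_iff.1
    (Filter.eventually_all.2 fun k => Filter.eventually_all.2 fun j => hgX k j)
  have hS : IsOpen (O ∩ V ∩ O') := (hO.inter hVo).inter hO'
  obtain ⟨c, hc, hcX⟩ := H.exists_linear_relation (m := m) (by omega) hnd hS ⟨⟨hpO, hV⟩, hpO'⟩
    (fun y hy => hMO y hy.1.1)
    (fun hf => hmin (H.containsComplexHypersurfaceThrough hO hpO
      (fun y hy hy' => (hMO y hy).2 hy') e he hf))
    (lt_of_le_of_lt hcard hlt) (X := fun k j => ⟨g k j, hg k j⟩)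
    (fun k => (hX k).isCRField H hS (fun y hy => hy.1.2) (fun y hy => hMO y hy.1.1)
      fun y hy j => hO'X y hy.2 k j)
  obtain ⟨W, hW, hWo, hpW⟩ := eventually_nhds_iff.1 hcX
  refine hc (hind c ⟨W ∩ (O ∩ V ∩ O'), hWo.inter hS, ⟨hpW, ⟨hpO, hV⟩, hpO'⟩, fun z hz => ?_⟩)
  ext j
  rw [Finset.sum_apply, Pi.zero_apply, ← hW z hz.2.1 ((hMO z hz.2.2.1.1).1 hz.1) j]
  refine Finset.sum_congr rfl fun k _ => ?_
  rw [Pi.smul_apply, Complex.real_smul]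
  exact congrArg _ (hO'X z hz.2.2.2 k j).symm
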